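/- If p is a positive even integer, then the operator norm of the Kak–Hilbert transform 𝓚 on ℓ^p(ℤ) equals C_p = cot(π/(2p)). -/

import Mathlib

open scoped BigOperators
open MeasureTheory

noncomputable section

/-- The ℓ^p norm of a doubly infinite complex sequence. -/
def lpNorm (p : ℝ) (a : ℤ → ℂ) : ℝ := (∑' n : ℤ, ‖a n‖ ^ p) ^ (1 / p)

/-- Membership in ℓ^p(ℤ). -/
def MemLpZ (p : ℝ) (a : ℤ → ℂ) : Prop := Summable fun n : ℤ => ‖a n‖ ^ p

/-- The operator norm of an operator on ℓ^p(ℤ): the least admissible constant. -/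
def opNormOn (p : ℝ) (T : (ℤ → ℂ) → ℤ → ℂ) : ℝ :=
  sInf {C : ℝ | 0 ≤ C ∧ ∀ a : ℤ → ℂ, MemLpZ p a → lpNorm p (T a) ≤ C * lpNorm p a}

/-- The Riesz–Titchmarsh operator: 𝓡 a_n = (1/π) Σ_{m ∈ ℤ} a_{n-m}/(m + 1/2). -/
def RT (a : ℤ → ℂ) (n : ℤ) : ℂ :=
  (1 / (Real.pi : ℂ)) * ∑' m : ℤ, a (n - m) / ((m : ℂ) + 1 / 2)

/-- The Kak–Hilbert transform: 𝓚 a_n = (2/π) Σ_{m odd} a_{n-m}/m. -/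
def KT (a : ℤ → ℂ) (n : ℤ) : ℂ :=
  (2 / (Real.pi : ℂ)) * ∑' m : {m : ℤ // Odd m}, a (n - (m : ℤ)) / ((m : ℤ) : ℂ)

/-- The discrete Hilbert transform: 𝓗₀ a_n = (1/π) Σ_{m ≠ 0} a_{n-m}/m. -/
def H0T (a : ℤ → ℂ) (n : ℤ) : ℂ :=
  (1 / (Real.pi : ℂ)) * ∑' m : {m : ℤ // m ≠ 0}, a (n - (m : ℤ)) / ((m : ℤ) : ℂ)

/-- The operator 𝓗: 𝓗 a_n = (2/π) Σ_{m even, m ≠ 0} a_{n-m}/m. -/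
def HT (a : ℤ → ℂ) (n : ℤ) : ℂ :=
  (2 / (Real.pi : ℂ)) *
    ∑' m : {m : ℤ // Even (m : ℤ) ∧ (m : ℤ) ≠ 0}, a (n - (m : ℤ)) / ((m : ℤ) : ℂ)

/-- The operator 𝓘: 𝓘 a_n = (4/π²) Σ_{m odd} a_{n-m}/m². -/
def IT (a : ℤ → ℂ) (n : ℤ) : ℂ :=
  (4 / (Real.pi : ℂ) ^ 2) * ∑' m : {m : ℤ // Odd m}, a (n - (m : ℤ)) / ((m : ℤ) : ℂ) ^ 2

/-- p* = max(p, p/(p-1)). -/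
def pstar (p : ℝ) : ℝ := max p (p / (p - 1))

/-- C_p = cot(π/(2 p*)). -/
def Cconst (p : ℝ) : ℝ := Real.cot (Real.pi / (2 * pstar p))


namespace KakHilbert

lemma hasDerivAt_intervalIntegral_of_continuous {f f' : ℝ → ℝ → ℝ} (a b : ℝ)
    (hf : Continuous (Function.uncurry f)) (hf' : Continuous (Function.uncurry f'))
    (hd : ∀ x t, HasDerivAt (fun y => f y t) (f' x t) x) (x₀ : ℝ) :
    HasDerivAt (fun x => ∫ t in a..b, f x t) (∫ t in a..b, f' x₀ t) x₀ := by
  obtain ⟨C, hC⟩ := ((isCompact_closedBall x₀ 1).prod (isCompact_uIcc (a := a) (b := b))).exists_bound_of_continuousOn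
    hf'.continuousOn
  refine (intervalIntegral.hasDerivAt_integral_of_dominated_loc_of_deriv_le (bound := fun _ => C)
    (Metric.closedBall_mem_nhds x₀ one_pos) (Filter.Eventually.of_forall fun x => ?_) ?_ ?_ ?_ ?_ ?_).2
  · exact (hf.comp (Continuous.prodMk_right x)).aestronglyMeasurable
  · exact (hf.comp (Continuous.prodMk_right x₀)).intervalIntegrable _ _
  · exact (hf'.comp (Continuous.prodMk_right x₀)).aestronglyMeasurable
  · exact Filter.Eventually.of_forall fun t ht x hx => hC (x, t) ⟨hx, Set.uIoc_subset_uIcc ht⟩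
  · exact intervalIntegrable_const
  · exact Filter.Eventually.of_forall fun t _ x _ => hd x t

/-- Sub-mean value inequality over the unit circle for a `C²` function with nonnegative Laplacian. -/
lemma subMean {u : ℂ → ℝ} (hu : ContDiff ℝ 2 u)
    (hΔ : ∀ z v, 0 ≤ fderiv ℝ (fderiv ℝ u) z v v
      + fderiv ℝ (fderiv ℝ u) z (Complex.I * v) (Complex.I * v)) :
    2 * Real.pi * u 0 ≤ ∫ θ in (0 : ℝ)..2 * Real.pi, u (Complex.exp (θ * Complex.I)) := by
  set e : ℝ → ℂ := fun θ => Complex.exp (θ * Complex.I) with he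
  have hec : Continuous e := by fun_prop
  have hde : ∀ θ, HasDerivAt e (Complex.I * e θ) θ := fun θ => by
    have := ((Complex.ofRealCLM.hasDerivAt (x := θ)).mul_const Complex.I).cexp
    simpa [he, mul_comm] using this
  have hdu : ContDiff ℝ 1 (fderiv ℝ u) := hu.fderiv_right (by norm_num)
  have hc1 : Continuous (fderiv ℝ u) := hdu.continuous
  have hc2 : Continuous (fderiv ℝ (fderiv ℝ u)) := hdu.continuous_fderiv (by norm_num)
  have h1 : ∀ z, HasFDerivAt u (fderiv ℝ u z) z := fun z =>
    (hu.differentiable (by norm_num) z).hasFDerivAt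
  have h2 : ∀ z, HasFDerivAt (fderiv ℝ u) (fderiv ℝ (fderiv ℝ u) z) z := fun z =>
    (hdu.differentiable (by norm_num) z).hasFDerivAt
  have hρ : ∀ (ρ : ℝ) (v : ℂ), HasDerivAt (fun ρ : ℝ => (ρ : ℂ) * v) v ρ := fun ρ v => by
    simpa using (Complex.ofRealCLM.hasDerivAt (x := ρ)).mul_const v
  generalize fderiv ℝ (fderiv ℝ u) = D' at *
  generalize fderiv ℝ u = D at *
  have hr : ∀ ρ θ : ℝ, HasDerivAt (fun ρ : ℝ => u (ρ * e θ)) (D (ρ * e θ) (e θ)) ρ :=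
    fun ρ θ => (h1 _).comp_hasDerivAt ρ (hρ ρ (e θ))
  set P : ℝ → ℝ → ℝ := fun ρ θ => ρ * D (ρ * e θ) (e θ) with hP
  set Q : ℝ → ℝ → ℝ := fun ρ θ => D (ρ * e θ) (Complex.I * e θ) with hQ
  set P' : ℝ → ℝ → ℝ := fun ρ θ => D (ρ * e θ) (e θ)
    + ρ * D' (ρ * e θ) (e θ) (e θ) with hP'
  set Q' : ℝ → ℝ → ℝ := fun ρ θ => ρ * D' (ρ * e θ) (Complex.I * e θ)
    (Complex.I * e θ) - D (ρ * e θ) (e θ) with hQ'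
  have hPd : ∀ ρ θ, HasDerivAt (fun ρ => P ρ θ) (P' ρ θ) ρ := fun ρ θ => by
    have h3 : HasDerivAt (fun ρ : ℝ => D (ρ * e θ)) (D' (ρ * e θ) (e θ)) ρ :=
      (h2 (ρ * e θ)).comp_hasDerivAt ρ (hρ ρ (e θ))
    have h4 : HasDerivAt (fun ρ : ℝ => D (ρ * e θ) (e θ)) (D' (ρ * e θ) (e θ) (e θ)) ρ := by
      simpa using h3.clm_apply (hasDerivAt_const ρ (e θ))
    have h7 := (hasDerivAt_id' ρ).fun_mul h4
    rw [one_mul] at h7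
    exact h7
  have hQd : ∀ ρ θ, HasDerivAt (fun θ => Q ρ θ) (Q' ρ θ) θ := fun ρ θ => by
    have h3 : HasDerivAt (fun θ => (ρ : ℂ) * e θ) (ρ • (Complex.I * e θ)) θ := by
      simpa using (hde θ).const_mul (ρ : ℂ)
    have h5 : HasDerivAt (fun θ : ℝ => D (ρ * e θ)) (D' (ρ * e θ) (ρ • (Complex.I * e θ))) θ :=
      (h2 (ρ * e θ)).comp_hasDerivAt θ h3
    have h6 := h5.clm_apply ((hde θ).const_mul Complex.I)
    have h4 : Complex.I * (Complex.I * e θ) = - e θ := by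
      rw [← mul_assoc, Complex.I_mul_I]; ring
    rw [h4, map_smul, map_neg] at h6
    exact h6
  have hcz : Continuous fun x : ℝ × ℝ => (x.1 : ℂ) * e x.2 := by fun_prop
  have hce : Continuous fun x : ℝ × ℝ => e x.2 := by fun_prop
  have hD1 : Continuous fun x : ℝ × ℝ => D ((x.1 : ℂ) * e x.2) (e x.2) :=
    (hc1.comp hcz).clm_apply hce
  have hPc : Continuous (Function.uncurry P) := continuous_fst.mul hD1
  have hP'c : Continuous (Function.uncurry P') :=
    hD1.add (continuous_fst.mul (((hc2.comp hcz).clm_apply hce).clm_apply hce))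
  have hQ'c : Continuous (Function.uncurry Q') :=
    (continuous_fst.mul (((hc2.comp hcz).clm_apply (continuous_const.mul hce)).clm_apply
      (continuous_const.mul hce))).sub hD1
  have hM := hasDerivAt_intervalIntegral_of_continuous 0 (2 * Real.pi) hPc hP'c hPd
  have hm := hasDerivAt_intervalIntegral_of_continuous (f := fun ρ θ => u (ρ * e θ))
    (f' := fun ρ θ => D (ρ * e θ) (e θ))
    0 (2 * Real.pi) (hu.continuous.comp hcz) hD1 hr
  have hQ0 : ∀ ρ, ∫ θ in (0 : ℝ)..2 * Real.pi, Q' ρ θ = 0 := fun ρ => by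
    rw [intervalIntegral.integral_eq_sub_of_hasDerivAt (fun θ _ => hQd ρ θ)
      ((hQ'c.comp (Continuous.prodMk_right ρ)).intervalIntegrable _ _)]
    simp [hQ, he]
  have hM' : ∀ ρ, 0 ≤ ρ → 0 ≤ ∫ θ in (0 : ℝ)..2 * Real.pi, P' ρ θ := fun ρ h0 => by
    have : ∫ θ in (0 : ℝ)..2 * Real.pi, P' ρ θ
        = ∫ θ in (0 : ℝ)..2 * Real.pi, (P' ρ θ + Q' ρ θ) := by
      have hi1 : IntervalIntegrable (fun θ => P' ρ θ) volume 0 (2 * Real.pi) :=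
        (hP'c.comp (Continuous.prodMk_right ρ)).intervalIntegrable _ _
      have hi2 : IntervalIntegrable (fun θ => Q' ρ θ) volume 0 (2 * Real.pi) :=
        (hQ'c.comp (Continuous.prodMk_right ρ)).intervalIntegrable _ _
      rw [intervalIntegral.integral_add hi1 hi2, hQ0, add_zero]
    rw [this]
    refine intervalIntegral.integral_nonneg (by positivity) fun θ _ => ?_
    have := mul_nonneg h0 (hΔ (ρ * e θ) (e θ))
    simp only [hP', hQ']
    linarith
  have hmono : MonotoneOn (fun ρ => ∫ θ in (0 : ℝ)..2 * Real.pi, P ρ θ) (Set.Ici 0) := by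
    refine monotoneOn_of_deriv_nonneg (convex_Ici 0)
      (fun x _ => (hM x).continuousAt.continuousWithinAt)
      (fun x _ => (hM x).differentiableAt.differentiableWithinAt) fun x hx => ?_
    rw [(hM x).deriv]
    exact hM' x (interior_subset hx)
  have hMnn : ∀ ρ : ℝ, 0 ≤ ρ → 0 ≤ ρ * ∫ θ in (0 : ℝ)..2 * Real.pi, D (ρ * e θ) (e θ) :=
    fun ρ h0 => by
      have := hmono (Set.mem_Ici.2 le_rfl) (Set.mem_Ici.2 h0) h0
      simpa [hP] using this
  have hmono2 : MonotoneOn (fun ρ : ℝ => ∫ θ in (0 : ℝ)..2 * Real.pi, u (ρ * e θ)) (Set.Ici 0) := by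
    refine monotoneOn_of_deriv_nonneg (convex_Ici 0)
      (fun x _ => (hm x).continuousAt.continuousWithinAt)
      (fun x _ => (hm x).differentiableAt.differentiableWithinAt) fun x hx => ?_
    rw [(hm x).deriv]
    rw [interior_Ici] at hx
    exact nonneg_of_mul_nonneg_right (hMnn x (le_of_lt hx)) hx
  have := hmono2 (Set.mem_Ici.2 le_rfl) (Set.mem_Ici.2 zero_le_one) zero_le_one
  simpa using this

lemma fderiv_fderiv_apply_of_line {u : ℂ → ℝ} (hu : ContDiff ℝ 2 u) {z v : ℂ} {g₁ : ℝ → ℝ} {c : ℝ}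
    (h1 : ∀ τ : ℝ, HasDerivAt (fun τ : ℝ => u (z + τ * v)) (g₁ τ) τ) (h2 : HasDerivAt g₁ c 0) :
    fderiv ℝ (fderiv ℝ u) z v v = c := by
  have hdu : ContDiff ℝ 1 (fderiv ℝ u) := hu.fderiv_right (by norm_num)
  have hl : ∀ τ : ℝ, HasDerivAt (fun τ : ℝ => z + τ * v) v τ := fun τ => by
    simpa using ((Complex.ofRealCLM.hasDerivAt (x := τ)).mul_const v).const_add z
  have hg : g₁ = fun τ : ℝ => fderiv ℝ u (z + τ * v) v := by
    funext τ
    exact (h1 τ).unique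
      ((hu.differentiable (by norm_num) (z + τ * v)).hasFDerivAt.comp_hasDerivAt τ (hl τ))
  have h3 := (hdu.differentiable (by norm_num) (z + (0 : ℝ) * v)).hasFDerivAt
  generalize fderiv ℝ (fderiv ℝ u) = D' at *
  generalize fderiv ℝ u = D at *
  have h4 : HasDerivAt (fun τ : ℝ => D (z + τ * v)) (D' (z + (0 : ℝ) * v) v) 0 :=
    h3.comp_hasDerivAt 0 (hl 0)
  have h5 := h4.clm_apply (hasDerivAt_const 0 v)
  rw [hg] at h2
  simpa using h5.unique h2

lemma re_cpow_sub_two_mul_re_le {ζ : ℂ} (hζ : 0 < ζ.re) {r : ℝ} (hr : 1 < r) (hr2 : r ≤ 2) :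
    (r - 1) * (ζ ^ ((r - 2 : ℝ) : ℂ)).re ≤ (ζ ^ ((r - 1 : ℝ) : ℂ)).re / ζ.re := by
  rw [le_div_iff₀ hζ, Complex.cpow_ofReal_re, Complex.cpow_ofReal_re]
  have hn : 0 < ‖ζ‖ := norm_pos_iff.2 fun h => by simp [h] at hζ
  have harg : |ζ.arg| < Real.pi / 2 := Complex.abs_arg_lt_pi_div_two_iff.2 (Or.inl hζ)
  set α := ζ.arg
  have h1 : ζ.re = ‖ζ‖ * Real.cos α := (Complex.norm_mul_cos_arg ζ).symm
  have h2 : ‖ζ‖ ^ (r - 1) = ‖ζ‖ ^ (r - 2) * ‖ζ‖ := by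
    rw [← Real.rpow_add_one hn.ne']; ring_nf
  have hcos : 0 ≤ Real.cos α := Real.cos_nonneg_of_mem_Icc
    ⟨by linarith [(abs_lt.1 harg).1], by linarith [(abs_lt.1 harg).2]⟩
  have h3 : Real.cos α ≤ Real.cos (α * (r - 1)) := by
    rw [← Real.cos_abs α, ← Real.cos_abs (α * (r - 1)), abs_mul, abs_of_pos (by linarith : 0 < r - 1)]
    apply Real.cos_le_cos_of_nonneg_of_le_pi (by positivity) (by linarith [Real.pi_pos])
    nlinarith [abs_nonneg α]
  have h4 : (r - 1) * Real.cos (α * (r - 2)) ≤ 1 := by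
    nlinarith [Real.cos_le_one (α * (r - 2))]
  rw [h1, h2]
  have : (r - 1) * Real.cos (α * (r - 2)) * Real.cos α ≤ Real.cos (α * (r - 1)) := by nlinarith
  calc (r - 1) * (‖ζ‖ ^ (r - 2) * Real.cos (α * (r - 2))) * (‖ζ‖ * Real.cos α)
      = ‖ζ‖ ^ (r - 2) * ‖ζ‖ * ((r - 1) * Real.cos (α * (r - 2)) * Real.cos α) := by ring
    _ ≤ _ := by gcongr

/-- First and second derivatives of `Re ((√(x² + ε²) + i y) ^ r)` along a curve. -/
lemma hasDerivAt_re_cpow_regularized {x y x₁ y₁ : ℝ → ℝ} {x₂ y₂ ε r : ℝ} (hε : 0 < ε)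
    (hx : ∀ t, HasDerivAt x (x₁ t) t) (hy : ∀ t, HasDerivAt y (y₁ t) t)
    (hx₁ : HasDerivAt x₁ x₂ 0) (hy₁ : HasDerivAt y₁ y₂ 0) :
    let S : ℝ → ℝ := fun t => √(x t ^ 2 + ε ^ 2)
    let ζ : ℝ → ℂ := fun t => S t + y t * Complex.I
    let g₁ : ℝ → ℝ := fun t =>
      ((r : ℂ) * ζ t ^ ((r - 1 : ℝ) : ℂ) * ((x t * x₁ t / S t : ℝ) + y₁ t * Complex.I)).re
    (∀ t, HasDerivAt (fun t => (ζ t ^ (r : ℂ)).re) (g₁ t) t) ∧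
    HasDerivAt g₁ (r * ((r - 1) * (ζ 0 ^ ((r - 2 : ℝ) : ℂ) *
        ((x 0 * x₁ 0 / S 0 : ℝ) + y₁ 0 * Complex.I) ^ 2).re
      + (ζ 0 ^ ((r - 1 : ℝ) : ℂ) * (((x₁ 0 ^ 2 + x 0 * x₂) / S 0 - x 0 ^ 2 * x₁ 0 ^ 2 / S 0 ^ 3 : ℝ)
        + y₂ * Complex.I)).re)) 0 := by
  intro S ζ g₁
  have hpos : ∀ t, 0 < x t ^ 2 + ε ^ 2 := fun t => by positivity
  have hS : ∀ t, 0 < S t := fun t => Real.sqrt_pos.2 (hpos t)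
  have hζre : ∀ t, (ζ t).re = S t := fun t => by simp [ζ]
  have hslit : ∀ t, ζ t ∈ Complex.slitPlane := fun t => Or.inl (by rw [hζre]; exact hS t)
  have hSd : ∀ t, HasDerivAt S (x t * x₁ t / S t) t := fun t => by
    have := (((hx t).fun_pow 2).add_const (ε ^ 2)).sqrt (hpos t).ne'
    convert this using 1
    have h0 : √(x t ^ 2 + ε ^ 2) ≠ 0 := (hS t).ne'
    simp only [S]
    field_simp
    push_cast
    ring
  have hζd : ∀ t, HasDerivAt ζ ((x t * x₁ t / S t : ℝ) + y₁ t * Complex.I) t := fun t =>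
    (hSd t).ofReal_comp.add ((hy t).ofReal_comp.mul_const Complex.I)
  have hre : ∀ {f : ℝ → ℂ} {f' : ℂ} {t : ℝ}, HasDerivAt f f' t →
      HasDerivAt (fun t => (f t).re) f'.re t := fun h =>
    Complex.reCLM.hasFDerivAt.comp_hasDerivAt _ h
  have hpow : ∀ (s : ℝ) t, HasDerivAt (fun t => ζ t ^ (s : ℂ))
      ((s : ℂ) * ζ t ^ ((s - 1 : ℝ) : ℂ) * ((x t * x₁ t / S t : ℝ) + y₁ t * Complex.I)) t :=
    fun s t => by
      have h := (hasDerivAt_id (ζ t)).cpow_const (c := (s : ℂ)) (hslit t)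
      have h' := h.comp t (hζd t)
      simpa [Function.comp_def] using h'
  refine ⟨fun t => hre (hpow r t), ?_⟩
  have hq : HasDerivAt (fun t => x t * x₁ t / S t)
      ((x₁ 0 ^ 2 + x 0 * x₂) / S 0 - x 0 ^ 2 * x₁ 0 ^ 2 / S 0 ^ 3) 0 := by
    refine (((hx 0).fun_mul hx₁).fun_div (hSd 0) (hS 0).ne').congr_deriv ?_
    have h0 := (hS 0).ne'
    generalize S 0 = s at *
    field_simp
  have hmain := hre (((hpow (r - 1) 0).const_mul (r : ℂ)).fun_mul
    (hq.ofReal_comp.fun_add (hy₁.ofReal_comp.mul_const Complex.I)))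
  refine hmain.congr_deriv ?_
  rw [← Complex.re_ofReal_mul, ← Complex.add_re, ← Complex.re_ofReal_mul]
  congr 1
  have : (r - 1 - 1 : ℝ) = r - 2 := by ring
  rw [this]
  push_cast
  ring

/-- The regularization `√((Re w)² + ε²) + i Im w` of `w`, which lies in the right half-plane. -/
def regularize (ε : ℝ) (w : ℂ) : ℂ := (√(w.re ^ 2 + ε ^ 2) : ℝ) + w.im * Complex.I

lemma regularize_re (ε : ℝ) (w : ℂ) : (regularize ε w).re = √(w.re ^ 2 + ε ^ 2) := by
  simp [regularize]

lemma regularize_im (ε : ℝ) (w : ℂ) : (regularize ε w).im = w.im := by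
  simp [regularize]

lemma contDiff_re_regularize_cpow {F : ℂ → ℂ} (hF : Differentiable ℂ F) {ε : ℝ} (hε : 0 < ε)
    (r : ℝ) : ContDiff ℝ 2 fun z => (regularize ε (F z) ^ (r : ℂ)).re := by
  have hF2 : ContDiff ℝ 2 F := (hF.contDiff (n := 2)).restrict_scalars ℝ
  have hre : ContDiff ℝ 2 fun z => (F z).re := Complex.reCLM.contDiff.comp hF2
  have him : ContDiff ℝ 2 fun z => (F z).im := Complex.imCLM.contDiff.comp hF2
  have hS : ContDiff ℝ 2 fun z => √((F z).re ^ 2 + ε ^ 2) :=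
    ((hre.pow 2).add contDiff_const).sqrt fun z => by positivity
  have hζ : ContDiff ℝ 2 fun z => regularize ε (F z) :=
    (Complex.ofRealCLM.contDiff.comp hS).add ((Complex.ofRealCLM.contDiff.comp him).mul contDiff_const)
  have hslit : ∀ z, 0 < (regularize ε (F z)).re := fun z => by
    rw [regularize_re]; positivity
  have hpow : ContDiff ℝ 2 fun z => regularize ε (F z) ^ (r : ℂ) := by
    have : (fun z => regularize ε (F z) ^ (r : ℂ))
        = fun z => Complex.exp (Complex.log (regularize ε (F z)) * r) := by
      funext z
      rw [Complex.cpow_def_of_ne_zero]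
      intro h
      have := hslit z
      simp [h] at this
    rw [this]
    have hlog : ContDiff ℝ 2 fun z => Complex.log (regularize ε (F z)) :=
      contDiff_iff_contDiffAt.2 fun z =>
        ContDiffAt.comp (g := Complex.log) z
          ((Complex.contDiffAt_log (n := 2) (Or.inl (hslit z))).restrict_scalars ℝ) hζ.contDiffAt
    exact ((Complex.contDiff_exp (𝕜 := ℂ)).restrict_scalars ℝ).comp (hlog.mul contDiff_const)
  exact Complex.reCLM.contDiff.comp hpow

lemma laplacian_re_regularize_cpow_nonneg {F : ℂ → ℂ} (hF : Differentiable ℂ F) {ε : ℝ} (hε : 0 < ε)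
    {r : ℝ} (hr : 1 < r) (hr2 : r ≤ 2) (z v : ℂ) :
    0 ≤ fderiv ℝ (fderiv ℝ fun z => (regularize ε (F z) ^ (r : ℂ)).re) z v v
      + fderiv ℝ (fderiv ℝ fun z => (regularize ε (F z) ^ (r : ℂ)).re) z
        (Complex.I * v) (Complex.I * v) := by
  have hu := contDiff_re_regularize_cpow hF hε r
  have hF' : Differentiable ℂ (deriv F) := fun w =>
    (hF.analyticAt w).deriv.differentiableAt
  have hline : ∀ {G : ℂ → ℂ}, Differentiable ℂ G → ∀ (w : ℂ) (τ : ℝ),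
      HasDerivAt (fun τ : ℝ => G (z + τ * w)) (deriv G (z + τ * w) * w) τ := by
    intro G hG w τ
    have hl : HasDerivAt (fun τ : ℝ => z + τ * w) w τ := by
      simpa using ((Complex.ofRealCLM.hasDerivAt (x := τ)).mul_const w).const_add z
    exact (hG (z + τ * w)).hasDerivAt.comp τ hl
  have hre : ∀ {f : ℝ → ℂ} {f' : ℂ} {t : ℝ}, HasDerivAt f f' t →
      HasDerivAt (fun t => (f t).re) f'.re t := fun h =>
    Complex.reCLM.hasFDerivAt.comp_hasDerivAt _ h
  have him : ∀ {f : ℝ → ℂ} {f' : ℂ} {t : ℝ}, HasDerivAt f f' t →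
      HasDerivAt (fun t => (f t).im) f'.im t := fun h =>
    Complex.imCLM.hasFDerivAt.comp_hasDerivAt _ h
  have key : ∀ w : ℂ, fderiv ℝ (fderiv ℝ fun z => (regularize ε (F z) ^ (r : ℂ)).re) z w w =
      _ := fun w => by
    have h2 := (hline hF' w 0).mul_const w
    obtain ⟨h3, h4⟩ := hasDerivAt_re_cpow_regularized (r := r) hε (fun τ => hre (hline hF w τ))
      (fun τ => him (hline hF w τ)) (hre h2) (him h2)
    exact fderiv_fderiv_apply_of_line hu h3 h4
  rw [key v, key (Complex.I * v)]
  simp only [Complex.ofReal_zero, zero_mul, add_zero]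
  set ζ := regularize ε (F z) with hζ
  have hζ' : ((√((F z).re ^ 2 + ε ^ 2) : ℝ) : ℂ) + (F z).im * Complex.I = ζ := rfl
  rw [hζ']
  have hS : 0 < √((F z).re ^ 2 + ε ^ 2) := by positivity
  have hS2 : √((F z).re ^ 2 + ε ^ 2) ^ 2 = (F z).re ^ 2 + ε ^ 2 := Real.sq_sqrt (by positivity)
  have hmain := re_cpow_sub_two_mul_re_le (ζ := ζ) (by rw [regularize_re]; exact hS) hr hr2
  rw [regularize_re] at hmain
  set S := √((F z).re ^ 2 + ε ^ 2)
  set x := (F z).re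
  have e1 : deriv F z * (Complex.I * v) = Complex.I * (deriv F z * v) := by ring
  have e2 : deriv (deriv F) z * (Complex.I * v) * (Complex.I * v)
      = - (deriv (deriv F) z * v * v) := by
    linear_combination (deriv (deriv F) z * v * v) * Complex.I_mul_I
  rw [e1, e2]
  set d := deriv F z * v
  set d2 := deriv (deriv F) z * v * v
  simp only [Complex.I_mul_re, Complex.I_mul_im, Complex.neg_re, Complex.neg_im]
  set W := d.re ^ 2 + d.im ^ 2
  have hsum : r * ((r - 1) * (ζ ^ ((r - 2 : ℝ) : ℂ) *
        ((x * d.re / S : ℝ) + d.im * Complex.I) ^ 2).re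
      + (ζ ^ ((r - 1 : ℝ) : ℂ) * (((d.re ^ 2 + x * d2.re) / S - x ^ 2 * d.re ^ 2 / S ^ 3 : ℝ)
        + d2.im * Complex.I)).re)
      + r * ((r - 1) * (ζ ^ ((r - 2 : ℝ) : ℂ) *
        ((x * -d.im / S : ℝ) + d.re * Complex.I) ^ 2).re
      + (ζ ^ ((r - 1 : ℝ) : ℂ) * ((((-d.im) ^ 2 + x * -d2.re) / S - x ^ 2 * (-d.im) ^ 2 / S ^ 3 : ℝ)
        + (-d2.im : ℝ) * Complex.I)).re)
      = r * W * ε ^ 2 / S ^ 2 * ((ζ ^ ((r - 1 : ℝ) : ℂ)).re / S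
        - (r - 1) * (ζ ^ ((r - 2 : ℝ) : ℂ)).re) := by
    generalize ζ ^ ((r - 1 : ℝ) : ℂ) = Z1
    generalize ζ ^ ((r - 2 : ℝ) : ℂ) = Z2
    have hε2 : ε ^ 2 = S ^ 2 - x ^ 2 := by linarith
    have hS0 := hS.ne'
    rw [hε2]
    simp only [Complex.mul_re, Complex.mul_im, Complex.add_re, Complex.add_im, Complex.ofReal_re,
      Complex.ofReal_im, Complex.I_re, Complex.I_im, pow_two ((_ : ℂ) + _), W]
    field_simp
    ring
  rw [hsum]
  exact mul_nonneg (by positivity) (by linarith)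

lemma integral_re_regularize_cpow_nonneg {F : ℂ → ℂ} (hF : Differentiable ℂ F) (hF0 : (F 0).im = 0)
    {ε : ℝ} (hε : 0 < ε) {r : ℝ} (hr : 1 < r) (hr2 : r ≤ 2) :
    0 ≤ ∫ θ in (0 : ℝ)..2 * Real.pi,
      (regularize ε (F (Complex.exp (θ * Complex.I))) ^ (r : ℂ)).re := by
  refine le_trans ?_ (subMean (contDiff_re_regularize_cpow hF hε r)
    (laplacian_re_regularize_cpow_nonneg hF hε hr hr2))
  have : regularize ε (F 0) = (√((F 0).re ^ 2 + ε ^ 2) : ℝ) := by simp [regularize, hF0]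
  rw [this, ← Complex.ofReal_cpow (Real.sqrt_nonneg _), Complex.ofReal_re]
  positivity

lemma sin_rpow_div_sin_antitoneOn {r : ℝ} (hr : 1 < r) (hr2 : r < 2) :
    AntitoneOn (fun t : ℝ => Real.sin t ^ (r - 1) / Real.sin ((r - 1) * t))
      (Set.Ioo 0 (Real.pi / 2)) := by
  have hs : ∀ t ∈ Set.Ioo 0 (Real.pi / 2), 0 < Real.sin t := fun t ht =>
    Real.sin_pos_of_pos_of_lt_pi ht.1 (by linarith [ht.2, Real.pi_pos])
  have hs2 : ∀ t ∈ Set.Ioo 0 (Real.pi / 2), 0 < Real.sin ((r - 1) * t) := fun t ht =>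
    Real.sin_pos_of_pos_of_lt_pi (mul_pos (by linarith) ht.1)
      (by nlinarith [ht.1, ht.2, Real.pi_pos])
  have hd : ∀ t ∈ Set.Ioo 0 (Real.pi / 2),
      HasDerivAt (fun t : ℝ => Real.sin t ^ (r - 1) / Real.sin ((r - 1) * t))
        ((Real.cos t * (r - 1) * Real.sin t ^ (r - 1 - 1) * Real.sin ((r - 1) * t)
          - Real.sin t ^ (r - 1) * (Real.cos ((r - 1) * t) * (r - 1)))
          / Real.sin ((r - 1) * t) ^ 2) t := fun t ht => by
    have h1 := (Real.hasDerivAt_sin t).rpow_const (p := r - 1) (Or.inl (hs t ht).ne')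
    have h2 : HasDerivAt (fun t : ℝ => Real.sin ((r - 1) * t)) (Real.cos ((r - 1) * t) * (r - 1)) t := by
      simpa using ((hasDerivAt_id' t).const_mul (r - 1)).sin
    exact h1.fun_div h2 (hs2 t ht).ne'
  refine antitoneOn_of_deriv_nonpos (convex_Ioo _ _)
    (fun t ht => (hd t ht).continuousAt.continuousWithinAt) (fun t ht => ?_) fun t ht => ?_
  · rw [interior_Ioo] at ht
    exact (hd t ht).differentiableAt.differentiableWithinAt
  · rw [interior_Ioo] at ht
    rw [(hd t ht).deriv]
    apply div_nonpos_of_nonpos_of_nonneg _ (sq_nonneg _)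
    have h3 : Real.sin t ^ (r - 1) = Real.sin t ^ (r - 1 - 1) * Real.sin t := by
      rw [← Real.rpow_add_one (hs t ht).ne']; ring_nf
    have h4 : Real.sin ((2 - r) * t) = Real.sin t * Real.cos ((r - 1) * t)
        - Real.cos t * Real.sin ((r - 1) * t) := by
      rw [← Real.sin_sub]; ring_nf
    have h5 : 0 ≤ Real.sin ((2 - r) * t) :=
      Real.sin_nonneg_of_nonneg_of_le_pi (mul_nonneg (by linarith) ht.1.le)
        (by nlinarith [ht.1, ht.2, Real.pi_pos])
    have h6 : 0 ≤ Real.sin t ^ (r - 1 - 1) * (r - 1) * Real.sin ((2 - r) * t) :=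
      mul_nonneg (mul_nonneg (Real.rpow_nonneg (hs t ht).le _) (by linarith)) h5
    rw [h3]
    rw [h4] at h6
    linarith

lemma tan_rpow_add_cos_le {r : ℝ} (hr : 1 < r) (hr2 : r < 2) {t : ℝ} (ht0 : 0 ≤ t)
    (ht : t < Real.pi / 2) :
    Real.tan t ^ r + Real.sin (Real.pi / (2 * r)) ^ (r - 1) / Real.cos (Real.pi / (2 * r))
      * (Real.cos (r * t) * Real.cos t ^ (-r)) ≤ Real.tan (Real.pi / (2 * r)) ^ r := by
  set γ := Real.pi / (2 * r) with hγ
  set D := Real.sin γ ^ (r - 1) / Real.cos γ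
  have hpi := Real.pi_pos
  have hrγ : r * γ = Real.pi / 2 := by rw [hγ]; field_simp
  have hγ0 : 0 < γ := by positivity
  have hγ2 : γ < Real.pi / 2 := by nlinarith
  have hc : ∀ t ∈ Set.Ico 0 (Real.pi / 2), 0 < Real.cos t := fun t ht =>
    Real.cos_pos_of_mem_Ioo ⟨by linarith [ht.1], ht.2⟩
  have hs : ∀ t ∈ Set.Ioo 0 (Real.pi / 2), 0 < Real.sin t := fun t ht =>
    Real.sin_pos_of_pos_of_lt_pi ht.1 (by linarith [ht.2, Real.pi_pos])
  have hs2 : ∀ t ∈ Set.Ioo 0 (Real.pi / 2), 0 < Real.sin ((r - 1) * t) := fun t ht =>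
    Real.sin_pos_of_pos_of_lt_pi (mul_pos (by linarith) ht.1)
      (by nlinarith [ht.1, ht.2, Real.pi_pos])
  have hDγ : D = Real.sin γ ^ (r - 1) / Real.sin ((r - 1) * γ) := by
    rw [show (r - 1) * γ = Real.pi / 2 - γ by linarith, Real.sin_pi_div_two_sub]
  set G : ℝ → ℝ := fun t => Real.tan t ^ r + D * (Real.cos (r * t) * Real.cos t ^ (-r)) with hG
  have hd : ∀ t ∈ Set.Ioo 0 (Real.pi / 2), HasDerivAt G
      (r * Real.cos t ^ (-r - 1) * (Real.sin t ^ (r - 1) - D * Real.sin ((r - 1) * t))) t :=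
    fun t ht => by
    have hct := hc t ⟨ht.1.le, ht.2⟩
    have hst := hs t ht
    have h1 := (Real.hasDerivAt_tan hct.ne').rpow_const (p := r) (Or.inr hr.le)
    have h2 : HasDerivAt (fun t : ℝ => Real.cos (r * t)) (-Real.sin (r * t) * r) t := by
      simpa using ((hasDerivAt_id' t).const_mul r).cos
    have h3 := (Real.hasDerivAt_cos t).rpow_const (p := -r) (Or.inl hct.ne')
    refine (h1.fun_add ((h2.fun_mul h3).const_mul D)).congr_deriv ?_
    have e1 : Real.tan t ^ (r - 1) = Real.sin t ^ (r - 1) * Real.cos t ^ (-r - 1) * Real.cos t ^ 2 := by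
      rw [Real.tan_eq_sin_div_cos, Real.div_rpow hst.le hct.le, mul_assoc, ← Real.rpow_add_natCast hct.ne',
        show (-r - 1 + (2 : ℕ)) = -(r - 1) by push_cast; ring, Real.rpow_neg hct.le]
      rfl
    have e2 : Real.cos t ^ (-r) = Real.cos t ^ (-r - 1) * Real.cos t := by
      rw [← Real.rpow_add_one hct.ne']; ring_nf
    have e3 : Real.sin ((r - 1) * t) = Real.sin (r * t) * Real.cos t - Real.cos (r * t) * Real.sin t := by
      rw [← Real.sin_sub]; ring_nf
    rw [e1, e2, e3]
    field_simp
    ring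
  have hcont : ContinuousOn G (Set.Ico 0 (Real.pi / 2)) := fun t ht => by
    have hct := hc t ht
    refine ContinuousAt.continuousWithinAt ?_
    refine ContinuousAt.add ((Real.continuousAt_tan.2 hct.ne').rpow_const (Or.inr (by linarith)))
      (continuousAt_const.mul (ContinuousAt.mul (by fun_prop)
        (Real.continuous_cos.continuousAt.rpow_const (Or.inl hct.ne'))))
  have hγmem : γ ∈ Set.Ioo 0 (Real.pi / 2) := ⟨hγ0, hγ2⟩
  have hGγ : G γ = Real.tan γ ^ r := by simp [hG, hrγ]
  have hanti := sin_rpow_div_sin_antitoneOn hr hr2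
  change G t ≤ _
  rw [← hGγ]
  rcases le_total t γ with h | h
  · refine monotoneOn_of_deriv_nonneg (D := Set.Icc 0 γ) (convex_Icc _ _)
      (hcont.mono fun s hs => ⟨hs.1, hs.2.trans_lt hγ2⟩) (fun s hs => ?_) (fun s hs => ?_)
      ⟨ht0, h⟩ ⟨hγ0.le, le_rfl⟩ h
    · rw [interior_Icc] at hs
      exact (hd s ⟨hs.1, hs.2.trans hγ2⟩).differentiableAt.differentiableWithinAt
    · rw [interior_Icc] at hs
      have hsm : s ∈ Set.Ioo 0 (Real.pi / 2) := ⟨hs.1, hs.2.trans hγ2⟩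
      rw [(hd s hsm).deriv]
      have := hanti hsm hγmem hs.2.le
      simp only [] at this
      rw [← hDγ, le_div_iff₀ (hs2 s hsm)] at this
      have := (Real.rpow_pos_of_pos (hc s ⟨hs.1.le, hsm.2⟩) (-r - 1)).le
      exact mul_nonneg (by positivity) (by linarith)
  · refine antitoneOn_of_deriv_nonpos (D := Set.Ico γ (Real.pi / 2)) (convex_Ico _ _)
      (hcont.mono fun s hs => ⟨hγ0.le.trans hs.1, hs.2⟩) (fun s hs => ?_) (fun s hs => ?_)
      ⟨le_rfl, hγ2⟩ ⟨h, ht⟩ h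
    · rw [interior_Ico] at hs
      exact (hd s ⟨hγ0.trans hs.1, hs.2⟩).differentiableAt.differentiableWithinAt
    · rw [interior_Ico] at hs
      have hsm : s ∈ Set.Ioo 0 (Real.pi / 2) := ⟨hγ0.trans hs.1, hs.2⟩
      rw [(hd s hsm).deriv]
      have := hanti hγmem hsm hs.1.le
      simp only [] at this
      rw [← hDγ, div_le_iff₀ (hs2 s hsm)] at this
      have := (Real.rpow_pos_of_pos (hc s ⟨hsm.1.le, hsm.2⟩) (-r - 1)).le
      exact mul_nonpos_of_nonneg_of_nonpos (by positivity) (by linarith)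

lemma abs_im_rpow_le {r : ℝ} (hr : 1 < r) (hr2 : r < 2) {ζ : ℂ} (hζ : 0 < ζ.re) :
    |ζ.im| ^ r ≤ Real.tan (Real.pi / (2 * r)) ^ r * ζ.re ^ r
      - Real.sin (Real.pi / (2 * r)) ^ (r - 1) / Real.cos (Real.pi / (2 * r))
        * (ζ ^ (r : ℂ)).re := by
  have hn : 0 < ‖ζ‖ := norm_pos_iff.2 fun h => by simp [h] at hζ
  have harg : |ζ.arg| < Real.pi / 2 := Complex.abs_arg_lt_pi_div_two_iff.2 (Or.inl hζ)
  have hmain := tan_rpow_add_cos_le hr hr2 (abs_nonneg _) harg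
  set D := Real.sin (Real.pi / (2 * r)) ^ (r - 1) / Real.cos (Real.pi / (2 * r))
  set T := Real.tan (Real.pi / (2 * r)) ^ r
  have hc : 0 < Real.cos |ζ.arg| :=
    Real.cos_pos_of_mem_Ioo ⟨by linarith [abs_nonneg ζ.arg, Real.pi_pos], harg⟩
  have hs : 0 ≤ Real.sin |ζ.arg| :=
    Real.sin_nonneg_of_nonneg_of_le_pi (abs_nonneg _) (by linarith [Real.pi_pos])
  have h1 : ζ.re = ‖ζ‖ * Real.cos |ζ.arg| := by
    rw [Real.cos_abs, Complex.norm_mul_cos_arg]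
  have h2 : |ζ.im| = ‖ζ‖ * Real.sin |ζ.arg| := by
    rw [← Complex.norm_mul_sin_arg ζ, abs_mul, abs_norm, Real.abs_sin_eq_sin_abs_of_abs_le_pi]
    linarith [Real.pi_pos]
  have h3 : (ζ ^ (r : ℂ)).re = ‖ζ‖ ^ r * Real.cos (r * |ζ.arg|) := by
    rw [Complex.cpow_ofReal_re, ← Real.cos_abs (ζ.arg * r), abs_mul, abs_of_pos (by linarith : 0 < r),
      mul_comm r]
  rw [h1, h2, h3, Real.mul_rpow hn.le hs, Real.mul_rpow hn.le hc.le]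
  have hcr := Real.rpow_pos_of_pos hc r
  rw [Real.tan_eq_sin_div_cos |ζ.arg|, Real.div_rpow hs hc.le, Real.rpow_neg hc.le] at hmain
  have h4 : Real.sin |ζ.arg| ^ r + D * Real.cos (r * |ζ.arg|) ≤ T * Real.cos |ζ.arg| ^ r := by
    refine le_trans (le_of_eq ?_) ((mul_le_mul_iff_of_pos_right hcr).2 hmain)
    field_simp
  have := mul_le_mul_of_nonneg_left h4 (Real.rpow_pos_of_pos hn r).le
  linarith

/-- Sharp conjugate function inequality on the unit circle for entire functions. -/
lemma integral_abs_im_rpow_le {F : ℂ → ℂ} (hF : Differentiable ℂ F) (hF0 : (F 0).im = 0)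
    {r : ℝ} (hr : 1 < r) (hr2 : r < 2) :
    ∫ θ in (0 : ℝ)..2 * Real.pi, |(F (Complex.exp (θ * Complex.I))).im| ^ r ≤
      Real.tan (Real.pi / (2 * r)) ^ r *
        ∫ θ in (0 : ℝ)..2 * Real.pi, |(F (Complex.exp (θ * Complex.I))).re| ^ r := by
  have hpi := Real.pi_pos
  have hr0 : 0 < r := by linarith
  set f : ℝ → ℂ := fun θ => F (Complex.exp (θ * Complex.I)) with hf
  have hfc : Continuous f := hF.continuous.comp (by fun_prop)
  have hfre : Continuous fun θ => (f θ).re := Complex.continuous_re.comp hfc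
  have hfim : Continuous fun θ => (f θ).im := Complex.continuous_im.comp hfc
  have hSc : Continuous fun x : ℝ × ℝ => √((f x.2).re ^ 2 + x.1 ^ 2) ^ r :=
    Continuous.rpow_const (by fun_prop) fun _ => Or.inr hr0.le
  have hI : Continuous fun ε : ℝ => ∫ θ in (0 : ℝ)..2 * Real.pi, √((f θ).re ^ 2 + ε ^ 2) ^ r :=
    intervalIntegral.continuous_parametric_intervalIntegral_of_continuous' hSc _ _
  have hlim : Filter.Tendsto (fun ε : ℝ => Real.tan (Real.pi / (2 * r)) ^ r *
      ∫ θ in (0 : ℝ)..2 * Real.pi, √((f θ).re ^ 2 + ε ^ 2) ^ r) (nhdsWithin 0 (Set.Ioi 0))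
      (nhds (Real.tan (Real.pi / (2 * r)) ^ r *
        ∫ θ in (0 : ℝ)..2 * Real.pi, |(f θ).re| ^ r)) := by
    have h0 : Filter.Tendsto (fun ε : ℝ => ∫ θ in (0 : ℝ)..2 * Real.pi, √((f θ).re ^ 2 + ε ^ 2) ^ r)
        (nhdsWithin 0 (Set.Ioi 0)) (nhds (∫ θ in (0 : ℝ)..2 * Real.pi, |(f θ).re| ^ r)) := by
      simpa [Real.sqrt_sq_eq_abs] using (hI.tendsto 0).mono_left nhdsWithin_le_nhds
    exact Filter.Tendsto.const_mul _ h0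
  refine ge_of_tendsto hlim ?_
  filter_upwards [self_mem_nhdsWithin] with ε hε
  have hε : 0 < ε := hε
  set D := Real.sin (Real.pi / (2 * r)) ^ (r - 1) / Real.cos (Real.pi / (2 * r))
  have hγ : Real.pi / (2 * r) < Real.pi / 2 := by
    apply div_lt_div_of_pos_left hpi (by norm_num); linarith
  have hD : 0 ≤ D := div_nonneg
    (Real.rpow_nonneg (Real.sin_nonneg_of_nonneg_of_le_pi (by positivity) (by linarith)) _)
    (Real.cos_nonneg_of_mem_Icc ⟨by linarith [show 0 < Real.pi / (2 * r) by positivity], hγ.le⟩)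
  have hu : Continuous fun θ : ℝ => (regularize ε (f θ) ^ (r : ℂ)).re :=
    (contDiff_re_regularize_cpow hF hε r).continuous.comp
      (by fun_prop : Continuous fun θ : ℝ => Complex.exp (θ * Complex.I))
  have hS : Continuous fun θ : ℝ => √((f θ).re ^ 2 + ε ^ 2) ^ r :=
    hSc.comp (by fun_prop : Continuous fun θ : ℝ => (ε, θ))
  have hS' : Continuous fun θ : ℝ => Real.tan (Real.pi / (2 * r)) ^ r * √((f θ).re ^ 2 + ε ^ 2) ^ r :=
    continuous_const.mul hS
  have hu' : Continuous fun θ : ℝ => D * (regularize ε (f θ) ^ (r : ℂ)).re := continuous_const.mul hu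
  calc ∫ θ in (0 : ℝ)..2 * Real.pi, |(f θ).im| ^ r
      ≤ ∫ θ in (0 : ℝ)..2 * Real.pi, (Real.tan (Real.pi / (2 * r)) ^ r * √((f θ).re ^ 2 + ε ^ 2) ^ r
          - D * (regularize ε (f θ) ^ (r : ℂ)).re) := by
        refine intervalIntegral.integral_mono_on (by positivity)
          ((hfim.abs.rpow_const fun _ => Or.inr hr0.le).intervalIntegrable _ _)
          ((hS'.sub hu').intervalIntegrable _ _)
          fun θ _ => ?_
        have := abs_im_rpow_le hr hr2 (ζ := regularize ε (f θ)) (by rw [regularize_re]; positivity)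
        rwa [regularize_re, regularize_im] at this
    _ = Real.tan (Real.pi / (2 * r)) ^ r * (∫ θ in (0 : ℝ)..2 * Real.pi, √((f θ).re ^ 2 + ε ^ 2) ^ r)
          - D * ∫ θ in (0 : ℝ)..2 * Real.pi, (regularize ε (f θ) ^ (r : ℂ)).re := by
        rw [intervalIntegral.integral_sub (hS'.intervalIntegrable _ _)
          (hu'.intervalIntegrable _ _), intervalIntegral.integral_const_mul,
          intervalIntegral.integral_const_mul]
    _ ≤ _ := by
        have := mul_nonneg hD (integral_re_regularize_cpow_nonneg hF hF0 hε hr hr2.le)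
        linarith

lemma integral_sin_int_mul_add (m : ℤ) (c : ℝ) :
    ∫ θ in (0 : ℝ)..2 * Real.pi, Real.sin (m * θ + c)
      = if m = 0 then 2 * Real.pi * Real.sin c else 0 := by
  split_ifs with h
  · simp [h]
  · have hm : (m : ℝ) ≠ 0 := by exact_mod_cast h
    rw [intervalIntegral.integral_comp_mul_add (fun x => Real.sin x) hm, integral_sin]
    have : Real.cos (m * (2 * Real.pi) + c) = Real.cos c := by
      rw [add_comm, Real.cos_add_int_mul_two_pi]
    rw [this]
    simp

lemma integral_cos_mul_sin (k l : ℕ) (a b : ℝ) :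
    ∫ θ in (0 : ℝ)..2 * Real.pi, Real.cos (k * (θ - a)) * Real.sin (l * (θ - b))
      = if k = l then Real.pi * Real.sin (k * (a - b)) else 0 := by
  have h : ∀ θ : ℝ, Real.cos (k * (θ - a)) * Real.sin (l * (θ - b))
      = (1 / 2) * Real.sin (((l + k : ℤ) : ℝ) * θ + (-(l * b) - k * a))
        + (1 / 2) * Real.sin (((l - k : ℤ) : ℝ) * θ + (-(l * b) + k * a)) := fun θ => by
    have e1 : ((l + k : ℤ) : ℝ) * θ + (-(l * b) - k * a) = l * (θ - b) + k * (θ - a) := by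
      push_cast; ring
    have e2 : ((l - k : ℤ) : ℝ) * θ + (-(l * b) + k * a) = l * (θ - b) - k * (θ - a) := by
      push_cast; ring
    rw [e1, e2, Real.sin_add, Real.sin_sub]
    ring
  simp_rw [h]
  rw [intervalIntegral.integral_add (Continuous.intervalIntegrable (by fun_prop) _ _)
    (Continuous.intervalIntegrable (by fun_prop) _ _), intervalIntegral.integral_const_mul,
    intervalIntegral.integral_const_mul, integral_sin_int_mul_add, integral_sin_int_mul_add]
  by_cases hkl : k = l
  · subst hkl
    rcases Nat.eq_zero_or_pos k with h0 | h0
    · simp [h0]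
    · rw [if_neg (by omega), if_pos (by omega), if_pos rfl]
      rw [show -((k : ℝ) * b) + k * a = k * (a - b) by ring]
      ring
  · rw [if_neg (by omega), if_neg (by omega), if_neg hkl]
    ring

/-- The Fejér kernel, normalized to have mean `1 / N`. -/
def fejer (N : ℕ) (t : ℝ) : ℝ :=
  (2 * ∑ k ∈ Finset.range N, ((N : ℝ) - k) * Real.cos (k * t) - N) / N ^ 2

/-- The conjugate Fejér kernel. -/
def conjFejer (N : ℕ) (t : ℝ) : ℝ :=
  (2 * ∑ k ∈ Finset.range N, ((N : ℝ) - k) * Real.sin (k * t)) / N ^ 2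

lemma continuous_fejer (N : ℕ) : Continuous (fejer N) := by
  unfold fejer; fun_prop

lemma continuous_conjFejer (N : ℕ) : Continuous (conjFejer N) := by
  unfold conjFejer; fun_prop

lemma sq_sum_cos_add_sq_sum_sin (N : ℕ) (t : ℝ) :
    (∑ k ∈ Finset.range N, Real.cos (k * t)) ^ 2 + (∑ k ∈ Finset.range N, Real.sin (k * t)) ^ 2
      = 2 * ∑ k ∈ Finset.range N, ((N : ℝ) - k) * Real.cos (k * t) - N := by
  induction N with
  | zero => simp
  | succ N ih =>
    have h1 : ∑ k ∈ Finset.range (N + 1), (((N + 1 : ℕ) : ℝ) - k) * Real.cos (k * t)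
        = ∑ k ∈ Finset.range N, ((N : ℝ) - k) * Real.cos (k * t)
          + ∑ k ∈ Finset.range (N + 1), Real.cos (k * t) := by
      rw [Finset.sum_range_succ, Finset.sum_range_succ _ N, ← add_assoc, ← Finset.sum_add_distrib]
      push_cast
      congr 1
      · exact Finset.sum_congr rfl fun k _ => by ring
      · ring
    have h2 : ∑ k ∈ Finset.range (N + 1), Real.cos (k * t)
        = ∑ k ∈ Finset.range (N + 1), Real.cos ((N - k) * t) := by
      rw [← Finset.sum_flip]
      refine Finset.sum_congr rfl fun k hk => ?_
      rw [Nat.cast_sub (Finset.mem_range_succ_iff.1 hk)]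
    have h3 : ∑ k ∈ Finset.range (N + 1), Real.cos ((N - k) * t)
        = Real.cos (N * t) * ∑ k ∈ Finset.range N, Real.cos (k * t)
          + Real.sin (N * t) * ∑ k ∈ Finset.range N, Real.sin (k * t) + 1 := by
      rw [Finset.sum_range_succ, Finset.mul_sum, Finset.mul_sum, ← Finset.sum_add_distrib]
      simp only [sub_self, zero_mul, Real.cos_zero]
      congr 1
      exact Finset.sum_congr rfl fun k _ => by rw [sub_mul, Real.cos_sub]
    have h4 := h2.trans h3
    have h5 := Finset.sum_range_succ (fun k : ℕ => Real.cos (k * t)) N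
    rw [h1, Finset.sum_range_succ (fun k : ℕ => Real.sin (k * t))]
    have := Real.sin_sq_add_cos_sq (N * t)
    push_cast
    linear_combination ih + this + (∑ k ∈ Finset.range (N + 1), Real.cos (k * t)
      + ∑ k ∈ Finset.range N, Real.cos (k * t) + Real.cos (N * t)) * h5 - 2 * h4

lemma fejer_nonneg (N : ℕ) (t : ℝ) : 0 ≤ fejer N t := by
  rw [fejer, ← sq_sum_cos_add_sq_sum_sin]
  positivity

lemma integral_fejer {N : ℕ} (hN : 0 < N) (a : ℝ) :
    ∫ θ in (0 : ℝ)..2 * Real.pi, fejer N (θ - a) = 2 * Real.pi / N := by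
  have hN' : (N : ℝ) ≠ 0 := by positivity
  have h : ∀ k : ℕ, ∫ θ in (0 : ℝ)..2 * Real.pi, ((N : ℝ) - k) * Real.cos (k * (θ - a))
      = if k = 0 then 2 * Real.pi * N else 0 := fun k => by
    have : ∀ θ : ℝ, Real.cos (k * (θ - a)) = Real.sin ((k : ℤ) * θ + (Real.pi / 2 - k * a)) :=
      fun θ => by
        rw [← Real.sin_pi_div_two_sub, ← Real.sin_pi_sub]; congr 1; push_cast; ring
    simp_rw [this]
    rw [intervalIntegral.integral_const_mul, integral_sin_int_mul_add]
    by_cases hk : k = 0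
    · simp [hk]; ring
    · simp [hk]
  unfold fejer
  rw [intervalIntegral.integral_div, intervalIntegral.integral_sub
    (Continuous.intervalIntegrable (by fun_prop) _ _)
    (Continuous.intervalIntegrable (by fun_prop) _ _), intervalIntegral.integral_const_mul,
    intervalIntegral.integral_finsetSum fun k _ => Continuous.intervalIntegrable (by fun_prop) _ _]
  simp_rw [h]
  rw [Finset.sum_ite_eq' , if_pos (Finset.mem_range.2 hN), intervalIntegral.integral_const]
  simp only [smul_eq_mul]
  field_simp
  ring

lemma sum_range_mul_sin (M : ℕ) (x : ℝ) :
    4 * Real.sin x ^ 2 * ∑ k ∈ Finset.range M, (k : ℝ) * Real.sin (k * (2 * x))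
      = Real.sin (M * (2 * x)) - 2 * M * Real.sin x * Real.cos (M * (2 * x) - x) := by
  induction M with
  | zero => simp
  | succ M ih =>
    rw [Finset.sum_range_succ, mul_add, ih]
    have e1 : ((M + 1 : ℕ) : ℝ) * (2 * x) = M * (2 * x) + 2 * x := by push_cast; ring
    have e2 : ((M + 1 : ℕ) : ℝ) * (2 * x) - x = M * (2 * x) + x := by push_cast; ring
    rw [e2, e1, Real.sin_add, Real.cos_sub, Real.cos_add, Real.sin_two_mul, Real.cos_two_mul]
    push_cast
    have := Real.sin_sq_add_cos_sq x
    linear_combination (-2 * Real.sin (M * (2 * x))) * this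

lemma sum_sq_mul_sin {N : ℕ} (hN : 0 < N) {x : ℝ} {d : ℤ} (hx : N * x = Real.pi * d) :
    ∑ k ∈ Finset.range N, ((N : ℝ) - k) ^ 2 * Real.sin (k * (2 * x)) = N ^ 2 / 2 * Real.cot x := by
  have hN' : (N : ℝ) ≠ 0 := by positivity
  have hNx : (N : ℝ) * (2 * x) = d * (2 * Real.pi) := by linear_combination 2 * hx
  have hflip : ∀ k ∈ Finset.range (N + 1), Real.sin ((N - k : ℕ) * (2 * x)) = - Real.sin (k * (2 * x)) :=
    fun k hk => by
      rw [Nat.cast_sub (Finset.mem_range_succ_iff.1 hk), sub_mul, hNx, Real.sin_int_mul_two_pi_sub]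
  have hsN : Real.sin (N * (2 * x)) = 0 := by
    rw [hNx]
    simpa using Real.sin_add_int_mul_two_pi 0 d
  have h0 : ∑ k ∈ Finset.range (N + 1), Real.sin (k * (2 * x)) = 0 := by
    have := Finset.sum_flip (n := N) fun k : ℕ => Real.sin (k * (2 * x))
    rw [Finset.sum_congr rfl hflip, Finset.sum_neg_distrib] at this
    linarith
  have h1 : ∑ k ∈ Finset.range (N + 1), ((N : ℝ) - k) ^ 2 * Real.sin (k * (2 * x))
      = - ∑ k ∈ Finset.range (N + 1), (k : ℝ) ^ 2 * Real.sin (k * (2 * x)) := by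
    rw [← Finset.sum_flip, ← Finset.sum_neg_distrib]
    refine Finset.sum_congr rfl fun k hk => ?_
    rw [hflip k hk, Nat.cast_sub (Finset.mem_range_succ_iff.1 hk)]
    ring
  have h2 : 2 * ∑ k ∈ Finset.range (N + 1), ((N : ℝ) - k) ^ 2 * Real.sin (k * (2 * x))
      = (N : ℝ) ^ 2 * ∑ k ∈ Finset.range (N + 1), Real.sin (k * (2 * x))
        - 2 * N * ∑ k ∈ Finset.range (N + 1), (k : ℝ) * Real.sin (k * (2 * x)) := by
    rw [two_mul]
    nth_rw 2 [h1]
    rw [Finset.mul_sum, Finset.mul_sum, ← sub_eq_add_neg, ← Finset.sum_sub_distrib,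
      ← Finset.sum_sub_distrib]
    exact Finset.sum_congr rfl fun k _ => by ring
  rw [h0, Finset.sum_range_succ, Finset.sum_range_succ _ N, hsN] at h2
  have h3 := sum_range_mul_sin N x
  rw [Real.cos_sub, hsN] at h3
  have hcN : Real.cos (N * (2 * x)) = 1 := by
    rw [hNx]
    simp
  rw [hcN] at h3
  rw [Real.cot_eq_cos_div_sin]
  by_cases hs : Real.sin x = 0
  · have : ∀ k : ℕ, Real.sin (k * (2 * x)) = 0 := fun k => by
      obtain ⟨m, hm⟩ := Real.sin_eq_zero_iff.1 hs
      rw [← hm, show (k : ℝ) * (2 * (m * Real.pi)) = ((k * 2 * m : ℤ) : ℝ) * Real.pi by push_cast; ring]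
      exact Real.sin_int_mul_pi _
    simp [this, hs]
  · have h4 : ∑ k ∈ Finset.range N, (k : ℝ) * Real.sin (k * (2 * x)) = -(N / 2) * (Real.cos x / Real.sin x) := by
      generalize ∑ k ∈ Finset.range N, (k : ℝ) * Real.sin (k * (2 * x)) = S at h3 ⊢
      have : Real.sin x * (2 * Real.sin x * S + N * Real.cos x) = 0 := by linear_combination h3 / 2
      field_simp
      rcases mul_eq_zero.1 this with h | h
      · exact absurd h hs
      · linarith
    rw [h4] at h2
    linarith

lemma integral_fejer_mul_conjFejer {N : ℕ} (hN : 0 < N) {a b : ℝ} {d : ℤ}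
    (hab : N * ((a - b) / 2) = Real.pi * d) :
    ∫ θ in (0 : ℝ)..2 * Real.pi, fejer N (θ - a) * conjFejer N (θ - b)
      = 2 * Real.pi / N ^ 2 * Real.cot ((a - b) / 2) := by
  have hN' : (N : ℝ) ≠ 0 := by positivity
  have h : ∀ θ, fejer N (θ - a) * conjFejer N (θ - b)
      = 4 / N ^ 4 * ∑ k ∈ Finset.range N, ∑ l ∈ Finset.range N, ((N : ℝ) - k) * ((N : ℝ) - l) *
          (Real.cos (k * (θ - a)) * Real.sin (l * (θ - b)))
        - 2 / N ^ 3 * ∑ l ∈ Finset.range N, ((N : ℝ) - l) *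
          (Real.cos ((0 : ℕ) * (θ - a)) * Real.sin (l * (θ - b))) := fun θ => by
    have e1 : ∑ k ∈ Finset.range N, ∑ l ∈ Finset.range N, ((N : ℝ) - k) * ((N : ℝ) - l) *
          (Real.cos (k * (θ - a)) * Real.sin (l * (θ - b)))
        = (∑ k ∈ Finset.range N, ((N : ℝ) - k) * Real.cos (k * (θ - a)))
          * ∑ l ∈ Finset.range N, ((N : ℝ) - l) * Real.sin (l * (θ - b)) := by
      rw [Finset.sum_mul_sum]
      exact Finset.sum_congr rfl fun k _ => Finset.sum_congr rfl fun l _ => by ring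
    rw [e1, fejer, conjFejer]
    simp only [Nat.cast_zero, zero_mul, Real.cos_zero, one_mul]
    generalize ∑ k ∈ Finset.range N, ((N : ℝ) - k) * Real.cos (k * (θ - a)) = S
    generalize ∑ k ∈ Finset.range N, ((N : ℝ) - k) * Real.sin (k * (θ - b)) = S'
    field_simp
    ring
  simp_rw [h]
  rw [intervalIntegral.integral_sub (Continuous.intervalIntegrable (by fun_prop) _ _)
    (Continuous.intervalIntegrable (by fun_prop) _ _), intervalIntegral.integral_const_mul,
    intervalIntegral.integral_const_mul,
    intervalIntegral.integral_finsetSum fun k _ => Continuous.intervalIntegrable (by fun_prop) _ _,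
    intervalIntegral.integral_finsetSum fun k _ => Continuous.intervalIntegrable (by fun_prop) _ _]
  have h1 : ∀ k ∈ Finset.range N, ∫ θ in (0 : ℝ)..2 * Real.pi, ∑ l ∈ Finset.range N,
      ((N : ℝ) - k) * ((N : ℝ) - l) * (Real.cos (k * (θ - a)) * Real.sin (l * (θ - b)))
      = Real.pi * (((N : ℝ) - k) ^ 2 * Real.sin (k * (2 * ((a - b) / 2)))) := fun k hk => by
    rw [intervalIntegral.integral_finsetSum fun k _ => Continuous.intervalIntegrable (by fun_prop) _ _]
    simp_rw [intervalIntegral.integral_const_mul, integral_cos_mul_sin, mul_ite, mul_zero]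
    rw [Finset.sum_ite_eq, if_pos hk]
    ring_nf
  rw [Finset.sum_congr rfl h1, ← Finset.mul_sum, sum_sq_mul_sin hN hab]
  simp_rw [intervalIntegral.integral_const_mul, integral_cos_mul_sin]
  simp
  field_simp
  ring

lemma sum_fejer {N : ℕ} (hN : 0 < N) (t : ℝ) :
    ∑ j ∈ Finset.range N, fejer N (t - 2 * Real.pi * j / N) = 1 := by
  have hN' : (N : ℝ) ≠ 0 := by positivity
  have h : ∀ k ∈ Finset.range N, ∑ j ∈ Finset.range N, Real.cos (k * (t - 2 * Real.pi * j / N))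
      = if k = 0 then (N : ℝ) else 0 := fun k hk => by
    by_cases hk0 : k = 0
    · simp [hk0]
    rw [if_neg hk0]
    have hkN := Finset.mem_range.1 hk
    have hs : 0 < Real.sin (Real.pi * k / N) := by
      apply Real.sin_pos_of_pos_of_lt_pi
      · have := Nat.pos_of_ne_zero hk0
        positivity
      · rw [div_lt_iff₀ (by positivity)]
        exact mul_lt_mul_of_pos_left (by exact_mod_cast hkN) Real.pi_pos
    have key : 2 * Real.sin (Real.pi * k / N) *
        ∑ j ∈ Finset.range N, Real.cos (k * (t - 2 * Real.pi * j / N)) = 0 := by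
      rw [Finset.mul_sum]
      have : ∀ j : ℕ, 2 * Real.sin (Real.pi * k / N) * Real.cos (k * (t - 2 * Real.pi * j / N))
          = Real.sin (k * t - 2 * (Real.pi * k / N) * j + Real.pi * k / N)
            - Real.sin (k * t - 2 * (Real.pi * k / N) * (j + 1 : ℕ) + Real.pi * k / N) := fun j => by
        have e1 : k * t - 2 * (Real.pi * k / N) * (j + 1 : ℕ) + Real.pi * k / N
          = k * (t - 2 * Real.pi * j / N) - Real.pi * k / N := by push_cast; ring
        have e2 : k * t - 2 * (Real.pi * k / N) * j + Real.pi * k / N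
          = k * (t - 2 * Real.pi * j / N) + Real.pi * k / N := by ring
        rw [e1, e2, Real.sin_add, Real.sin_sub]
        ring
      simp_rw [this]
      rw [Finset.sum_range_sub' (fun j : ℕ => Real.sin (k * t - 2 * (Real.pi * k / N) * j + Real.pi * k / N))]
      have e3 : k * t - 2 * (Real.pi * k / N) * N + Real.pi * k / N
          = k * t + Real.pi * k / N - k * (2 * Real.pi) := by field_simp; ring
      rw [e3, Real.sin_sub_nat_mul_two_pi]
      simp
    rcases mul_eq_zero.1 key with h | h
    · linarith
    · exact h
  unfold fejer
  rw [← Finset.sum_div, Finset.sum_sub_distrib, ← Finset.mul_sum, Finset.sum_comm]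
  simp_rw [← Finset.mul_sum]
  rw [Finset.sum_congr rfl fun k hk => by rw [h k hk]]
  simp only [mul_ite, mul_zero, Finset.sum_ite_eq', Finset.mem_range, hN, if_true]
  simp
  field_simp
  ring

/-- The `ℓ^q` norm of a finite family. -/
def finNorm {ι : Type*} [Fintype ι] (q : ℝ) (f : ι → ℝ) : ℝ := (∑ i, |f i| ^ q) ^ (1 / q)

lemma finNorm_nonneg {ι : Type*} [Fintype ι] (q : ℝ) (f : ι → ℝ) : 0 ≤ finNorm q f :=
  Real.rpow_nonneg (Finset.sum_nonneg fun _ _ => Real.rpow_nonneg (abs_nonneg _) _) _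

lemma abs_intervalIntegral_mul_le {f g : ℝ → ℝ} (hf : Continuous f) (hg : Continuous g) {q r : ℝ}
    (hqr : q.HolderConjugate r) {a b : ℝ} (hab : a ≤ b) :
    |∫ θ in a..b, f θ * g θ| ≤
      (∫ θ in a..b, |f θ| ^ q) ^ (1 / q) * (∫ θ in a..b, |g θ| ^ r) ^ (1 / r) := by
  have hmem : ∀ {f : ℝ → ℝ}, Continuous f → ∀ s : ENNReal,
      MemLp (fun θ => |f θ|) s (volume.restrict (Set.Ioc a b)) := by
    intro f hf s
    obtain ⟨C, hC⟩ := isCompact_Icc.exists_bound_of_continuousOn (s := Set.Icc a b) hf.continuousOn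
    refine MemLp.of_bound hf.abs.aestronglyMeasurable C ?_
    filter_upwards [ae_restrict_mem measurableSet_Ioc] with θ hθ
    simpa using hC θ (Set.Ioc_subset_Icc_self hθ)
  calc |∫ θ in a..b, f θ * g θ| ≤ ∫ θ in a..b, |f θ * g θ| :=
        intervalIntegral.abs_integral_le_integral_abs hab
    _ = ∫ θ in a..b, |f θ| * |g θ| := by simp_rw [abs_mul]
    _ ≤ _ := by
        simp_rw [intervalIntegral.integral_of_le hab]
        exact integral_mul_le_Lp_mul_Lq_of_nonneg hqr (Filter.Eventually.of_forall fun _ => abs_nonneg _)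
          (Filter.Eventually.of_forall fun _ => abs_nonneg _) (hmem hf _) (hmem hg _)

lemma inv_cot (x : ℝ) : (Real.cot x)⁻¹ = Real.tan x := by
  rw [Real.cot_eq_cos_div_sin, Real.tan_eq_sin_div_cos, inv_div]

lemma cot_pi_div_nonneg {n : ℕ} (hn : 0 < n) : 0 ≤ Real.cot (Real.pi / (4 * n)) := by
  have hn' : (1 : ℝ) ≤ n := by exact_mod_cast hn
  rw [← inv_inv (Real.cot _), inv_cot]
  refine inv_nonneg.2 (Real.tan_nonneg_of_nonneg_of_le_pi_div_two (by positivity) ?_)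
  apply div_le_div_of_nonneg_left Real.pi_pos.le (by norm_num); linarith

lemma cot_add_int_mul_pi (x : ℝ) (n : ℤ) : Real.cot (x + n * Real.pi) = Real.cot x := by
  rw [← inv_inv (Real.cot x), ← inv_inv (Real.cot (x + n * Real.pi)), inv_cot, inv_cot,
    Real.tan_add_int_mul_pi]

/-- The kernel of the discrete Hilbert transform on `ZMod N`. -/
def cycH (N : ℕ) (x : ZMod N) : ℝ := Real.cot (Real.pi * x.val / N) / N

section Cyclic

variable {N : ℕ} [NeZero N]

lemma cycH_intCast (m : ℤ) : cycH N (m : ZMod N) = Real.cot (Real.pi * m / N) / N := by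
  have hN : (N : ℝ) ≠ 0 := NeZero.ne _
  have h1 : (((m : ZMod N).val : ℤ) : ℝ) = ((m % N : ℤ) : ℝ) := by rw [ZMod.val_intCast]
  have h2 : (m : ℝ) = ((m % N : ℤ) : ℝ) + N * ((m / N : ℤ) : ℝ) := by
    exact_mod_cast (Int.emod_add_mul_ediv m N).symm
  rw [cycH, h2, ← h1, Int.cast_natCast]
  rw [show Real.pi * ((m : ZMod N).val + N * ((m / N : ℤ) : ℝ)) / N
    = Real.pi * (m : ZMod N).val / N + (m / N : ℤ) * Real.pi by field_simp, cot_add_int_mul_pi]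

lemma cycH_sub (i j : ZMod N) : cycH N (i - j)
    = Real.cot ((2 * Real.pi * i.val / N - 2 * Real.pi * j.val / N) / 2) / N := by
  have : i - j = (((i.val : ℤ) - j.val : ℤ) : ZMod N) := by simp
  rw [this, cycH_intCast]
  congr 2
  push_cast
  ring

lemma cycH_neg (x : ZMod N) : cycH N (-x) = - cycH N x := by
  have h1 := cycH_sub x 0
  have h2 := cycH_sub 0 x
  rw [sub_zero] at h1
  rw [zero_sub] at h2
  rw [h1, h2, Real.cot_eq_cos_div_sin, Real.cot_eq_cos_div_sin, ← neg_sub, neg_div, Real.cos_neg,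
    Real.sin_neg, div_neg, neg_div]

lemma sum_zmod_val (f : ℕ → ℝ) : ∑ j : ZMod N, f j.val = ∑ j ∈ Finset.range N, f j := by
  refine Finset.sum_bij (fun j _ => j.val) (fun j _ => Finset.mem_range.2 (ZMod.val_lt j))
    (fun i _ j _ h => ZMod.val_injective N h) (fun k hk => ?_) (fun _ _ => rfl)
  exact ⟨(k : ZMod N), Finset.mem_univ _, ZMod.val_cast_of_lt (Finset.mem_range.1 hk)⟩

lemma integral_abs_sum_fejer_rpow_le (b : ZMod N → ℝ) {r : ℝ} (hr : 1 ≤ r) :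
    ∫ θ in (0 : ℝ)..2 * Real.pi, |∑ j, b j * fejer N (θ - 2 * Real.pi * j.val / N)| ^ r
      ≤ 2 * Real.pi / N * ∑ j, |b j| ^ r := by
  have hN : 0 < N := NeZero.pos N
  have hc := continuous_fejer N
  have hr0 : 0 ≤ r := by linarith
  calc _ ≤ ∫ θ in (0 : ℝ)..2 * Real.pi, ∑ j, fejer N (θ - 2 * Real.pi * j.val / N) * |b j| ^ r := by
        refine intervalIntegral.integral_mono_on (by positivity) (Continuous.intervalIntegrable
          (Continuous.rpow_const (by fun_prop) fun _ => Or.inr hr0) _ _)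
          (Continuous.intervalIntegrable (by fun_prop) _ _) fun θ _ => ?_
        refine le_trans ?_ (Real.rpow_arith_mean_le_arith_mean_rpow Finset.univ
          (fun j : ZMod N => fejer N (θ - 2 * Real.pi * j.val / N)) (fun j => |b j|)
          (fun _ _ => fejer_nonneg _ _) ?_ (fun _ _ => abs_nonneg _) hr)
        · refine Real.rpow_le_rpow (abs_nonneg _) ((Finset.abs_sum_le_sum_abs _ _).trans
            (le_of_eq (Finset.sum_congr rfl fun j _ => ?_))) hr0
          rw [abs_mul, abs_of_nonneg (fejer_nonneg _ _), mul_comm]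
        · rw [sum_zmod_val fun j => fejer N (θ - 2 * Real.pi * j / N), sum_fejer hN]
    _ = _ := by
        rw [intervalIntegral.integral_finsetSum fun j _ =>
          Continuous.intervalIntegrable (by fun_prop) _ _, Finset.mul_sum]
        refine Finset.sum_congr rfl fun j _ => ?_
        rw [intervalIntegral.integral_mul_const, integral_fejer hN]

lemma integral_abs_sum_conjFejer_rpow_le (b : ZMod N → ℝ) {r : ℝ} (hr : 1 < r) (hr2 : r < 2) :
    ∫ θ in (0 : ℝ)..2 * Real.pi, |∑ j, b j * conjFejer N (θ - 2 * Real.pi * j.val / N)| ^ r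
      ≤ Real.tan (Real.pi / (2 * r)) ^ r * (2 * Real.pi / N * ∑ j, |b j| ^ r) := by
  set F : ℂ → ℂ := fun z => ∑ j : ZMod N, (b j : ℂ) *
    ((2 * ∑ k ∈ Finset.range N, ((N - k : ℝ) : ℂ) *
      Complex.exp ((-(k * (2 * Real.pi * j.val / N)) : ℝ) * Complex.I) * z ^ k - N) / N ^ 2) with hF
  have hFd : Differentiable ℂ F := by fun_prop
  have hN : 0 < N := NeZero.pos N
  have hN' : (N : ℂ) ≠ 0 := NeZero.ne _
  have hterm : ∀ (k : ℕ) (c θ : ℝ), ((N - k : ℝ) : ℂ) * Complex.exp ((-(k * c) : ℝ) * Complex.I)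
      * Complex.exp (θ * Complex.I) ^ k = (((N - k) * Real.cos (k * (θ - c)) : ℝ) : ℂ)
        + (((N - k) * Real.sin (k * (θ - c)) : ℝ) : ℂ) * Complex.I := fun k c θ => by
    rw [mul_assoc, ← Complex.exp_nat_mul, ← Complex.exp_add, show ((-(k * c) : ℝ) : ℂ) * Complex.I
      + k * (θ * Complex.I) = ((k * (θ - c) : ℝ) : ℂ) * Complex.I by push_cast; ring,
      Complex.exp_mul_I, ← Complex.ofReal_cos, ← Complex.ofReal_sin]
    push_cast
    ring
  have hval : ∀ θ : ℝ, F (Complex.exp (θ * Complex.I))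
      = ((∑ j, b j * fejer N (θ - 2 * Real.pi * j.val / N) : ℝ) : ℂ)
        + ((∑ j, b j * conjFejer N (θ - 2 * Real.pi * j.val / N) : ℝ) : ℂ) * Complex.I := fun θ => by
    simp only [hF, hterm, Complex.ofReal_sum, Finset.sum_mul, ← Finset.sum_add_distrib]
    refine Finset.sum_congr rfl fun j _ => ?_
    rw [fejer, conjFejer, Finset.sum_add_distrib, ← Finset.sum_mul]
    push_cast
    ring
  have hF0 : (F 0).im = 0 := by
    have : F 0 = ((∑ j : ZMod N, b j * (1 / N) : ℝ) : ℂ) := by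
      simp only [hF, Complex.ofReal_sum]
      refine Finset.sum_congr rfl fun j _ => ?_
      rw [Finset.sum_eq_single_of_mem 0 (Finset.mem_range.2 hN) fun k _ hk => by simp [hk]]
      simp
      left
      field_simp
      norm_num
    rw [this, Complex.ofReal_im]
  have h := integral_abs_im_rpow_le hFd hF0 hr hr2
  have hre : ∀ x y : ℝ, ((x : ℂ) + y * Complex.I).re = x := by simp
  have him : ∀ x y : ℝ, ((x : ℂ) + y * Complex.I).im = y := by simp
  simp only [hval, hre, him] at h
  have hγ : Real.pi / (2 * r) < Real.pi / 2 := by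
    apply div_lt_div_of_pos_left Real.pi_pos (by norm_num); linarith
  refine h.trans (mul_le_mul_of_nonneg_left (integral_abs_sum_fejer_rpow_le b hr.le) ?_)
  exact Real.rpow_nonneg (Real.tan_nonneg_of_nonneg_of_le_pi_div_two
    (div_nonneg Real.pi_pos.le (by linarith)) hγ.le) _

lemma abs_sum_cycH_le (a b : ZMod N → ℝ) {q r : ℝ} (hqr : q.HolderConjugate r) (hr2 : r < 2) :
    |∑ i, ∑ j, cycH N (i - j) * a i * b j|
      ≤ Real.tan (Real.pi / (2 * r)) * (finNorm q a * finNorm r b) := by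
  have hN : 0 < N := NeZero.pos N
  have hN' : (N : ℝ) ≠ 0 := NeZero.ne _
  have hr : 1 < r := hqr.symm.lt
  have hq : 1 < q := hqr.lt
  have hpi := Real.pi_pos
  have hc := continuous_fejer N
  have hc' := continuous_conjFejer N
  have hγ : Real.pi / (2 * r) < Real.pi / 2 := by
    apply div_lt_div_of_pos_left Real.pi_pos (by norm_num); linarith
  have hT : 0 ≤ Real.tan (Real.pi / (2 * r)) := Real.tan_nonneg_of_nonneg_of_le_pi_div_two
    (div_nonneg Real.pi_pos.le (by linarith)) hγ.le
  set u : ℝ → ℝ := fun θ => ∑ i : ZMod N, a i * fejer N (θ - 2 * Real.pi * i.val / N)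
  set v : ℝ → ℝ := fun θ => ∑ j : ZMod N, b j * conjFejer N (θ - 2 * Real.pi * j.val / N)
  have huv : ∫ θ in (0 : ℝ)..2 * Real.pi, u θ * v θ
      = 2 * Real.pi / N * ∑ i, ∑ j, cycH N (i - j) * a i * b j := by
    have : ∀ θ, u θ * v θ = ∑ i : ZMod N, ∑ j : ZMod N, a i * b j *
        (fejer N (θ - 2 * Real.pi * i.val / N) * conjFejer N (θ - 2 * Real.pi * j.val / N)) := fun θ => by
      rw [Finset.sum_mul_sum]
      exact Finset.sum_congr rfl fun k _ => Finset.sum_congr rfl fun l _ => by ring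
    simp_rw [this]
    rw [intervalIntegral.integral_finsetSum fun j _ =>
          Continuous.intervalIntegrable (by fun_prop) _ _, Finset.mul_sum]
    refine Finset.sum_congr rfl fun i _ => ?_
    rw [intervalIntegral.integral_finsetSum fun j _ =>
          Continuous.intervalIntegrable (by fun_prop) _ _, Finset.mul_sum]
    refine Finset.sum_congr rfl fun j _ => ?_
    rw [intervalIntegral.integral_const_mul, integral_fejer_mul_conjFejer hN
      (d := (i.val : ℤ) - j.val) (by push_cast; field_simp), cycH_sub]
    ring
  have h := abs_intervalIntegral_mul_le (f := u) (g := v) (by fun_prop) (by fun_prop) hqr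
    (by positivity : (0 : ℝ) ≤ 2 * Real.pi)
  have hA : 0 ≤ ∑ i, |a i| ^ q := Finset.sum_nonneg fun _ _ => Real.rpow_nonneg (abs_nonneg _) _
  have hB : 0 ≤ ∑ i, |b i| ^ r := Finset.sum_nonneg fun _ _ => Real.rpow_nonneg (abs_nonneg _) _
  have h1 : (∫ θ in (0 : ℝ)..2 * Real.pi, |u θ| ^ q) ^ (1 / q) ≤ (2 * Real.pi / N) ^ (1 / q) * finNorm q a := by
    rw [finNorm, ← Real.mul_rpow (by positivity) hA]
    exact Real.rpow_le_rpow (intervalIntegral.integral_nonneg (by positivity)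
      fun _ _ => Real.rpow_nonneg (abs_nonneg _) _) (integral_abs_sum_fejer_rpow_le a hq.le) (by positivity)
  have h2 : (∫ θ in (0 : ℝ)..2 * Real.pi, |v θ| ^ r) ^ (1 / r)
      ≤ Real.tan (Real.pi / (2 * r)) * ((2 * Real.pi / N) ^ (1 / r) * finNorm r b) := by
    have e : Real.tan (Real.pi / (2 * r)) = (Real.tan (Real.pi / (2 * r)) ^ r) ^ (1 / r) := by
      rw [← Real.rpow_mul hT, mul_one_div_cancel (by linarith), Real.rpow_one]
    rw [e, finNorm, ← Real.mul_rpow (by positivity) hB, ← Real.mul_rpow (Real.rpow_nonneg hT _) (by positivity)]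
    exact Real.rpow_le_rpow (intervalIntegral.integral_nonneg (by positivity)
      fun _ _ => Real.rpow_nonneg (abs_nonneg _) _) (integral_abs_sum_conjFejer_rpow_le b hr hr2) (by positivity)
  rw [huv, abs_mul, abs_of_pos (by positivity)] at h
  have h3 : (2 * Real.pi / N : ℝ) ^ (1 / q) * (2 * Real.pi / N) ^ (1 / r) = 2 * Real.pi / N := by
    rw [← Real.rpow_add (by positivity), one_div, one_div, hqr.inv_add_inv_eq_one, Real.rpow_one]
  have h4 := h.trans (mul_le_mul h1 h2 (Real.rpow_nonneg (intervalIntegral.integral_nonneg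
    (by positivity) fun _ _ => Real.rpow_nonneg (abs_nonneg _) _) _)
    (mul_nonneg (by positivity) (finNorm_nonneg _ _)))
  refine le_of_mul_le_mul_left (h4.trans (le_of_eq ?_)) (by positivity : 0 < 2 * Real.pi / N)
  linear_combination Real.tan (Real.pi / (2 * r)) * finNorm q a * finNorm r b * h3

/-- Convolution on `ZMod N`. -/
def cycConv (K a : ZMod N → ℝ) (n : ZMod N) : ℝ := ∑ j, K (n - j) * a j

/-- Sharp bound for the discrete Hilbert transform on `ZMod N`. -/
lemma finNorm_cycH_le (a : ZMod N → ℝ) {q : ℝ} (hq : 2 < q) :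
    finNorm q (cycConv (cycH N) a) ≤ Real.cot (Real.pi / (2 * q)) * finNorm q a := by
  obtain ⟨r, hqr⟩ : ∃ r, q.HolderConjugate r := ⟨_, Real.HolderConjugate.conjExponent (by linarith)⟩
  have hr : 1 < r := hqr.symm.lt
  have hsum := hqr.inv_add_inv_eq_one
  have hr2 : r < 2 := by
    have h1 : q⁻¹ < 2⁻¹ := inv_strictAnti₀ (by norm_num) hq
    have h2 : 2⁻¹ < r⁻¹ := by linarith
    exact (inv_lt_inv₀ (by norm_num) (by linarith)).1 h2
  have hcot : Real.cot (Real.pi / (2 * q)) = Real.tan (Real.pi / (2 * r)) := by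
    have : Real.pi / (2 * r) = Real.pi / 2 - Real.pi / (2 * q) := by
      have e : r⁻¹ = 1 - q⁻¹ := by linarith
      have : Real.pi / (2 * r) = Real.pi / 2 * r⁻¹ := by field_simp
      rw [this, e]; field_simp
    rw [this, Real.tan_pi_div_two_sub, ← inv_cot, inv_inv]
  rw [hcot]
  set y := cycConv (cycH N) a with hy
  set b : ZMod N → ℝ := fun j => SignType.sign (y j) * |y j| ^ (q - 1) with hb
  have hq1 : (q - 1) * r = q := by
    have := hqr.sub_one_mul_conj; linarith
  have hbr : ∀ j, |b j| ^ r = |y j| ^ q := fun j => by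
    by_cases h0 : y j = 0
    · simp [hb, h0, Real.zero_rpow (by linarith : r ≠ 0), Real.zero_rpow (by linarith : q ≠ 0)]
    · have : |((SignType.sign (y j) : SignType) : ℝ)| = 1 := by
        rcases lt_or_gt_of_ne h0 with h | h
        · simp [sign_neg h]
        · simp [sign_pos h]
      rw [hb]
      simp only
      rw [abs_mul, this, one_mul, abs_of_nonneg (Real.rpow_nonneg (abs_nonneg _) _),
        ← Real.rpow_mul (abs_nonneg _), hq1]
  have hyb : ∀ j, y j * b j = |y j| ^ q := fun j => by
    by_cases h0 : y j = 0
    · simp [hb, h0, Real.zero_rpow (by linarith : q ≠ 0)]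
    · have : y j * SignType.sign (y j) = |y j| := by
        rw [mul_comm]; exact sign_mul_self (y j)
      rw [hb]
      simp only
      rw [← mul_assoc, this, mul_comm, ← Real.rpow_add_one (abs_ne_zero.2 h0)]
      ring_nf
  have h := abs_sum_cycH_le a b hqr hr2
  have hS : ∑ i, ∑ j, cycH N (i - j) * a i * b j = - ∑ j, |y j| ^ q := by
    rw [Finset.sum_comm, ← Finset.sum_neg_distrib]
    refine Finset.sum_congr rfl fun j _ => ?_
    rw [← hyb, hy, cycConv, Finset.sum_mul, ← Finset.sum_neg_distrib]
    refine Finset.sum_congr rfl fun i _ => ?_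
    rw [← neg_sub j i, cycH_neg]
    ring
  have hY : 0 ≤ ∑ j, |y j| ^ q := Finset.sum_nonneg fun _ _ => Real.rpow_nonneg (abs_nonneg _) _
  rw [hS, abs_neg, abs_of_nonneg hY] at h
  rw [finNorm, finNorm, Finset.sum_congr rfl fun j _ => hbr j] at h
  rw [finNorm, finNorm]
  rcases hY.eq_or_lt with h0 | h0
  · rw [← h0, Real.zero_rpow (by simp; linarith)]
    have hγ : Real.pi / (2 * r) < Real.pi / 2 := by
      apply div_lt_div_of_pos_left Real.pi_pos (by norm_num); linarith
    exact mul_nonneg (Real.tan_nonneg_of_nonneg_of_le_pi_div_two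
      (div_nonneg Real.pi_pos.le (by linarith)) hγ.le) (finNorm_nonneg q a)
  · have e : ∑ j, |y j| ^ q = (∑ j, |y j| ^ q) ^ (1 / q) * (∑ j, |y j| ^ q) ^ (1 / r) := by
      rw [← Real.rpow_add h0, one_div, one_div, hsum, Real.rpow_one]
    nth_rw 1 [e] at h
    rw [← mul_assoc] at h
    exact le_of_mul_le_mul_right h (Real.rpow_pos_of_pos h0 _)

end Cyclic

/-- The kernel of the Riesz–Titchmarsh operator on `ZMod N`. -/
def cycR (N : ℕ) (x : ZMod N) : ℝ := Real.cot (Real.pi * (x.val + 1 / 2) / N) / N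

/-- The nonnegative kernel appearing in the product formula for `cycR`. -/
def cycI (N : ℕ) (x : ZMod N) : ℝ := 1 / (N * Real.sin (Real.pi * (x.val + 1 / 2) / N)) ^ 2

lemma cycI_nonneg {N : ℕ} (x : ZMod N) : 0 ≤ cycI N x := by
  unfold cycI; positivity

/-- The averaging kernel on `ZMod N`. -/
def cycE (N : ℕ) (_ : ZMod N) : ℝ := 1 / N

section CyclicProduct

variable {N : ℕ} [NeZero N]

lemma cycR_intCast (m : ℤ) : cycR N (m : ZMod N) = Real.cot (Real.pi * (m + 1 / 2) / N) / N := by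
  have hN : (N : ℝ) ≠ 0 := NeZero.ne _
  have h1 : (((m : ZMod N).val : ℤ) : ℝ) = ((m % N : ℤ) : ℝ) := by rw [ZMod.val_intCast]
  have h2 : (m : ℝ) = ((m % N : ℤ) : ℝ) + N * ((m / N : ℤ) : ℝ) := by
    exact_mod_cast (Int.emod_add_mul_ediv m N).symm
  rw [cycR, h2, ← h1, Int.cast_natCast]
  rw [show Real.pi * ((m : ZMod N).val + N * ((m / N : ℤ) : ℝ) + 1 / 2) / N
    = Real.pi * ((m : ZMod N).val + 1 / 2) / N + (m / N : ℤ) * Real.pi by field_simp; ring,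
    cot_add_int_mul_pi]

lemma sin_half_integer_ne_zero (x : ZMod N) : Real.sin (Real.pi * (x.val + 1 / 2) / N) ≠ 0 := by
  have hN : (0 : ℝ) < N := by exact_mod_cast NeZero.pos N
  have hx : (x.val : ℝ) + 1 ≤ N := by exact_mod_cast ZMod.val_lt x
  refine (Real.sin_pos_of_pos_of_lt_pi (by positivity) ?_).ne'
  rw [div_lt_iff₀ hN]
  exact mul_lt_mul_of_pos_left (by linarith) Real.pi_pos

lemma cycR_neg_one_sub (x : ZMod N) : cycR N (-1 - x) = - cycR N x := by
  have h1 : x = ((x.val : ℤ) : ZMod N) := by simp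
  have h2 : -1 - x = ((-1 - x.val : ℤ) : ZMod N) := by simp
  have h3 : cycR N x = cycR N ((x.val : ℤ) : ZMod N) := by rw [← h1]
  rw [h2, h3, cycR_intCast, cycR_intCast, show Real.pi * (((-1 - x.val : ℤ) : ℝ) + 1 / 2) / N
    = -(Real.pi * (((x.val : ℤ) : ℝ) + 1 / 2) / N) by push_cast; ring, Real.cot_eq_cos_div_sin,
    Real.cot_eq_cos_div_sin, Real.cos_neg, Real.sin_neg, div_neg, neg_div]

lemma sum_cycR : ∑ x, cycR N x = 0 := by
  have := Equiv.sum_comp (Equiv.subLeft (-1 : ZMod N)) (cycR N)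
  simp only [Equiv.subLeft_apply, cycR_neg_one_sub, Finset.sum_neg_distrib] at this
  linarith

lemma sum_cycH : ∑ x, cycH N x = 0 := by
  have := Equiv.sum_comp (Equiv.neg (ZMod N)) (cycH N)
  simp only [Equiv.neg_apply, cycH_neg, Finset.sum_neg_distrib] at this
  linarith

lemma cycR_mul_cycR (j k : ZMod N) : cycR N j * cycR N k
    = cycH N (k - j) * cycR N j + cycH N (j - k) * cycR N k
      + (if j = k then cycI N j else 0) - 1 / N ^ 2 := by
  have hN : (N : ℝ) ≠ 0 := NeZero.ne _
  have hj := sin_half_integer_ne_zero j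
  have hk := sin_half_integer_ne_zero k
  by_cases hjk : j = k
  · subst hjk
    have h0 : cycH N 0 = 0 := by
      have := cycH_neg (0 : ZMod N)
      rw [neg_zero] at this
      linarith
    rw [if_pos rfl, sub_self, h0, cycR, cycI, Real.cot_eq_cos_div_sin]
    generalize Real.pi * (j.val + 1 / 2) / N = α at *
    have := Real.sin_sq_add_cos_sq α
    field_simp
    linarith
  · have hs : Real.sin (Real.pi * (k.val + 1 / 2) / N - Real.pi * (j.val + 1 / 2) / N) ≠ 0 := by
      intro h
      obtain ⟨m, hm⟩ := Real.sin_eq_zero_iff.1 h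
      apply hjk
      have h1 : (m : ℝ) * N = k.val - j.val := by
        field_simp at hm
        linarith
      have h2 : (m : ℤ) * N = k.val - j.val := by exact_mod_cast h1
      have h3 := congrArg (Int.cast : ℤ → ZMod N) h2
      simp at h3
      exact (sub_eq_zero.1 h3.symm).symm
    have e : cycH N (k - j)
        = Real.cot (Real.pi * (k.val + 1 / 2) / N - Real.pi * (j.val + 1 / 2) / N) / N := by
      rw [cycH_sub]; congr 2; ring
    rw [if_neg hjk, ← neg_sub k j, cycH_neg, e, cycR, cycR]
    generalize Real.pi * (k.val + 1 / 2) / N = β at *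
    generalize Real.pi * (j.val + 1 / 2) / N = α at *
    simp only [Real.cot_eq_cos_div_sin]
    have h1 : Real.cos α / Real.sin α - Real.cos β / Real.sin β
        = Real.sin (β - α) / (Real.sin α * Real.sin β) := by
      rw [Real.sin_sub]; field_simp
    have h2 : Real.cos (β - α) / Real.sin (β - α) * (Real.cos α / Real.sin α - Real.cos β / Real.sin β)
        = Real.cos α / Real.sin α * (Real.cos β / Real.sin β) + 1 := by
      rw [h1, div_mul_div_cancel₀ hs, Real.cos_sub]; field_simp
    linear_combination (-1 / (N : ℝ) ^ 2) * h2

lemma sum_cycI : ∑ x, cycI N x = 1 := by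
  have hN : (N : ℝ) ≠ 0 := NeZero.ne _
  have h := Finset.sum_mul_sum Finset.univ Finset.univ (cycR N) (cycR N)
  simp only [cycR_mul_cycR] at h
  have h1 : ∀ j : ZMod N, ∑ k, cycH N (k - j) = 0 := fun j => by
    exact (Equiv.sum_comp (Equiv.subRight j) (cycH N)).trans sum_cycH
  have h2 : ∀ j : ZMod N, ∑ k, cycH N (j - k) = 0 := fun j => by
    exact (Equiv.sum_comp (Equiv.subLeft j) (cycH N)).trans sum_cycH
  simp only [Finset.sum_add_distrib, Finset.sum_sub_distrib, ← Finset.sum_mul, h1,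
    Finset.sum_ite_eq, Finset.mem_univ, if_true] at h
  rw [sum_cycR, Finset.sum_comm] at h
  simp only [← Finset.sum_mul, h1] at h
  simp at h
  field_simp at h
  linarith

lemma sum_cycConv (K a : ZMod N → ℝ) : ∑ n, cycConv K a n = (∑ n, K n) * ∑ n, a n := by
  simp only [cycConv]
  rw [Finset.sum_comm, Finset.mul_sum]
  refine Finset.sum_congr rfl fun j _ => ?_
  rw [← Finset.sum_mul, ← Equiv.sum_comp (Equiv.subRight j) K]
  rfl

/-- Product formula for the Riesz–Titchmarsh operator on `ZMod N`. -/
lemma cycConv_cycR_mul (a b : ZMod N → ℝ) (n : ZMod N) :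
    cycConv (cycR N) a n * cycConv (cycR N) b n
      = cycConv (cycR N) (fun m => a m * cycConv (cycH N) b m + b m * cycConv (cycH N) a m) n
        + cycConv (cycI N) (fun m => a m * b m) n
        - cycConv (cycE N) a n * cycConv (cycE N) b n := by
  have h : cycConv (cycR N) a n * cycConv (cycR N) b n
      = ∑ j, ∑ k, (cycR N (n - j) * (a j * (cycH N (j - k) * b k))
        + cycR N (n - k) * (b k * (cycH N (k - j) * a j))
        + (if j = k then cycI N (n - j) * (a j * b k) else 0) - (1 / N * a j) * (1 / N * b k)) := by
    simp only [cycConv]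
    rw [Finset.sum_mul_sum]
    refine Finset.sum_congr rfl fun j _ => Finset.sum_congr rfl fun k _ => ?_
    have := cycR_mul_cycR (n - j) (n - k)
    rw [sub_sub_sub_cancel_left, sub_sub_sub_cancel_left] at this
    have e : (n - j = n - k) ↔ j = k := sub_right_inj
    simp only [e] at this
    split_ifs at this ⊢ <;> linear_combination a j * b k * this
  rw [h]
  simp only [Finset.sum_add_distrib, Finset.sum_sub_distrib, Finset.sum_ite_eq, Finset.mem_univ,
    if_true, cycConv, mul_add, ← Finset.mul_sum, cycE, ← Finset.sum_mul]
  congr 2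
  congr 1
  rw [Finset.sum_comm]
  simp only [← Finset.mul_sum]

end CyclicProduct

section FinNorm

variable {ι : Type*} [Fintype ι]

lemma finNorm_add_le (f g : ι → ℝ) {q : ℝ} (hq : 1 ≤ q) :
    finNorm q (fun i => f i + g i) ≤ finNorm q f + finNorm q g :=
  Real.Lp_add_le _ f g hq

lemma finNorm_neg (f : ι → ℝ) (q : ℝ) : finNorm q (fun i => - f i) = finNorm q f := by
  simp [finNorm]

lemma finNorm_sub_le (f g : ι → ℝ) {q : ℝ} (hq : 1 ≤ q) :
    finNorm q (fun i => f i - g i) ≤ finNorm q f + finNorm q g := by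
  simpa only [sub_eq_add_neg, finNorm_neg] using finNorm_add_le f (fun i => - g i) hq

lemma finNorm_mul_le (f g : ι → ℝ) {p q r : ℝ} (h : p.HolderTriple q r) :
    finNorm r (fun i => f i * g i) ≤ finNorm p f * finNorm q g := by
  have h1 := Real.Lr_rpow_le_Lp_mul_Lq Finset.univ f g h
  have hA : 0 ≤ ∑ i, |f i| ^ p := Finset.sum_nonneg fun _ _ => Real.rpow_nonneg (abs_nonneg _) _
  have hB : 0 ≤ ∑ i, |g i| ^ q := Finset.sum_nonneg fun _ _ => Real.rpow_nonneg (abs_nonneg _) _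
  have hr := h.pos'
  have h2 := Real.rpow_le_rpow (Finset.sum_nonneg fun _ _ => Real.rpow_nonneg (abs_nonneg _) _) h1
    (by positivity : 0 ≤ 1 / r)
  rwa [Real.mul_rpow (Real.rpow_nonneg hA _) (Real.rpow_nonneg hB _), ← Real.rpow_mul hA,
    ← Real.rpow_mul hB, show r / p * (1 / r) = 1 / p by field_simp,
    show r / q * (1 / r) = 1 / q by field_simp] at h2

lemma finNorm_pow (f : ι → ℝ) {p : ℝ} (hp : p ≠ 0) {j : ℕ} (hj : j ≠ 0) :
    finNorm (p / j) (fun i => f i ^ j) = finNorm p f ^ j := by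
  have hj' : (j : ℝ) ≠ 0 := Nat.cast_ne_zero.2 hj
  have hA : 0 ≤ ∑ i, |f i| ^ p := Finset.sum_nonneg fun _ _ => Real.rpow_nonneg (abs_nonneg _) _
  rw [finNorm, finNorm, ← Real.rpow_natCast, ← Real.rpow_mul hA]
  congr 1
  · refine Finset.sum_congr rfl fun i _ => ?_
    rw [abs_pow, ← Real.rpow_natCast, ← Real.rpow_mul (abs_nonneg _), mul_div_cancel₀ _ hj']
  · field_simp

lemma finNorm_const_mul (c : ℝ) (f : ι → ℝ) {q : ℝ} (hq : 0 < q) :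
    finNorm q (fun i => c * f i) = |c| * finNorm q f := by
  have hA : 0 ≤ ∑ i, |f i| ^ q := Finset.sum_nonneg fun _ _ => Real.rpow_nonneg (abs_nonneg _) _
  simp only [finNorm, abs_mul, Real.mul_rpow (abs_nonneg _) (abs_nonneg _), ← Finset.mul_sum]
  rw [Real.mul_rpow (Real.rpow_nonneg (abs_nonneg _) _) hA, ← Real.rpow_mul (abs_nonneg _),
    mul_one_div_cancel hq.ne', Real.rpow_one]

lemma finNorm_rpow (f : ι → ℝ) {q : ℝ} (hq : 0 < q) : finNorm q f ^ q = ∑ i, |f i| ^ q := by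
  have hA : 0 ≤ ∑ i, |f i| ^ q := Finset.sum_nonneg fun _ _ => Real.rpow_nonneg (abs_nonneg _) _
  rw [finNorm, ← Real.rpow_mul hA, one_div_mul_cancel hq.ne', Real.rpow_one]

lemma eq_zero_of_finNorm_eq_zero {f : ι → ℝ} {q : ℝ} (hq : 0 < q) (h : finNorm q f = 0) (i : ι) :
    f i = 0 := by
  have h1 := finNorm_rpow f hq
  rw [h, Real.zero_rpow hq.ne', eq_comm,
    Finset.sum_eq_zero_iff_of_nonneg fun _ _ => Real.rpow_nonneg (abs_nonneg _) _] at h1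
  simpa [hq.ne'] using (Real.rpow_eq_zero_iff_of_nonneg (abs_nonneg _)).1 (h1 i (Finset.mem_univ i))

end FinNorm

section CyclicBound

variable {N : ℕ} [NeZero N]

lemma finNorm_cycConv_le {K : ZMod N → ℝ} (hK : ∀ x, 0 ≤ K x) (hK1 : ∑ x, K x = 1)
    (a : ZMod N → ℝ) {q : ℝ} (hq : 1 ≤ q) : finNorm q (cycConv K a) ≤ finNorm q a := by
  have hq0 : 0 ≤ q := by linarith
  refine Real.rpow_le_rpow (Finset.sum_nonneg fun _ _ => Real.rpow_nonneg (abs_nonneg _) _) ?_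
    (by positivity)
  calc ∑ n, |cycConv K a n| ^ q ≤ ∑ n, cycConv K (fun m => |a m| ^ q) n := by
        refine Finset.sum_le_sum fun n _ => ?_
        refine le_trans ?_ (Real.rpow_arith_mean_le_arith_mean_rpow Finset.univ
          (fun j => K (n - j)) (fun j => |a j|) (fun _ _ => hK _) ?_ (fun _ _ => abs_nonneg _) hq)
        · refine Real.rpow_le_rpow (abs_nonneg _) ((Finset.abs_sum_le_sum_abs _ _).trans
            (le_of_eq (Finset.sum_congr rfl fun j _ => ?_))) hq0
          rw [abs_mul, abs_of_nonneg (hK _)]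
        · exact (Equiv.sum_comp (Equiv.subLeft n) K).trans hK1
    _ = _ := by rw [sum_cycConv, hK1, one_mul]

lemma finNorm_two_cycR_le (a : ZMod N → ℝ) : finNorm 2 (cycConv (cycR N) a) ≤ finNorm 2 a := by
  refine Real.rpow_le_rpow (Finset.sum_nonneg fun _ _ => Real.rpow_nonneg (abs_nonneg _) _) ?_
    (by positivity)
  simp only [Real.rpow_two, sq_abs]
  calc ∑ n, cycConv (cycR N) a n ^ 2 = ∑ n, (cycConv (cycR N)
          (fun m => a m * cycConv (cycH N) a m + a m * cycConv (cycH N) a m) n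
        + cycConv (cycI N) (fun m => a m * a m) n - cycConv (cycE N) a n * cycConv (cycE N) a n) :=
        Finset.sum_congr rfl fun n _ => by rw [sq, cycConv_cycR_mul]
    _ ≤ ∑ n, (cycConv (cycR N)
          (fun m => a m * cycConv (cycH N) a m + a m * cycConv (cycH N) a m) n
        + cycConv (cycI N) (fun m => a m * a m) n) :=
        Finset.sum_le_sum fun n _ => sub_le_self _ (mul_self_nonneg _)
    _ = _ := by
        rw [Finset.sum_add_distrib, sum_cycConv, sum_cycConv, sum_cycR, sum_cycI, zero_mul, zero_add,
          one_mul]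
        simp only [sq]

lemma sum_cycE : ∑ x, cycE N x = 1 := by
  have hN : (N : ℝ) ≠ 0 := NeZero.ne _
  simp [cycE, hN]

/-- The sequence `b₁ = a`, `b_{j+1} = a * H b_j + b_j * H a` (with index shifted by one). -/
def hilbertSeq (a : ZMod N → ℝ) : ℕ → ZMod N → ℝ
  | 0 => a
  | j + 1 => fun m => a m * cycConv (cycH N) (hilbertSeq a j) m
      + hilbertSeq a j m * cycConv (cycH N) a m

lemma holderTriple_div {p : ℝ} (hp : 0 < p) {j : ℝ} (hj : 0 < j) :
    p.HolderTriple (p / j) (p / (j + 1)) := by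
  have : 0 < p / j := by positivity
  refine ⟨?_, hp, this⟩
  field_simp
  ring

lemma sin_pos_of_le {n j : ℕ} (hj : 0 < j) (hjn : j ≤ n) :
    0 < Real.sin (j * (Real.pi / (4 * n))) := by
  have hj' : (0 : ℝ) < j := by exact_mod_cast hj
  have hn : (0 : ℝ) < n := by exact_mod_cast hj.trans_le hjn
  have hjn' : (j : ℝ) ≤ n := by exact_mod_cast hjn
  have hpi := Real.pi_pos
  refine Real.sin_pos_of_pos_of_lt_pi (by positivity) ?_
  rw [mul_div_assoc', div_lt_iff₀ (by positivity)]
  nlinarith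

lemma finNorm_hilbertSeq_le {a : ZMod N → ℝ} {n : ℕ} (ha : finNorm (2 * n) a = 1) (j : ℕ)
    (hj : j + 1 ≤ n) : finNorm (2 * n / (j + 1 : ℕ)) (hilbertSeq a j)
      ≤ Real.sin ((j + 1 : ℕ) * (Real.pi / (4 * n))) / Real.sin (Real.pi / (4 * n)) ^ (j + 1) := by
  have hs1 := sin_pos_of_le (n := n) (j := 1) one_pos (by omega)
  rw [Nat.cast_one, one_mul] at hs1
  have hn : (0 : ℝ) < n := by exact_mod_cast (show 0 < n by omega)
  induction j with
  | zero =>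
    simp only [zero_add, Nat.cast_one, div_one, one_mul, pow_one, hilbertSeq, ha]
    rw [div_self hs1.ne']
  | succ j ih =>
    have ih := ih (by omega)
    have hj2 : ((j + 1 : ℕ) : ℝ) + 1 ≤ n := by exact_mod_cast hj
    have hjp : (0 : ℝ) < (j + 1 : ℕ) := by positivity
    have hs := sin_pos_of_le (n := n) (j := j + 1) (by omega) (by omega)
    have hT := holderTriple_div (p := 2 * n) (by positivity) hjp
    have hq : 2 < 2 * (n : ℝ) / (j + 1 : ℕ) := by
      rw [lt_div_iff₀ hjp]; linarith
    have h1 := finNorm_cycH_le (hilbertSeq a j) hq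
    have h2 := finNorm_cycH_le a (q := 2 * n) (by linarith)
    rw [ha, mul_one] at h2
    rw [show Real.pi / (2 * (2 * (n : ℝ) / (j + 1 : ℕ))) = (j + 1 : ℕ) * (Real.pi / (4 * n)) by
      field_simp; ring] at h1
    rw [show Real.pi / (2 * (2 * (n : ℝ))) = Real.pi / (4 * n) by ring_nf] at h2
    have hc0 : 0 ≤ Real.cot ((j + 1 : ℕ) * (Real.pi / (4 * n))) := by
      rw [← inv_inv (Real.cot _), inv_cot]
      refine inv_nonneg.2 (Real.tan_nonneg_of_nonneg_of_le_pi_div_two (by positivity) ?_)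
      rw [mul_div_assoc', div_le_div_iff₀ (by positivity) (by positivity)]
      nlinarith [Real.pi_pos]
    rw [show ((j + 1 + 1 : ℕ) : ℝ) = ((j + 1 : ℕ) : ℝ) + 1 by push_cast; ring]
    have h3 := finNorm_mul_le a (cycConv (cycH N) (hilbertSeq a j)) hT
    have h4 := finNorm_mul_le (cycConv (cycH N) a) (hilbertSeq a j) hT
    rw [ha, one_mul] at h3
    have h5 := finNorm_add_le (fun i => a i * cycConv (cycH N) (hilbertSeq a j) i)
      (fun i => hilbertSeq a j i * cycConv (cycH N) a i) (q := 2 * n / ((j + 1 : ℕ) + 1)) (by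
        rw [le_div_iff₀ (by positivity)]; linarith)
    rw [show hilbertSeq a (j + 1) = fun m => a m * cycConv (cycH N) (hilbertSeq a j) m
      + hilbertSeq a j m * cycConv (cycH N) a m from rfl]
    have h6 := h3.trans (h1.trans (mul_le_mul_of_nonneg_left ih hc0))
    have h7 := h4.trans (mul_le_mul h2 ih (finNorm_nonneg _ _) ((finNorm_nonneg _ _).trans h2))
    simp only [mul_comm (cycConv (cycH N) a _)] at h7
    refine (h5.trans (add_le_add h6 h7)).trans (le_of_eq ?_)
    rw [add_mul ((j + 1 : ℕ) : ℝ), one_mul, Real.sin_add]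
    generalize ((j + 1 : ℕ) : ℝ) * (Real.pi / (4 * n)) = α at *
    generalize Real.pi / (4 * (n : ℝ)) = θ at *
    rw [Real.cot_eq_cos_div_sin, Real.cot_eq_cos_div_sin, pow_succ]
    field_simp
    ring

lemma cycR_error_bound {a : ZMod N → ℝ} {n : ℕ} (ha : finNorm (2 * n) a = 1)
    (hc : Real.cot (Real.pi / (4 * n)) ≤ finNorm (2 * n) (cycConv (cycR N) a)) (j : ℕ)
    (hj : j + 1 ≤ n) :
    finNorm (2 * n / (j + 1 : ℕ))
        (fun m => cycConv (cycR N) a m ^ (j + 1) - cycConv (cycR N) (hilbertSeq a j) m)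
      ≤ (1 + finNorm (2 * n) (cycConv (cycE N) a))
        * (finNorm (2 * n) (cycConv (cycR N) a) / Real.cot (Real.pi / (4 * n))) ^ j
        * (Real.cot (Real.pi / (4 * n)) ^ (j + 1) - Real.cos ((j + 1 : ℕ) * (Real.pi / (4 * n)))
          / Real.sin (Real.pi / (4 * n)) ^ (j + 1)) := by
  have hs1 := sin_pos_of_le (n := n) (j := 1) one_pos (by omega)
  rw [Nat.cast_one, one_mul] at hs1
  have hn : (0 : ℝ) < n := by exact_mod_cast (show 0 < n by omega)
  have hn1 : (1 : ℝ) ≤ n := by exact_mod_cast (show 1 ≤ n by omega)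
  have hcp : 0 < Real.cot (Real.pi / (4 * n)) := by
    rw [Real.cot_eq_cos_div_sin]
    refine div_pos (Real.cos_pos_of_mem_Ioo ⟨?_, ?_⟩) hs1
    · linarith [Real.pi_pos, show 0 ≤ Real.pi / (4 * n) by positivity]
    · apply div_lt_div_of_pos_left Real.pi_pos (by norm_num); linarith
  set x := finNorm (2 * n) (cycConv (cycR N) a)
  set c := Real.cot (Real.pi / (4 * n)) with hcdef
  set η := finNorm (2 * n) (cycConv (cycE N) a)
  have hη : 0 ≤ η := finNorm_nonneg _ _
  induction j with
  | zero =>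
    rw [Real.cot_eq_cos_div_sin] at hcdef
    simp only [zero_add, Nat.cast_one, div_one, one_mul, pow_one, hilbertSeq, sub_self, finNorm,
      ← hcdef, mul_zero, abs_zero]
    rw [Real.zero_rpow (by positivity), Finset.sum_const_zero, Real.zero_rpow (by positivity)]
  | succ j ih =>
    have ih := ih (by omega)
    have hβ := finNorm_hilbertSeq_le ha j (by omega)
    have hj2 : ((j + 1 : ℕ) : ℝ) + 1 ≤ n := by exact_mod_cast hj
    have hjp : (0 : ℝ) < (j + 1 : ℕ) := by positivity
    have hT := holderTriple_div (p := 2 * n) (by positivity) hjp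
    have hs := sin_pos_of_le (n := n) (j := j + 1) (by omega) (by omega)
    rw [show ((j + 1 + 1 : ℕ) : ℝ) = ((j + 1 : ℕ) : ℝ) + 1 by push_cast; ring]
    have hr1 : 1 ≤ 2 * (n : ℝ) / ((j + 1 : ℕ) + 1) := by
      rw [le_div_iff₀ (by positivity)]; linarith
    have hr2 : 1 ≤ 2 * (n : ℝ) / (j + 1 : ℕ) := by
      rw [le_div_iff₀ (by positivity)]; linarith
    set e : ZMod N → ℝ :=
      fun m => cycConv (cycR N) a m ^ (j + 1) - cycConv (cycR N) (hilbertSeq a j) m with he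
    have hrec : (fun m => cycConv (cycR N) a m ^ (j + 1 + 1)
          - cycConv (cycR N) (hilbertSeq a (j + 1)) m)
        = fun m => (cycConv (cycR N) a m * e m + cycConv (cycI N) (fun k => a k * hilbertSeq a j k) m)
          - cycConv (cycE N) a m * cycConv (cycE N) (hilbertSeq a j) m := by
      funext m
      have := cycConv_cycR_mul a (hilbertSeq a j) m
      simp only [he, hilbertSeq]
      rw [pow_succ]
      linear_combination this
    rw [hrec]
    refine (finNorm_sub_le _ _ hr1).trans ?_
    have h1 := finNorm_add_le (fun m => cycConv (cycR N) a m * e m)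
      (cycConv (cycI N) fun k => a k * hilbertSeq a j k) hr1
    have h2 := finNorm_mul_le (cycConv (cycR N) a) e hT
    have h3 := finNorm_cycConv_le cycI_nonneg sum_cycI (fun k => a k * hilbertSeq a j k) hr1
    have h4 := finNorm_mul_le a (hilbertSeq a j) hT
    have h5 := finNorm_mul_le (cycConv (cycE N) a) (cycConv (cycE N) (hilbertSeq a j)) hT
    have h6 := finNorm_cycConv_le (fun x => by unfold cycE; positivity) sum_cycE (hilbertSeq a j) hr2
    rw [ha, one_mul] at h4
    have hx0 : 0 ≤ x := finNorm_nonneg _ _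
    have h7 := h2.trans (mul_le_mul_of_nonneg_left ih hx0)
    have h8 := h5.trans (mul_le_mul_of_nonneg_left (h6.trans hβ) hη)
    have h9 := (h3.trans h4).trans hβ
    have hy : 1 ≤ x / c := (one_le_div hcp).2 hc
    have hγ : Real.cos (((j + 1 : ℕ) + 1) * (Real.pi / (4 * n))) / Real.sin (Real.pi / (4 * n)) ^ (j + 1 + 1)
        = c * (Real.cos ((j + 1 : ℕ) * (Real.pi / (4 * n))) / Real.sin (Real.pi / (4 * n)) ^ (j + 1))
          - Real.sin ((j + 1 : ℕ) * (Real.pi / (4 * n))) / Real.sin (Real.pi / (4 * n)) ^ (j + 1) := by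
      rw [add_mul ((j + 1 : ℕ) : ℝ), one_mul, Real.cos_add, hcdef, Real.cot_eq_cos_div_sin]
      generalize ((j + 1 : ℕ) : ℝ) * (Real.pi / (4 * n)) = α at *
      generalize Real.pi / (4 * (n : ℝ)) = θ at *
      rw [pow_succ]
      field_simp
    rw [hγ]
    set β := Real.sin ((j + 1 : ℕ) * (Real.pi / (4 * n))) / Real.sin (Real.pi / (4 * n)) ^ (j + 1)
    set γ := Real.cos ((j + 1 : ℕ) * (Real.pi / (4 * n))) / Real.sin (Real.pi / (4 * n)) ^ (j + 1)
    have hβ0 : 0 ≤ β := (finNorm_nonneg _ _).trans hβ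
    have h10 : (1 + η) * β ≤ (1 + η) * (x / c) ^ (j + 1) * β :=
      mul_le_mul_of_nonneg_right (le_mul_of_one_le_right (by linarith) (one_le_pow₀ hy)) hβ0
    have h11 : x * ((1 + η) * (x / c) ^ j * (c ^ (j + 1) - γ))
        = (1 + η) * (x / c) ^ (j + 1) * (c ^ (j + 1 + 1) - c * γ) := by
      have : x = (x / c) * c := by field_simp
      nth_rw 1 [this]
      ring
    have h12 : (1 + η) * (x / c) ^ (j + 1) * (c ^ (j + 1 + 1) - (c * γ - β))
        = (1 + η) * (x / c) ^ (j + 1) * (c ^ (j + 1 + 1) - c * γ) + (1 + η) * (x / c) ^ (j + 1) * β := by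
      ring
    rw [h12, ← h11]
    linarith

lemma finNorm_cycR_le_of_eq_one {a : ZMod N → ℝ} {n : ℕ} (hn0 : 0 < n)
    (ha : finNorm (2 * n) a = 1) : finNorm (2 * n) (cycConv (cycR N) a)
      ≤ Real.cot (Real.pi / (4 * n)) * (1 + finNorm (2 * n) (cycConv (cycE N) a)) := by
  have hs1 := sin_pos_of_le (n := n) (j := 1) one_pos (by omega)
  rw [Nat.cast_one, one_mul] at hs1
  have hn : (0 : ℝ) < n := by exact_mod_cast hn0
  have hn1 : (1 : ℝ) ≤ n := by exact_mod_cast hn0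
  have hcp : 0 < Real.cot (Real.pi / (4 * n)) := by
    rw [Real.cot_eq_cos_div_sin]
    refine div_pos (Real.cos_pos_of_mem_Ioo ⟨?_, ?_⟩) hs1
    · linarith [Real.pi_pos, show 0 ≤ Real.pi / (4 * n) by positivity]
    · apply div_lt_div_of_pos_left Real.pi_pos (by norm_num); linarith
  have hη : 0 ≤ finNorm (2 * n) (cycConv (cycE N) a) := finNorm_nonneg _ _
  rcases le_total (finNorm (2 * n) (cycConv (cycR N) a)) (Real.cot (Real.pi / (4 * n))) with hc | hc
  · exact hc.trans (le_mul_of_one_le_right hcp.le (by linarith))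
  obtain ⟨j, rfl⟩ : ∃ j, n = j + 1 := ⟨n - 1, by omega⟩
  have h1 := cycR_error_bound ha hc j le_rfl
  have h2 := finNorm_hilbertSeq_le ha j le_rfl
  have h3 := finNorm_pow (cycConv (cycR N) a) (p := 2 * (j + 1 : ℕ)) (by positivity) (j := j + 1) (by omega)
  rw [mul_div_assoc, div_self hn.ne', mul_one] at h1 h2 h3
  have h4 := finNorm_add_le (fun m => cycConv (cycR N) a m ^ (j + 1)
    - cycConv (cycR N) (hilbertSeq a j) m) (cycConv (cycR N) (hilbertSeq a j)) one_le_two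
  simp only [sub_add_cancel] at h4
  rw [h3] at h4
  have h5 := finNorm_two_cycR_le (hilbertSeq a j)
  have e : ((j + 1 : ℕ) : ℝ) * (Real.pi / (4 * (j + 1 : ℕ))) = Real.pi / 4 := by field_simp
  rw [e, Real.sin_pi_div_four] at h2
  rw [e, Real.cos_pi_div_four] at h1
  set x := finNorm (2 * (j + 1 : ℕ)) (cycConv (cycR N) a)
  set c := Real.cot (Real.pi / (4 * (j + 1 : ℕ))) with hcdef
  set η := finNorm (2 * (j + 1 : ℕ)) (cycConv (cycE N) a)
  set δ := Real.sqrt 2 / 2 / Real.sin (Real.pi / (4 * (j + 1 : ℕ))) ^ (j + 1)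
  have hy : 1 ≤ x / c := (one_le_div hcp).2 hc
  have hδ : 0 ≤ δ := by positivity
  have h6 : δ ≤ (1 + η) * (x / c) ^ j * δ := le_mul_of_one_le_left hδ
    (one_le_mul_of_one_le_of_one_le (by linarith) (one_le_pow₀ hy))
  have h7 : x ^ (j + 1) ≤ (1 + η) * (x / c) ^ j * c ^ (j + 1) := by linarith
  have h8 : (1 + η) * (x / c) ^ j * c ^ (j + 1) = c * (1 + η) * x ^ j := by
    rw [div_pow]; field_simp; ring
  rw [h8, pow_succ, mul_comm (x ^ j)] at h7
  exact le_of_mul_le_mul_right h7 (pow_pos (hcp.trans_le hc) j)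

/-- The norm bound for the Riesz–Titchmarsh operator on `ZMod N`, up to the mean of the data. -/
lemma finNorm_cycR_le (a : ZMod N → ℝ) {n : ℕ} (hn0 : 0 < n) :
    finNorm (2 * n) (cycConv (cycR N) a)
      ≤ Real.cot (Real.pi / (4 * n)) * (finNorm (2 * n) a + finNorm (2 * n) (cycConv (cycE N) a)) := by
  have hn : (0 : ℝ) < n := by exact_mod_cast hn0
  rcases (finNorm_nonneg (2 * n) a).eq_or_lt with h0 | h0
  · have : a = fun _ => 0 := funext fun i => eq_zero_of_finNorm_eq_zero (by positivity) h0.symm i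
    subst this
    have : ∀ K : ZMod N → ℝ, finNorm (2 * n) (cycConv K fun _ => 0) = 0 := fun K => by
      simp [cycConv, finNorm, hn.ne']
    rw [this, this, ← h0, add_zero, mul_zero]
  · set A := finNorm (2 * n) a
    have hconv : ∀ K : ZMod N → ℝ, finNorm (2 * n) (cycConv K fun i => A⁻¹ * a i)
        = A⁻¹ * finNorm (2 * n) (cycConv K a) := fun K => by
      have : (cycConv K fun i => A⁻¹ * a i) = fun i => A⁻¹ * cycConv K a i := by
        funext i
        simp only [cycConv, Finset.mul_sum]
        exact Finset.sum_congr rfl fun j _ => by ring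
      rw [this, finNorm_const_mul _ _ (by positivity), abs_of_pos (by positivity)]
    have h := finNorm_cycR_le_of_eq_one (a := fun i => A⁻¹ * a i) hn0 (by
      rw [finNorm_const_mul _ _ (by positivity), abs_of_pos (by positivity)]
      exact inv_mul_cancel₀ h0.ne')
    rw [hconv, hconv] at h
    generalize Real.cot (Real.pi / (4 * n)) = c at *
    field_simp at h
    linarith

end CyclicBound

lemma tendsto_cot_div (y : ℝ) (hy : y ≠ 0) :
    Filter.Tendsto (fun M : ℕ => Real.cot (Real.pi * y / (M + 1 : ℕ)) / (M + 1 : ℕ)) Filter.atTop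
      (nhds (1 / (Real.pi * y))) := by
  have hz : Filter.Tendsto (fun M : ℕ => Real.pi * y / (M + 1 : ℕ)) Filter.atTop (nhds 0) :=
    (tendsto_const_div_atTop_nhds_zero_nat (Real.pi * y)).comp (Filter.tendsto_add_atTop_nat 1)
  have h1 : Filter.Tendsto (fun M : ℕ => Real.cos (Real.pi * y / (M + 1 : ℕ))) Filter.atTop (nhds 1) := by
    simpa [Function.comp_def] using (Real.continuous_cos.tendsto 0).comp hz
  have h2 : Filter.Tendsto (fun M : ℕ => Real.sinc (Real.pi * y / (M + 1 : ℕ))) Filter.atTop (nhds 1) := by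
    simpa [Function.comp_def] using (Real.continuous_sinc.tendsto 0).comp hz
  have hpy : Real.pi * y ≠ 0 := mul_ne_zero Real.pi_ne_zero hy
  have h3 := h1.div (h2.const_mul (Real.pi * y)) (by simpa using hpy)
  rw [mul_one] at h3
  refine h3.congr fun M => ?_
  have hM : ((M + 1 : ℕ) : ℝ) ≠ 0 := by positivity
  simp only [Pi.div_apply]
  rw [Real.sinc_of_ne_zero (div_ne_zero hpy hM), Real.cot_eq_cos_div_sin]
  generalize Real.pi * y = z at *
  field_simp

/-- Push a finitely supported family on `ℤ` forward to `ZMod N`. -/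
def pushZMod (N : ℕ) (S : Finset ℤ) (a : ℤ → ℝ) (x : ZMod N) : ℝ :=
  ∑ m ∈ S, if (m : ZMod N) = x then a m else 0

lemma cycConv_pushZMod {N : ℕ} [NeZero N] (K : ZMod N → ℝ) (S : Finset ℤ) (a : ℤ → ℝ) (x : ZMod N) :
    cycConv K (pushZMod N S a) x = ∑ m ∈ S, K (x - m) * a m := by
  simp only [cycConv, pushZMod, Finset.mul_sum]
  rw [Finset.sum_comm]
  refine Finset.sum_congr rfl fun m _ => ?_
  simp

lemma injOn_intCast_zmod {N L : ℕ} (hN : 2 * L < N) (S : Finset ℤ) (hS : ∀ m ∈ S, |m| ≤ L) :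
    Set.InjOn (fun m : ℤ => (m : ZMod N)) S := by
  intro x hx y hy h
  have h1 := (ZMod.intCast_eq_intCast_iff_dvd_sub x y N).1 h
  have h2 := abs_le.1 (hS x hx)
  have h3 := abs_le.1 (hS y hy)
  have := Int.eq_zero_of_abs_lt_dvd h1 (by rw [abs_lt]; constructor <;> omega)
  omega

lemma sum_abs_pushZMod_rpow {N L : ℕ} [NeZero N] (hN : 2 * L < N) (S : Finset ℤ)
    (hS : ∀ m ∈ S, |m| ≤ L) (a : ℤ → ℝ) {p : ℝ} (hp : p ≠ 0) :
    ∑ x, |pushZMod N S a x| ^ p = ∑ m ∈ S, |a m| ^ p := by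
  classical
  have hinj := injOn_intCast_zmod hN S hS
  rw [← Finset.sum_subset (Finset.subset_univ (S.image fun m : ℤ => (m : ZMod N))),
    Finset.sum_image hinj]
  · refine Finset.sum_congr rfl fun m hm => ?_
    rw [pushZMod, Finset.sum_eq_single_of_mem m hm, if_pos rfl]
    intro k hk hkm
    exact if_neg fun h => hkm (hinj hk hm h)
  · intro x _ hx
    rw [pushZMod, Finset.sum_eq_zero, abs_zero, Real.zero_rpow hp]
    intro m hm
    exact if_neg fun h => hx (Finset.mem_image.2 ⟨m, hm, h⟩)

lemma sum_abs_rieszTitchmarsh_le (S W : Finset ℤ) (a : ℤ → ℝ) {n : ℕ} (hn : 0 < n) :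
    ∑ k ∈ W, |∑ m ∈ S, 1 / (Real.pi * ((k - m : ℤ) + 1 / 2)) * a m| ^ (2 * n : ℝ)
      ≤ Real.cot (Real.pi / (4 * n)) ^ (2 * n : ℝ) * ∑ m ∈ S, |a m| ^ (2 * n : ℝ) := by
  classical
  have hn' : (1 : ℝ) ≤ n := by exact_mod_cast hn
  set p : ℝ := 2 * n with hp
  have hp0 : 0 < p := by positivity
  obtain ⟨L, hL⟩ : ∃ L : ℕ, ∀ m ∈ S ∪ W, |m| ≤ L := by
    refine ⟨(S ∪ W).sup Int.natAbs, fun m hm => ?_⟩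
    rw [Int.abs_eq_natAbs]
    exact_mod_cast Finset.le_sup (f := Int.natAbs) hm
  have hc := cot_pi_div_nonneg hn
  have hX0 : ∀ f : ℤ → ℝ, ∀ T : Finset ℤ, 0 ≤ ∑ k ∈ T, |f k| ^ p := fun f T =>
    Finset.sum_nonneg fun _ _ => Real.rpow_nonneg (abs_nonneg _) _
  have key : ∀ M : ℕ, 2 * L ≤ M →
      (∑ k ∈ W, |∑ m ∈ S, Real.cot (Real.pi * ((k - m : ℤ) + 1 / 2) / (M + 1 : ℕ)) / (M + 1 : ℕ) * a m| ^ p)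
        ^ (1 / p)
      ≤ Real.cot (Real.pi / (4 * n)) * ((∑ m ∈ S, |a m| ^ p) ^ (1 / p)
        + ((M + 1 : ℕ) : ℝ) ^ (-(1 - 1 / p)) * |∑ m ∈ S, a m|) := by
    intro M hM
    have hM1 : 2 * L < M + 1 := by omega
    have hMpos : (0 : ℝ) < (M + 1 : ℕ) := by positivity
    have h := finNorm_cycR_le (pushZMod (M + 1) S a) hn
    have hE : finNorm p (cycConv (cycE (M + 1)) (pushZMod (M + 1) S a))
        = ((M + 1 : ℕ) : ℝ) ^ (-(1 - 1 / p)) * |∑ m ∈ S, a m| := by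
      simp only [finNorm, cycConv_pushZMod, cycE, ← Finset.mul_sum]
      rw [Finset.sum_const, Finset.card_univ, ZMod.card, nsmul_eq_mul,
        Real.mul_rpow hMpos.le (Real.rpow_nonneg (abs_nonneg _) _), ← Real.rpow_mul (abs_nonneg _),
        mul_one_div_cancel hp0.ne', Real.rpow_one, abs_mul, abs_of_pos (by positivity), neg_sub,
        Real.rpow_sub_one hMpos.ne']
      ring
    rw [← hp, hE, finNorm, finNorm, sum_abs_pushZMod_rpow hM1 S
      (fun m hm => hL m (Finset.mem_union_left _ hm)) a hp0.ne'] at h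
    refine le_trans (Real.rpow_le_rpow (hX0 _ _) ?_ (by positivity)) h
    have himg := Finset.sum_image (f := fun x => |cycConv (cycR (M + 1)) (pushZMod (M + 1) S a) x| ^ p)
      (injOn_intCast_zmod hM1 W fun m hm => hL m (Finset.mem_union_right _ hm))
    refine le_trans (le_of_eq (Eq.trans ?_ himg.symm)) (Finset.sum_le_sum_of_subset_of_nonneg
      (Finset.subset_univ _) fun _ _ _ => Real.rpow_nonneg (abs_nonneg _) _)
    · refine Finset.sum_congr rfl fun k _ => ?_
      rw [cycConv_pushZMod]
      congr 2
      refine Finset.sum_congr rfl fun m _ => ?_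
      rw [← Int.cast_sub, cycR_intCast]
  have hlim1 : Filter.Tendsto (fun M : ℕ => (∑ k ∈ W, |∑ m ∈ S,
      Real.cot (Real.pi * ((k - m : ℤ) + 1 / 2) / (M + 1 : ℕ)) / (M + 1 : ℕ) * a m| ^ p) ^ (1 / p))
      Filter.atTop (nhds ((∑ k ∈ W, |∑ m ∈ S, 1 / (Real.pi * ((k - m : ℤ) + 1 / 2)) * a m| ^ p) ^ (1 / p))) := by
    refine Filter.Tendsto.rpow_const (tendsto_finsetSum _ fun k _ => ?_) (Or.inr (by positivity))
    refine Filter.Tendsto.rpow_const (Filter.Tendsto.abs (tendsto_finsetSum _ fun m _ => ?_))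
      (Or.inr hp0.le)
    refine Filter.Tendsto.mul_const _ (tendsto_cot_div _ ?_)
    intro h0
    have : 2 * (k - m) + 1 = 0 := by
      have : 2 * ((k - m : ℤ) : ℝ) + 1 = 0 := by linarith
      exact_mod_cast this
    omega
  have hlim2 : Filter.Tendsto (fun M : ℕ => Real.cot (Real.pi / (4 * n)) * ((∑ m ∈ S, |a m| ^ p) ^ (1 / p)
        + ((M + 1 : ℕ) : ℝ) ^ (-(1 - 1 / p)) * |∑ m ∈ S, a m|)) Filter.atTop
      (nhds (Real.cot (Real.pi / (4 * n)) * ((∑ m ∈ S, |a m| ^ p) ^ (1 / p) + 0 * |∑ m ∈ S, a m|))) := by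
    have h1p : 0 < 1 - 1 / p := by
      rw [sub_pos, div_lt_one hp0]; linarith
    exact (((tendsto_rpow_neg_atTop h1p).comp (tendsto_natCast_atTop_atTop.comp
      (Filter.tendsto_add_atTop_nat 1))).mul_const _).const_add _ |>.const_mul _
  have hfin := le_of_tendsto_of_tendsto hlim1 hlim2 (Filter.eventually_atTop.2 ⟨2 * L, key⟩)
  rw [zero_mul, add_zero] at hfin
  have := Real.rpow_le_rpow (Real.rpow_nonneg (hX0 _ _) _) hfin hp0.le
  rwa [Real.mul_rpow hc (Real.rpow_nonneg (hX0 _ _) _), ← Real.rpow_mul (hX0 _ _),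
    ← Real.rpow_mul (hX0 _ _), one_div_mul_cancel hp0.ne', Real.rpow_one, Real.rpow_one] at this

lemma integral_abs_im_exp_mul_rpow (z : ℂ) (n : ℕ) :
    ∫ φ in (0 : ℝ)..Real.pi, |Real.sin φ * z.re + Real.cos φ * z.im| ^ (2 * n : ℝ)
      = (∫ φ in (0 : ℝ)..Real.pi, Real.sin φ ^ (2 * n)) * ‖z‖ ^ (2 * n : ℝ) := by
  have h : ∀ φ : ℝ, |Real.sin φ * z.re + Real.cos φ * z.im| ^ (2 * n : ℝ)
      = Real.sin (φ + z.arg) ^ (2 * n) * ‖z‖ ^ (2 * n : ℝ) := fun φ => by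
    have e : Real.sin φ * z.re + Real.cos φ * z.im = ‖z‖ * Real.sin (φ + z.arg) := by
      rw [Real.sin_add]
      linear_combination (-Real.sin φ) * Complex.norm_mul_cos_arg z
        - Real.cos φ * Complex.norm_mul_sin_arg z
    rw [e, abs_mul, abs_norm, Real.mul_rpow (norm_nonneg _) (abs_nonneg _), mul_comm]
    congr 1
    rw [show (2 * n : ℝ) = ((2 * n : ℕ) : ℝ) by push_cast; ring, Real.rpow_natCast,
      Even.pow_abs (even_two_mul n)]
  simp_rw [h]
  rw [intervalIntegral.integral_mul_const, intervalIntegral.integral_comp_add_right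
    (fun x => Real.sin x ^ (2 * n))]
  have hper : Function.Periodic (fun x => Real.sin x ^ (2 * n)) Real.pi := fun x => by
    simp only [Real.sin_add_pi, Even.neg_pow (even_two_mul n)]
  have := hper.intervalIntegral_add_eq z.arg 0
  rw [zero_add] at this
  rw [zero_add, add_comm Real.pi, this]

lemma sum_norm_rieszTitchmarsh_le (S W : Finset ℤ) (a : ℤ → ℂ) {n : ℕ} (hn : 0 < n) :
    ∑ k ∈ W, ‖∑ m ∈ S, ((1 / (Real.pi * ((k - m : ℤ) + 1 / 2)) : ℝ) : ℂ) * a m‖ ^ (2 * n : ℝ)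
      ≤ Real.cot (Real.pi / (4 * n)) ^ (2 * n : ℝ) * ∑ m ∈ S, ‖a m‖ ^ (2 * n : ℝ) := by
  have hκ := integral_sin_pow_pos (2 * n)
  have hcont : ∀ z : ℂ, Continuous fun φ : ℝ =>
      |Real.sin φ * z.re + Real.cos φ * z.im| ^ (2 * n : ℝ) := fun z =>
    Continuous.rpow_const (by fun_prop) fun _ => Or.inr (by positivity)
  refine le_of_mul_le_mul_left ?_ hκ
  rw [mul_left_comm, Finset.mul_sum, Finset.mul_sum]
  simp_rw [← integral_abs_im_exp_mul_rpow]
  rw [← intervalIntegral.integral_finsetSum fun k _ => (hcont _).intervalIntegrable _ _,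
    ← intervalIntegral.integral_finsetSum fun k _ => (hcont _).intervalIntegrable _ _,
    ← intervalIntegral.integral_const_mul]
  refine intervalIntegral.integral_mono_on Real.pi_pos.le
    ((continuous_finsetSum _ fun k _ => hcont _).intervalIntegrable _ _)
    (((continuous_finsetSum _ fun k _ => hcont _).const_mul _).intervalIntegrable _ _) fun φ _ => ?_
  refine le_trans (le_of_eq (Finset.sum_congr rfl fun k _ => ?_)) (sum_abs_rieszTitchmarsh_le S W
    (fun m => Real.sin φ * (a m).re + Real.cos φ * (a m).im) hn)
  congr 2
  simp only [Complex.re_sum, Complex.im_sum, Complex.re_ofReal_mul, Complex.im_ofReal_mul,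
    Finset.mul_sum, ← Finset.sum_add_distrib]
  exact Finset.sum_congr rfl fun m _ => by ring

lemma summable_div_add_half {a : ℤ → ℂ} {p : ℝ} (hp : 1 < p) (ha : Summable fun k => ‖a k‖ ^ p)
    (k : ℤ) : Summable fun m : ℤ => ((1 / (Real.pi * ((k - m : ℤ) + 1 / 2)) : ℝ) : ℂ) * a m := by
  obtain ⟨q, hpq⟩ : ∃ q, p.HolderConjugate q := ⟨_, Real.HolderConjugate.conjExponent hp⟩
  refine Summable.of_norm ?_
  simp only [norm_mul, Complex.norm_real]
  refine Real.summable_mul_of_Lp_Lq_of_nonneg hpq.symm (fun _ => norm_nonneg _)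
    (fun _ => norm_nonneg _) ?_ ha
  have h := ((Real.summable_one_div_int_add_rpow (1 / 2) q).2 hpq.symm.lt).mul_left ((1 / Real.pi) ^ q)
  refine ((Equiv.subLeft k).summable_iff.2 h).congr fun m => ?_
  simp only [Function.comp_apply, Equiv.subLeft_apply]
  rw [Real.norm_eq_abs, abs_div, abs_mul, abs_of_pos Real.pi_pos, abs_one, ← one_div_mul_one_div,
    Real.mul_rpow (by positivity) (by positivity),
    Real.div_rpow zero_le_one (abs_nonneg (((k - m : ℤ) : ℝ) + 1 / 2)), Real.one_rpow]

lemma rieszTitchmarsh_bound {a : ℤ → ℂ} {n : ℕ} (hn : 0 < n)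
    (ha : Summable fun k => ‖a k‖ ^ (2 * n : ℝ)) :
    (Summable fun k : ℤ => ‖∑' m : ℤ, ((1 / (Real.pi * ((k - m : ℤ) + 1 / 2)) : ℝ) : ℂ) * a m‖ ^ (2 * n : ℝ)) ∧
    ∑' k : ℤ, ‖∑' m : ℤ, ((1 / (Real.pi * ((k - m : ℤ) + 1 / 2)) : ℝ) : ℂ) * a m‖ ^ (2 * n : ℝ)
      ≤ Real.cot (Real.pi / (4 * n)) ^ (2 * n : ℝ) * ∑' m : ℤ, ‖a m‖ ^ (2 * n : ℝ) := by
  have hn' : (1 : ℝ) ≤ n := by exact_mod_cast hn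
  have hc := cot_pi_div_nonneg hn
  have hfin : ∀ W : Finset ℤ, ∑ k ∈ W,
      ‖∑' m : ℤ, ((1 / (Real.pi * ((k - m : ℤ) + 1 / 2)) : ℝ) : ℂ) * a m‖ ^ (2 * n : ℝ)
      ≤ Real.cot (Real.pi / (4 * n)) ^ (2 * n : ℝ) * ∑' m : ℤ, ‖a m‖ ^ (2 * n : ℝ) := fun W => by
    have hlim : Filter.Tendsto (fun S : Finset ℤ => ∑ k ∈ W,
        ‖∑ m ∈ S, ((1 / (Real.pi * ((k - m : ℤ) + 1 / 2)) : ℝ) : ℂ) * a m‖ ^ (2 * n : ℝ)) Filter.atTop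
        (nhds (∑ k ∈ W,
          ‖∑' m : ℤ, ((1 / (Real.pi * ((k - m : ℤ) + 1 / 2)) : ℝ) : ℂ) * a m‖ ^ (2 * n : ℝ))) := by
      refine tendsto_finsetSum _ fun k _ => Filter.Tendsto.rpow_const (Filter.Tendsto.norm ?_)
        (Or.inr (by positivity))
      exact (summable_div_add_half (by linarith) ha k).hasSum
    refine le_of_tendsto hlim (Filter.Eventually.of_forall fun S =>
      (sum_norm_rieszTitchmarsh_le S W a hn).trans (mul_le_mul_of_nonneg_left ?_ (Real.rpow_nonneg hc _)))
    exact ha.sum_le_tsum S fun _ _ => Real.rpow_nonneg (norm_nonneg _) _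
  have hs := summable_of_sum_le (fun _ => Real.rpow_nonneg (norm_nonneg _) _) hfin
  exact ⟨hs, hs.tsum_le_of_sum_le hfin⟩

/-- Parametrization of the odd integers by `m ↦ 2 * (k - m) + 1`. -/
def oddEquiv (k : ℤ) : ℤ ≃ {m : ℤ // Odd m} where
  toFun m := ⟨2 * (k - m) + 1, k - m, rfl⟩
  invFun x := k - (x.1 - 1) / 2
  left_inv m := by simp
  right_inv x := by
    obtain ⟨_, l, rfl⟩ := x
    simp

lemma KT_eq_tsum (a b : ℤ → ℂ) (n k : ℤ) (h : ∀ m, a (n - (2 * (k - m) + 1)) = b m) :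
    KT a n = ∑' m : ℤ, ((1 / (Real.pi * ((k - m : ℤ) + 1 / 2)) : ℝ) : ℂ) * b m := by
  rw [KT, ← (oddEquiv k).tsum_eq, ← tsum_mul_left]
  refine tsum_congr fun m => ?_
  have h1 : ((oddEquiv k m : {m : ℤ // Odd m}) : ℤ) = 2 * (k - m) + 1 := rfl
  have h2 : (2 * ((k - m : ℤ) : ℂ) + 1) ≠ 0 := by
    have : (2 * (k - m) + 1 : ℤ) ≠ 0 := by omega
    exact_mod_cast this
  have h3 : (((k - m : ℤ) : ℂ) + 1 / 2) ≠ 0 := fun h => h2 (by linear_combination 2 * h)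
  have hpi : (Real.pi : ℂ) ≠ 0 := by exact_mod_cast Real.pi_ne_zero
  rw [h1, h, show ((2 * (k - m) + 1 : ℤ) : ℂ) = 2 * ((k - m : ℤ) : ℂ) + 1 by push_cast; ring]
  rw [show ((1 / (Real.pi * ((k - m : ℤ) + 1 / 2)) : ℝ) : ℂ)
    = 1 / (Real.pi * (((k - m : ℤ) : ℂ) + 1 / 2)) by push_cast; ring]
  generalize ((k - m : ℤ) : ℂ) = z at *
  field_simp

lemma KT_odd (a : ℤ → ℂ) (k : ℤ) : KT a (2 * k + 1)
    = ∑' m : ℤ, ((1 / (Real.pi * ((k - m : ℤ) + 1 / 2)) : ℝ) : ℂ) * a (2 * m) :=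
  KT_eq_tsum a (fun m => a (2 * m)) _ k fun m => by congr 1; ring

lemma KT_even (a : ℤ → ℂ) (k : ℤ) : KT a (2 * (k + 1))
    = ∑' m : ℤ, ((1 / (Real.pi * ((k - m : ℤ) + 1 / 2)) : ℝ) : ℂ) * a (2 * m + 1) :=
  KT_eq_tsum a (fun m => a (2 * m + 1)) _ k fun m => by congr 1; ring

lemma hasSum_int_even_add_odd {f : ℤ → ℝ} {x y : ℝ} (he : HasSum (fun k => f (2 * k)) x)
    (ho : HasSum (fun k => f (2 * k + 1)) y) : HasSum f (x + y) := by
  have := mul_right_injective₀ (two_ne_zero' ℤ)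
  replace ho := ((add_left_injective 1).comp this).hasSum_range_iff.2 ho
  refine (this.hasSum_range_iff.2 he).add_isCompl ?_ ho
  have e0 : Set.range (fun x : ℤ => 2 * x) = {n | Even n} := by
    ext n; simp [even_iff_exists_two_mul]
  have e1 : Set.range ((fun x : ℤ => x + 1) ∘ fun x => 2 * x) = {n | Odd n} := by
    ext n; simp [Odd, eq_comm]
  rw [e0, e1]
  exact Int.isCompl_even_odd

lemma KT_bound {a : ℤ → ℂ} {n : ℕ} (hn : 0 < n) (ha : MemLpZ (2 * n) a) :
    MemLpZ (2 * n) (KT a) ∧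
      _root_.lpNorm (2 * n) (KT a) ≤ Real.cot (Real.pi / (4 * n)) * _root_.lpNorm (2 * n) a := by
  have hc := cot_pi_div_nonneg hn
  have hs0 : Summable fun k => ‖a (2 * k)‖ ^ (2 * n : ℝ) :=
    ha.comp_injective (i := fun k : ℤ => 2 * k) (mul_right_injective₀ (two_ne_zero' ℤ))
  have hs1 : Summable fun k => ‖a (2 * k + 1)‖ ^ (2 * n : ℝ) :=
    ha.comp_injective (i := fun k : ℤ => 2 * k + 1)
      ((add_left_injective 1).comp (mul_right_injective₀ (two_ne_zero' ℤ)))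
  obtain ⟨h1, h2⟩ := rieszTitchmarsh_bound hn hs0
  obtain ⟨h3, h4⟩ := rieszTitchmarsh_bound hn hs1
  simp only [← KT_odd] at h1 h2
  simp only [← KT_even] at h3 h4
  have h5 : HasSum (fun k : ℤ => ‖KT a (2 * k)‖ ^ (2 * n : ℝ))
      (∑' k : ℤ, ‖KT a (2 * (k + 1))‖ ^ (2 * n : ℝ)) :=
    (Equiv.hasSum_iff (Equiv.addRight (1 : ℤ))).1 h3.hasSum
  have h6 := hasSum_int_even_add_odd (f := fun k => ‖KT a k‖ ^ (2 * n : ℝ)) h5 h1.hasSum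
  have h7 := hasSum_int_even_add_odd (f := fun k => ‖a k‖ ^ (2 * n : ℝ)) hs0.hasSum hs1.hasSum
  refine ⟨h6.summable, ?_⟩
  have h8 : ∑' k : ℤ, ‖KT a k‖ ^ (2 * n : ℝ)
      ≤ Real.cot (Real.pi / (4 * n)) ^ (2 * n : ℝ) * ∑' k : ℤ, ‖a k‖ ^ (2 * n : ℝ) := by
    rw [h6.tsum_eq, h7.tsum_eq, mul_add]
    linarith
  have h9 : 0 ≤ ∑' k : ℤ, ‖a k‖ ^ (2 * n : ℝ) :=
    tsum_nonneg fun _ => Real.rpow_nonneg (norm_nonneg _) _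
  have h10 := Real.rpow_le_rpow (tsum_nonneg fun _ => Real.rpow_nonneg (norm_nonneg _) _) h8
    (by positivity : (0 : ℝ) ≤ 1 / (2 * n))
  rwa [Real.mul_rpow (Real.rpow_nonneg hc _) h9, ← Real.rpow_mul hc,
    mul_one_div_cancel (by positivity), Real.rpow_one] at h10

/-- A truncated expansion of `(n ^ μ - t ^ μ) / (n ^ 2 - t ^ 2)` for `t ≤ n`. -/
def lowKernel (n μ : ℝ) (K : ℕ) (t : ℝ) : ℝ :=
  (n ^ μ - t ^ μ) * ∑ k ∈ Finset.range K, (t ^ 2) ^ k / (n ^ 2) ^ (k + 1)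

/-- A truncated expansion of `(t ^ μ - n ^ μ) / (t ^ 2 - n ^ 2)` for `n ≤ t`. -/
def highKernel (n μ : ℝ) (K : ℕ) (t : ℝ) : ℝ :=
  (t ^ μ - n ^ μ) * ∑ k ∈ Finset.range K, (n ^ 2) ^ k / (t ^ 2) ^ (k + 1)

lemma sum_geom_div_le {u w : ℝ} (hu : 0 ≤ u) (huw : u < w) (K : ℕ) :
    ∑ k ∈ Finset.range K, u ^ k / w ^ (k + 1) ≤ 1 / (w - u) := by
  have hw : 0 < w := hu.trans_lt huw
  have h : ∑ k ∈ Finset.range K, u ^ k / w ^ (k + 1) = (1 - (u / w) ^ K) / (w - u) := by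
    have hne : w - u ≠ 0 := by linarith
    induction K with
    | zero => simp
    | succ K ih =>
      rw [Finset.sum_range_succ, ih, pow_succ (u / w) K, div_pow]
      field_simp
      ring
  rw [h]
  have : 0 ≤ (u / w) ^ K := by positivity
  exact div_le_div_of_nonneg_right (by linarith) (by linarith)

lemma rpow_secant_antitone {μ : ℝ} (h0 : 0 ≤ μ) (h2 : μ ≤ 2) {n m t : ℝ} (hn : 0 < n) (hm : 0 < m)
    (hmt : m ≤ t) (hmn : m ≠ n) (htn : t ≠ n) :
    (t ^ μ - n ^ μ) / (t ^ 2 - n ^ 2) ≤ (m ^ μ - n ^ μ) / (m ^ 2 - n ^ 2) := by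
  have ht : 0 < t := hm.trans_le hmt
  have hsq : ∀ x : ℝ, 0 < x → x ^ μ = (x ^ 2) ^ (μ / 2) := fun x hx => by
    rw [← Real.rpow_natCast, ← Real.rpow_mul hx.le]
    congr 1
    push_cast; ring
  have hne : ∀ x : ℝ, 0 < x → x ≠ n → x ^ 2 ≠ n ^ 2 := fun x hx h h' =>
    h ((pow_left_inj₀ hx.le hn.le two_ne_zero).1 h')
  have h := (Real.concaveOn_rpow (p := μ / 2) (by linarith) (by linarith)).neg.secant_mono
    (a := n ^ 2) (x := m ^ 2) (y := t ^ 2) (Set.mem_Ici.2 (by positivity)) (Set.mem_Ici.2 (by positivity))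
    (Set.mem_Ici.2 (by positivity)) (hne m hm hmn) (hne t ht htn) (by gcongr)
  simp only [Pi.neg_apply] at h
  rw [← hsq n hn, ← hsq m hm, ← hsq t ht] at h
  have e : ∀ x y : ℝ, (-x - -(n ^ μ)) / y = -((x - n ^ μ) / y) := fun x y => by ring
  rw [e, e] at h
  linarith

lemma rpow_secant_nonneg {μ : ℝ} (h0 : 0 ≤ μ) {n m : ℝ} (hn : 0 < n) (hm : 0 < m) :
    0 ≤ (m ^ μ - n ^ μ) / (m ^ 2 - n ^ 2) := by
  rcases le_total m n with h | h
  · exact div_nonneg_of_nonpos (sub_nonpos.2 (Real.rpow_le_rpow hm.le h h0))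
      (sub_nonpos.2 (by gcongr))
  · exact div_nonneg (sub_nonneg.2 (Real.rpow_le_rpow hn.le h h0)) (sub_nonneg.2 (by gcongr))

lemma lowKernel_le {μ : ℝ} (h0 : 0 ≤ μ) (h2 : μ ≤ 2) {n m t : ℝ} (hn : 0 < n) (hm : 0 < m)
    (hmt : m ≤ t) (hmn : m ≠ n) (htn : t ≤ n) (K : ℕ) :
    lowKernel n μ K t ≤ (m ^ μ - n ^ μ) / (m ^ 2 - n ^ 2) := by
  rcases htn.eq_or_lt with rfl | htn
  · rw [lowKernel, sub_self, zero_mul]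
    exact rpow_secant_nonneg h0 hn hm
  · have ht : 0 < t := hm.trans_le hmt
    refine le_trans ?_ (rpow_secant_antitone h0 h2 hn hm hmt hmn htn.ne)
    rw [← neg_sub (n ^ μ), ← neg_sub (n ^ 2), neg_div_neg_eq, lowKernel, div_eq_mul_one_div (n ^ μ - t ^ μ)]
    exact mul_le_mul_of_nonneg_left (sum_geom_div_le (by positivity) (by gcongr) K)
      (sub_nonneg.2 (Real.rpow_le_rpow ht.le htn.le h0))

lemma highKernel_le {μ : ℝ} (h0 : 0 ≤ μ) (h2 : μ ≤ 2) {n m t : ℝ} (hn : 0 < n) (hm : 0 < m)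
    (hmt : m ≤ t) (hmn : m ≠ n) (htn : n ≤ t) (K : ℕ) :
    highKernel n μ K t ≤ (m ^ μ - n ^ μ) / (m ^ 2 - n ^ 2) := by
  rcases htn.eq_or_lt with rfl | htn
  · rw [highKernel, sub_self, zero_mul]
    exact rpow_secant_nonneg h0 hn hm
  · refine le_trans ?_ (rpow_secant_antitone h0 h2 hn hm hmt hmn htn.ne')
    rw [highKernel, div_eq_mul_one_div (t ^ μ - n ^ μ)]
    exact mul_le_mul_of_nonneg_left (sum_geom_div_le (by positivity) (by gcongr) K)
      (sub_nonneg.2 (Real.rpow_le_rpow hn.le htn.le h0))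

/-- The two truncated expansions glued at `t = n`. -/
def gluedKernel (n μ : ℝ) (K : ℕ) (t : ℝ) : ℝ :=
  lowKernel n μ K (min t n) + highKernel n μ K (max t n)

lemma gluedKernel_of_le {n μ t : ℝ} (h : t ≤ n) (K : ℕ) : gluedKernel n μ K t = lowKernel n μ K t := by
  simp [gluedKernel, h, highKernel]

lemma gluedKernel_of_ge {n μ t : ℝ} (h : n ≤ t) (K : ℕ) : gluedKernel n μ K t = highKernel n μ K t := by
  simp [gluedKernel, h, lowKernel]

lemma continuous_gluedKernel {n μ : ℝ} (hn : 0 < n) (hμ : 0 ≤ μ) (K : ℕ) :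
    Continuous (gluedKernel n μ K) := by
  have h1 : Continuous fun t : ℝ => (min t n) ^ μ :=
    Continuous.rpow_const (by fun_prop) fun _ => Or.inr hμ
  have h2 : Continuous fun t : ℝ => (max t n) ^ μ :=
    Continuous.rpow_const (by fun_prop) fun _ => Or.inr hμ
  have h3 : ∀ t k, ((max t n) ^ 2) ^ (k + 1) ≠ 0 := fun t k => by
    have : 0 < max t n := lt_max_of_lt_right hn
    positivity
  have h4 : ∀ k : ℕ, Continuous fun t : ℝ => (n ^ 2) ^ k / ((max t n) ^ 2) ^ (k + 1) := fun k =>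
    continuous_const.div (by fun_prop) fun t => h3 t k
  unfold gluedKernel lowKernel highKernel
  have h5 : Continuous fun t : ℝ => ∑ k ∈ Finset.range K, (n ^ 2) ^ k / ((max t n) ^ 2) ^ (k + 1) :=
    continuous_finsetSum _ fun k _ => h4 k
  have h6 : Continuous fun t : ℝ => ∑ k ∈ Finset.range K, ((min t n) ^ 2) ^ k / (n ^ 2) ^ (k + 1) := by
    fun_prop
  exact ((continuous_const.sub h1).mul h6).add ((h2.sub continuous_const).mul h5)

lemma integral_gluedKernel_le_sum {n μ : ℝ} (hn : 0 < n) (hμ : 0 ≤ μ) (hμ2 : μ ≤ 2) (K I : ℕ)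
    (hne : ∀ i : ℕ, (2 * i + 1 : ℝ) ≠ n) :
    ∫ t in (1 : ℝ)..(2 * I + 1 : ℝ), gluedKernel n μ K t
      ≤ ∑ i ∈ Finset.range I, 2 * (((2 * i + 1 : ℝ) ^ μ - n ^ μ) / ((2 * i + 1 : ℝ) ^ 2 - n ^ 2)) := by
  have hc := continuous_gluedKernel hn hμ K
  have hint : ∀ a b : ℝ, IntervalIntegrable (gluedKernel n μ K) volume a b := fun a b =>
    hc.intervalIntegrable a b
  have h := intervalIntegral.sum_integral_adjacent_intervals
    (a := fun i : ℕ => (2 * i + 1 : ℝ)) (n := I) fun k _ => hint _ _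
  simp only [Nat.cast_zero, mul_zero, zero_add] at h
  rw [← h]
  refine Finset.sum_le_sum fun i _ => ?_
  have hm : (0 : ℝ) < 2 * i + 1 := by positivity
  have h2 : ∫ _ in (2 * i + 1 : ℝ)..(2 * (i + 1 : ℕ) + 1 : ℝ),
      ((2 * i + 1 : ℝ) ^ μ - n ^ μ) / ((2 * i + 1 : ℝ) ^ 2 - n ^ 2)
      = 2 * (((2 * i + 1 : ℝ) ^ μ - n ^ μ) / ((2 * i + 1 : ℝ) ^ 2 - n ^ 2)) := by
    rw [intervalIntegral.integral_const, smul_eq_mul]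
    congr 1
    push_cast; ring
  rw [← h2]
  refine intervalIntegral.integral_mono_on (by push_cast; linarith) (hint _ _) ?_ fun t ht => ?_
  · exact intervalIntegrable_const
  rcases le_total t n with h | h
  · rw [gluedKernel_of_le h]
    exact lowKernel_le hμ hμ2 hn hm ht.1 (hne i) h K
  · rw [gluedKernel_of_ge h]
    exact highKernel_le hμ hμ2 hn hm ht.1 (hne i) h K

lemma le_integral_lowKernel {n μ : ℝ} (hn : 1 ≤ n) (hμ : 0 ≤ μ) (K : ℕ) :
    n ^ (μ - 1) * ∑ k ∈ Finset.range K, (1 / (2 * k + 1 : ℝ) - 1 / (2 * k + 1 + μ)) - K * n ^ (μ - 2)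
      ≤ ∫ t in (1 : ℝ)..n, lowKernel n μ K t := by
  have hn0 : 0 < n := by linarith
  have h0 : (0 : ℝ) ∉ Set.uIcc 1 n := by
    rw [Set.uIcc_of_le hn]; intro h; linarith [h.1]
  have e : ∫ t in (1 : ℝ)..n, lowKernel n μ K t = ∫ t in (1 : ℝ)..n, ∑ k ∈ Finset.range K,
      (n ^ μ / (n ^ 2) ^ (k + 1) * t ^ (2 * k : ℝ) - 1 / (n ^ 2) ^ (k + 1) * t ^ (μ + 2 * k : ℝ)) := by
    refine intervalIntegral.integral_congr fun t ht => ?_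
    rw [Set.uIcc_of_le hn] at ht
    have ht0 : 0 < t := by linarith [ht.1]
    simp only [lowKernel, Finset.mul_sum]
    refine Finset.sum_congr rfl fun k _ => ?_
    have : t ^ (2 * k : ℝ) = (t ^ 2) ^ k := by
      rw [Real.rpow_mul ht0.le, Real.rpow_two, Real.rpow_natCast]
    rw [Real.rpow_add ht0, this]
    ring
  have hi : ∀ r : ℝ, 0 ≤ r → IntervalIntegrable (fun t : ℝ => t ^ r) volume 1 n := fun r hr =>
    intervalIntegral.intervalIntegrable_rpow' (by linarith)
  rw [e, intervalIntegral.integral_finsetSum fun k _ =>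
    ((hi _ (by positivity)).const_mul _).sub ((hi _ (by positivity)).const_mul _), Finset.mul_sum,
    show (K : ℝ) * n ^ (μ - 2) = ∑ k ∈ Finset.range K, n ^ (μ - 2) by simp, ← Finset.sum_sub_distrib]
  refine Finset.sum_le_sum fun k _ => ?_
  rw [intervalIntegral.integral_sub ((hi _ (by positivity)).const_mul _)
    ((hi _ (by positivity)).const_mul _), intervalIntegral.integral_const_mul,
    intervalIntegral.integral_const_mul, integral_rpow (Or.inl (by linarith [show (0:ℝ) ≤ 2 * k by positivity])),
    integral_rpow (Or.inl (by linarith [show (0:ℝ) ≤ 2 * k by positivity])), Real.one_rpow, Real.one_rpow]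
  have hP : n ^ (2 * k + 1 : ℝ) = (n ^ 2) ^ k * n := by
    rw [Real.rpow_add hn0, Real.rpow_one, Real.rpow_mul hn0.le, Real.rpow_two, Real.rpow_natCast]
  have hQ : n ^ (μ + 2 * k + 1 : ℝ) = n ^ μ * ((n ^ 2) ^ k * n) := by
    rw [add_assoc, Real.rpow_add hn0, hP]
  have h1 : n ^ (μ - 1) = n ^ μ / n := Real.rpow_sub_one hn0.ne' μ
  have h2 : n ^ (μ - 2) = n ^ μ / n ^ 2 := by rw [Real.rpow_sub hn0, Real.rpow_two]
  have hX : 0 < n ^ μ := Real.rpow_pos_of_pos hn0 _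
  rw [hP, hQ, h1, h2]
  have hk : (0 : ℝ) ≤ 2 * k := by positivity
  have e2 : n ^ μ / (n ^ 2) ^ (k + 1) * (((n ^ 2) ^ k * n - 1) / (2 * k + 1))
      - 1 / (n ^ 2) ^ (k + 1) * ((n ^ μ * ((n ^ 2) ^ k * n) - 1) / (μ + 2 * k + 1))
      = n ^ μ / n * (1 / (2 * k + 1) - 1 / (2 * k + 1 + μ))
        - n ^ μ / n ^ 2 * (1 / (n ^ 2) ^ k) * (1 / (2 * k + 1))
        + 1 / (n ^ 2) ^ (k + 1) * (1 / (μ + 2 * k + 1)) := by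
    have : μ + 2 * k + 1 ≠ 0 := by positivity
    have : 2 * k + 1 + μ ≠ 0 := by positivity
    generalize n ^ μ = X at *
    field_simp
    ring
  rw [e2]
  have h3 : 1 / (n ^ 2) ^ k ≤ 1 := by
    rw [div_le_one (by positivity)]
    exact one_le_pow₀ (one_le_pow₀ hn)
  have h4 : 1 / (2 * k + 1 : ℝ) ≤ 1 := by
    rw [div_le_one (by positivity)]; linarith
  have h5 : n ^ μ / n ^ 2 * (1 / (n ^ 2) ^ k) * (1 / (2 * k + 1)) ≤ n ^ μ / n ^ 2 := by
    rw [mul_assoc]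
    exact mul_le_of_le_one_right (by positivity) (mul_le_one₀ h3 (by positivity) h4)
  have h6 : 0 ≤ 1 / (n ^ 2) ^ (k + 1) * (1 / (μ + 2 * k + 1)) := by positivity
  linarith

lemma tendsto_integral_highKernel {n μ : ℝ} (hn : 1 ≤ n) (hμ : μ < 1) (K : ℕ) :
    Filter.Tendsto (fun X : ℝ => ∫ t in n..X, highKernel n μ K t) Filter.atTop
      (nhds (n ^ (μ - 1) * ∑ k ∈ Finset.range K, (1 / (2 * k + 1 - μ) - 1 / (2 * k + 1 : ℝ)))) := by
  have hn0 : 0 < n := by linarith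
  have e : ∀ X, n ≤ X → ∑ k ∈ Finset.range K, ((n ^ 2) ^ k *
      ((X ^ (-(2 * k + 1 - μ)) - n ^ (-(2 * k + 1 - μ))) / (-(2 * k + 1 - μ)))
      - n ^ μ * (n ^ 2) ^ k * ((X ^ (-(2 * k + 1 : ℝ)) - n ^ (-(2 * k + 1 : ℝ))) / (-(2 * k + 1 : ℝ))))
      = ∫ t in n..X, highKernel n μ K t := fun X hX => by
    have h0 : (0 : ℝ) ∉ Set.uIcc n X := by
      rw [Set.uIcc_of_le hX]; intro h; linarith [h.1]
    have e : ∫ t in n..X, highKernel n μ K t = ∫ t in n..X, ∑ k ∈ Finset.range K,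
        ((n ^ 2) ^ k * t ^ (-(2 * k + 2 - μ)) - n ^ μ * (n ^ 2) ^ k * t ^ (-(2 * k + 2 : ℝ))) := by
      refine intervalIntegral.integral_congr fun t ht => ?_
      rw [Set.uIcc_of_le hX] at ht
      have ht0 : 0 < t := by linarith [ht.1]
      simp only [highKernel, Finset.mul_sum]
      refine Finset.sum_congr rfl fun k _ => ?_
      have h1 : t ^ (-(2 * k + 2 : ℝ)) = ((t ^ 2) ^ (k + 1))⁻¹ := by
        rw [Real.rpow_neg ht0.le, show (2 * k + 2 : ℝ) = 2 * ((k + 1 : ℕ) : ℝ) by push_cast; ring,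
          Real.rpow_mul ht0.le, Real.rpow_two, Real.rpow_natCast]
      have h2 : t ^ (-(2 * k + 2 - μ)) = t ^ μ * t ^ (-(2 * k + 2 : ℝ)) := by
        rw [← Real.rpow_add ht0]; congr 1; ring
      rw [h2, h1]
      ring
    have hi : ∀ r : ℝ, IntervalIntegrable (fun t : ℝ => t ^ r) volume n X := fun r =>
      intervalIntegral.intervalIntegrable_rpow (Or.inr h0)
    rw [e, intervalIntegral.integral_finsetSum fun k _ =>
      ((hi _).const_mul _).sub ((hi _).const_mul _)]
    refine Finset.sum_congr rfl fun k _ => ?_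
    have hk : (0 : ℝ) ≤ 2 * k := by positivity
    rw [intervalIntegral.integral_sub ((hi _).const_mul _) ((hi _).const_mul _),
      intervalIntegral.integral_const_mul, intervalIntegral.integral_const_mul,
      integral_rpow (Or.inr ⟨by intro h; linarith, h0⟩), integral_rpow (Or.inr ⟨by intro h; linarith, h0⟩),
      show -(2 * k + 2 - μ) + 1 = -(2 * k + 1 - μ) by ring,
      show -(2 * k + 2 : ℝ) + 1 = -(2 * k + 1) by ring]
  refine Filter.Tendsto.congr' (Filter.eventually_atTop.2 ⟨n, e⟩) ?_
  rw [Finset.mul_sum]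
  refine tendsto_finsetSum _ fun k _ => ?_
  have hk : (0 : ℝ) ≤ 2 * k := by positivity
  have h1 := tendsto_rpow_neg_atTop (y := 2 * k + 1 - μ) (by linarith)
  have h2 := tendsto_rpow_neg_atTop (y := 2 * k + 1) (by linarith)
  have h3 := (((h1.sub_const (n ^ (-(2 * k + 1 - μ)))).div_const (-(2 * k + 1 - μ))).const_mul
    ((n ^ 2) ^ k)).sub (((h2.sub_const (n ^ (-(2 * k + 1 : ℝ)))).div_const (-(2 * k + 1 : ℝ))).const_mul
    (n ^ μ * (n ^ 2) ^ k))
  refine h3.trans (le_of_eq (congrArg nhds ?_))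
  have hP : n ^ (-(2 * k + 1 : ℝ)) = ((n ^ 2) ^ k * n)⁻¹ := by
    rw [Real.rpow_neg hn0.le, Real.rpow_add hn0, Real.rpow_one, Real.rpow_mul hn0.le, Real.rpow_two,
      Real.rpow_natCast]
  have hQ : n ^ (-(2 * k + 1 - μ)) = n ^ μ * ((n ^ 2) ^ k * n)⁻¹ := by
    rw [← hP, ← Real.rpow_add hn0]; congr 1; ring
  have h4 : n ^ (μ - 1) = n ^ μ / n := Real.rpow_sub_one hn0.ne' μ
  rw [hP, hQ, h4]
  have h5 : 2 * k + 1 - μ ≠ 0 := by linarith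
  have h6 : -(2 * k + 1 - μ) ≠ 0 := by linarith
  generalize n ^ μ = Y at *
  rw [div_neg, div_neg]
  field_simp
  ring

lemma tendsto_sum_odd_telescope (j : ℕ) :
    Filter.Tendsto (fun I : ℕ => ∑ i ∈ Finset.range I,
      (1 / (2 * (i - j : ℝ) + 1) - 1 / (2 * (i + j : ℝ) + 1))) Filter.atTop (nhds 0) := by
  have hz : ∀ c : ℝ, Filter.Tendsto (fun I : ℕ => 1 / (2 * (I + c : ℝ) + 1)) Filter.atTop (nhds 0) := by
    intro c
    refine Filter.Tendsto.div_atTop tendsto_const_nhds ?_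
    exact Filter.tendsto_atTop_add_const_right _ _ (Filter.Tendsto.const_mul_atTop two_pos
      (Filter.tendsto_atTop_add_const_right _ _ tendsto_natCast_atTop_atTop))
  induction j with
  | zero => simp
  | succ j ih =>
    have h := ((ih.sub (hz (-j - 1))).sub (hz j))
    rw [sub_zero, sub_zero] at h
    refine h.congr fun I => ?_
    induction I with
    | zero =>
      simp only [Finset.range_zero, Finset.sum_empty, Nat.cast_zero, zero_add, zero_sub]
      rw [show 2 * (-(j : ℝ) - 1) + 1 = -(2 * j + 1) by ring, one_div_neg_eq_neg_one_div]
      ring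
    | succ I ih =>
      rw [Finset.sum_range_succ, Finset.sum_range_succ, ← ih]
      generalize ∑ i ∈ Finset.range I, (1 / (2 * (i - j : ℝ) + 1) - 1 / (2 * (i + j : ℝ) + 1)) = S
      push_cast
      ring

lemma tendsto_sum_one_div_odd_sq_sub (k : ℕ) :
    Filter.Tendsto (fun I : ℕ => ∑ i ∈ Finset.range I,
      1 / ((2 * i + 1 : ℝ) ^ 2 - (2 * (k + 1) : ℝ) ^ 2)) Filter.atTop (nhds 0) := by
  have h := (tendsto_sum_odd_telescope (k + 1)).const_mul (1 / (4 * (k + 1) : ℝ))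
  rw [mul_zero] at h
  refine h.congr fun I => ?_
  rw [Finset.mul_sum]
  refine Finset.sum_congr rfl fun i _ => ?_
  have h1 : (2 * (i : ℝ) + 1) - 2 * (k + 1) ≠ 0 := by
    have : (2 * i + 1 - 2 * (k + 1) : ℤ) ≠ 0 := by omega
    exact_mod_cast this
  have h2 : (2 * (i : ℝ) + 1) + 2 * (k + 1) ≠ 0 := by positivity
  have h3 : (k + 1 : ℝ) ≠ 0 := by positivity
  rw [sq_sub_sq, Nat.cast_add, Nat.cast_one, show 2 * (i - (k + 1) : ℝ) + 1 = 2 * i + 1 - 2 * (k + 1) by ring,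
    show 2 * (i + (k + 1) : ℝ) + 1 = 2 * i + 1 + 2 * (k + 1) by ring]
  have h4 : 4 * (k + 1 : ℝ) = (2 * i + 1 + 2 * (k + 1)) - (2 * i + 1 - 2 * (k + 1)) := by ring
  have h5 : 4 * (k + 1 : ℝ) ≠ 0 := by positivity
  generalize (2 * (i : ℝ) + 1) + 2 * (k + 1) = u at *
  generalize (2 * (i : ℝ) + 1) - 2 * (k + 1) = v at *
  rw [one_div_mul_eq_div, div_sub_div _ _ h1 h2, h4, div_div, one_mul, mul_one]
  rw [h4] at h5
  field_simp

/-- The odd extremal sequence supported on the odd integers. -/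
def oddPowerSeq (μ : ℝ) (m : ℤ) : ℂ :=
  ((if Odd m then (m.sign : ℝ) * |(m : ℝ)| ^ (μ - 1) else 0 : ℝ) : ℂ)

lemma oddPowerSeq_odd (μ : ℝ) (i : ℕ) :
    oddPowerSeq μ (2 * i + 1) = (((2 * i + 1 : ℝ) ^ (μ - 1) : ℝ) : ℂ) := by
  have h1 : Odd (2 * (i : ℤ) + 1) := ⟨_, rfl⟩
  have h2 : (2 * (i : ℤ) + 1).sign = 1 := Int.sign_eq_one_of_pos (by positivity)
  have h3 : |((2 * (i : ℤ) + 1 : ℤ) : ℝ)| = 2 * i + 1 := by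
    push_cast; exact abs_of_pos (by positivity)
  rw [oddPowerSeq, if_pos h1, h2, h3]
  simp

lemma oddPowerSeq_neg (μ : ℝ) (m : ℤ) : oddPowerSeq μ (-m) = -oddPowerSeq μ m := by
  unfold oddPowerSeq
  rw [Int.sign_neg, Int.cast_neg, Int.cast_neg, abs_neg]
  simp only [odd_neg]
  split_ifs <;> simp

lemma oddPowerSeq_neg_odd (μ : ℝ) (i : ℕ) :
    oddPowerSeq μ (2 * (-((i : ℤ) + 1)) + 1) = -(((2 * i + 1 : ℝ) ^ (μ - 1) : ℝ) : ℂ) := by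
  rw [← oddPowerSeq_odd, ← oddPowerSeq_neg]
  ring_nf

lemma oddPowerSeq_even (μ : ℝ) (m : ℤ) : oddPowerSeq μ (2 * m) = 0 := by
  rw [oddPowerSeq, if_neg (by simp [parity_simps])]
  simp

lemma KT_neg {a : ℤ → ℂ} (ha : ∀ m, a (-m) = -a m) (n : ℤ) : KT a (-n) = KT a n := by
  let e : {m : ℤ // Odd m} ≃ {m : ℤ // Odd m} :=
    (Equiv.neg ℤ).subtypeEquiv fun m => by simp
  rw [KT, KT, ← e.tsum_eq]
  congr 1
  refine tsum_congr fun m => ?_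
  have : ((e m : {m : ℤ // Odd m}) : ℤ) = -(m : ℤ) := rfl
  rw [this, show -n - -(m : ℤ) = -(n - m) by ring, ha]
  push_cast
  rw [neg_div_neg_eq]

lemma norm_oddPowerSeq_odd (μ : ℝ) (i : ℕ) (p : ℝ) :
    ‖oddPowerSeq μ (2 * i + 1)‖ ^ p = (2 * i + 1 : ℝ) ^ ((μ - 1) * p) := by
  rw [oddPowerSeq_odd, Complex.norm_real, Real.norm_of_nonneg (by positivity),
    Real.rpow_mul (by positivity)]

lemma summable_odd_rpow {r : ℝ} (hr : r < -1) : Summable fun i : ℕ => (2 * i + 1 : ℝ) ^ r := by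
  have h := (Real.summable_nat_rpow.2 hr).comp_injective
    (i := fun i : ℕ => 2 * i + 1) fun i j h => by simpa using h
  refine h.congr fun i => ?_
  simp

lemma hasSum_norm_oddPowerSeq {μ p : ℝ} (hp : 0 < p) (h : (μ - 1) * p < -1) :
    HasSum (fun m => ‖oddPowerSeq μ m‖ ^ p) (2 * ∑' i : ℕ, (2 * i + 1 : ℝ) ^ ((μ - 1) * p)) := by
  have hs := (summable_odd_rpow h).hasSum
  have h1 : HasSum (fun k : ℤ => ‖oddPowerSeq μ (2 * k + 1)‖ ^ p)
      (2 * ∑' i : ℕ, (2 * i + 1 : ℝ) ^ ((μ - 1) * p)) := by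
    rw [two_mul]
    refine HasSum.of_nat_of_neg_add_one ?_ ?_
    · simpa only [norm_oddPowerSeq_odd] using hs
    · simp only [oddPowerSeq_neg_odd, ← oddPowerSeq_odd, norm_neg]
      simpa only [norm_oddPowerSeq_odd] using hs
  have h0 : HasSum (fun k : ℤ => ‖oddPowerSeq μ (2 * k)‖ ^ p) 0 := by
    simp only [oddPowerSeq_even, norm_zero, Real.zero_rpow hp.ne']
    exact hasSum_zero
  simpa using hasSum_int_even_add_odd (f := fun m => ‖oddPowerSeq μ m‖ ^ p) h0 h1

lemma hasSum_KT_oddPowerSeq {μ p : ℝ} (hp : 1 < p) (h : (μ - 1) * p < -1) (k : ℕ) :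
    HasSum (fun i : ℕ => 4 / Real.pi * ((2 * i + 1 : ℝ) ^ μ
      / ((2 * i + 1 : ℝ) ^ 2 - (2 * (k + 1) : ℝ) ^ 2))) (-(KT (oddPowerSeq μ) (2 * (k + 1))).re) := by
  have hs : Summable fun m : ℤ => ‖oddPowerSeq μ (2 * m + 1)‖ ^ p :=
    (hasSum_norm_oddPowerSeq (by linarith) h).summable.comp_injective (i := fun k : ℤ => 2 * k + 1)
      ((add_left_injective 1).comp (mul_right_injective₀ (two_ne_zero' ℤ)))
  have h1 := (summable_div_add_half hp hs k).hasSum.nat_add_neg_add_one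
  rw [← KT_even] at h1
  have h2 := (Complex.hasSum_re h1).neg
  refine (congrArg (fun f => HasSum f _) (funext fun i => ?_)).mp h2
  rw [oddPowerSeq_odd, oddPowerSeq_neg_odd, ← Complex.ofReal_neg, ← Complex.ofReal_mul,
    ← Complex.ofReal_mul, ← Complex.ofReal_add, Complex.ofReal_re]
  have hM : (0 : ℝ) < 2 * i + 1 := by positivity
  have e1 : (2 * i + 1 : ℝ) ^ μ = (2 * i + 1) ^ (μ - 1) * (2 * i + 1) := by
    rw [Real.rpow_sub_one hM.ne', div_mul_cancel₀ _ hM.ne']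
  have h3 : (2 * (i : ℝ) + 1) - 2 * (k + 1) ≠ 0 := by
    have : (2 * i + 1 - 2 * (k + 1) : ℤ) ≠ 0 := by omega
    exact_mod_cast this
  have h4 : (2 * (i : ℝ) + 1) + 2 * (k + 1) ≠ 0 := by positivity
  push_cast
  rw [e1, sq_sub_sq, show (k - i + 1 / 2 : ℝ) = -(2 * i + 1 - 2 * (k + 1)) / 2 by ring,
    show (k - -(i + 1) + 1 / 2 : ℝ) = (2 * i + 1 + 2 * (k + 1)) / 2 by ring]
  have hpi := Real.pi_ne_zero
  generalize ((2 * i + 1 : ℝ) ^ (μ - 1)) = Y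
  have e2 : (2 * i + 1 : ℝ) = ((2 * i + 1 + 2 * (k + 1)) + (2 * i + 1 - 2 * (k + 1))) / 2 := by ring
  rw [mul_comm Y]
  generalize (2 * (i : ℝ) + 1) + 2 * (k + 1) = u at *
  generalize (2 * (i : ℝ) + 1) - 2 * (k + 1) = v at *
  rw [e2]
  field_simp
  ring

lemma le_norm_KT_oddPowerSeq {μ p : ℝ} (hp : 1 < p) (h : (μ - 1) * p < -1) (h0 : 0 ≤ μ)
    (h1 : μ < 1) (k K : ℕ) :
    (2 * (k + 1) : ℝ) ^ (μ - 1) * (2 / Real.pi *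
      (∑ j ∈ Finset.range K, (1 / (2 * j + 1 - μ) - 1 / (2 * j + 1 + μ)) - K / (2 * (k + 1))))
      ≤ ‖KT (oddPowerSeq μ) (2 * (k + 1))‖ := by
  refine le_trans ?_ ((neg_le_abs _).trans (Complex.abs_re_le_norm _))
  set n : ℝ := 2 * (k + 1) with hn
  have hk : (0 : ℝ) ≤ k := by positivity
  have hn1 : 1 ≤ n := by rw [hn]; linarith
  have hn0 : 0 < n := by linarith
  have hS := (hasSum_KT_oddPowerSeq hp h k).tendsto_sum_nat.sub
    ((tendsto_sum_one_div_odd_sq_sub k).const_mul (4 / Real.pi * n ^ μ))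
  rw [mul_zero, sub_zero] at hS
  have hX : Filter.Tendsto (fun I : ℕ => (2 * I + 1 : ℝ)) Filter.atTop Filter.atTop :=
    Filter.tendsto_atTop_add_const_right _ _ (Filter.Tendsto.const_mul_atTop two_pos
      tendsto_natCast_atTop_atTop)
  have hH := (((tendsto_integral_highKernel hn1 h1 K).comp hX).const_add
    (∫ t in (1 : ℝ)..n, lowKernel n μ K t)).const_mul (2 / Real.pi)
  have hint : ∀ a b : ℝ, IntervalIntegrable (gluedKernel n μ K) volume a b := fun a b =>
    (continuous_gluedKernel hn0 h0 K).intervalIntegrable a b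
  have hle := le_of_tendsto_of_tendsto hH hS ?_
  · refine le_trans ?_ hle
    have hL := le_integral_lowKernel hn1 h0 K
    have e : n ^ (μ - 1) * (2 / Real.pi *
        (∑ j ∈ Finset.range K, (1 / (2 * j + 1 - μ) - 1 / (2 * j + 1 + μ)) - K / n))
        = 2 / Real.pi * ((n ^ (μ - 1) * ∑ k ∈ Finset.range K, (1 / (2 * k + 1 : ℝ) - 1 / (2 * k + 1 + μ))
          - K * n ^ (μ - 2)) + n ^ (μ - 1) * ∑ k ∈ Finset.range K, (1 / (2 * k + 1 - μ) - 1 / (2 * k + 1 : ℝ))) := by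
      rw [show μ - 2 = μ - 1 - 1 by ring, Real.rpow_sub_one hn0.ne' (μ - 1)]
      simp only [Finset.sum_sub_distrib]
      ring
    rw [e]
    gcongr
  · filter_upwards [Filter.eventually_ge_atTop (k + 1)] with I hI
    have hI' : n ≤ 2 * I + 1 := by
      have : ((k + 1 : ℕ) : ℝ) ≤ I := by exact_mod_cast hI
      push_cast at this
      rw [hn]; linarith
    have hg := integral_gluedKernel_le_sum hn0 h0 (by linarith) K I fun i hi => by
      rw [hn] at hi
      have : (2 * i + 1 : ℤ) = 2 * (k + 1) := by exact_mod_cast hi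
      omega
    have e1 : ∫ t in (1 : ℝ)..n, lowKernel n μ K t = ∫ t in (1 : ℝ)..n, gluedKernel n μ K t :=
      intervalIntegral.integral_congr fun t ht => by
        rw [Set.uIcc_of_le hn1] at ht
        exact (gluedKernel_of_le ht.2 K).symm
    have e2 : ∫ t in n..(2 * I + 1 : ℝ), highKernel n μ K t
        = ∫ t in n..(2 * I + 1 : ℝ), gluedKernel n μ K t :=
      intervalIntegral.integral_congr fun t ht => by
        rw [Set.uIcc_of_le hI'] at ht
        exact (gluedKernel_of_ge ht.1 K).symm
    simp only [Function.comp_apply]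
    rw [e1, e2, intervalIntegral.integral_add_adjacent_intervals (hint _ _) (hint _ _)]
    refine (mul_le_mul_of_nonneg_left hg (by positivity)).trans (le_of_eq ?_)
    rw [Finset.mul_sum, Finset.mul_sum, ← Finset.sum_sub_distrib]
    exact Finset.sum_congr rfl fun i _ => by ring

lemma oddPowerSeq_test {μ p D C : ℝ} (hp : 1 < p) (h : (μ - 1) * p < -1) (h0 : 0 ≤ μ)
    (h1 : μ < 1) (K J : ℕ) (hC : 0 ≤ C) (hK : MemLpZ p (KT (oddPowerSeq μ)))
    (hle : _root_.lpNorm p (KT (oddPowerSeq μ)) ≤ C * _root_.lpNorm p (oddPowerSeq μ)) (hD : 0 ≤ D)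
    (hDle : D ≤ 2 / Real.pi *
      (∑ j ∈ Finset.range K, (1 / (2 * j + 1 - μ) - 1 / (2 * j + 1 + μ)) - K / (2 * (J + 1)))) :
    D ^ p * (∑' i : ℕ, (2 * i + 1 : ℝ) ^ ((μ - 1) * p) - (J + 1))
      ≤ C ^ p * ∑' i : ℕ, (2 * i + 1 : ℝ) ^ ((μ - 1) * p) := by
  have hp0 : 0 < p := by linarith
  have hr : (μ - 1) * p ≤ 0 := by linarith
  set Z := ∑' i : ℕ, (2 * i + 1 : ℝ) ^ ((μ - 1) * p) with hZ
  have hzs := summable_odd_rpow h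
  have hZ0 : 0 ≤ Z := tsum_nonneg fun i => by positivity
  have hA := hasSum_norm_oddPowerSeq hp0 h
  have hT0 : 0 ≤ ∑' m, ‖KT (oddPowerSeq μ) m‖ ^ p := tsum_nonneg fun i => by positivity
  have hup : ∑' m, ‖KT (oddPowerSeq μ) m‖ ^ p ≤ C ^ p * (2 * Z) := by
    have h2 := Real.rpow_le_rpow (Real.rpow_nonneg hT0 _) hle hp0.le
    rwa [_root_.lpNorm, hA.tsum_eq, Real.mul_rpow hC (Real.rpow_nonneg (by positivity) _),
      ← Real.rpow_mul hT0, ← Real.rpow_mul (by positivity), one_div_mul_cancel hp0.ne',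
      Real.rpow_one, Real.rpow_one] at h2
  have hinj := mul_right_injective₀ (two_ne_zero' ℤ)
  have hKe : Summable fun k : ℤ => ‖KT (oddPowerSeq μ) (2 * k)‖ ^ p :=
    hK.comp_injective (i := fun k : ℤ => 2 * k) hinj
  have hev : ∑' k : ℤ, ‖KT (oddPowerSeq μ) (2 * k)‖ ^ p ≤ ∑' m, ‖KT (oddPowerSeq μ) m‖ ^ p :=
    tsum_comp_le_tsum_of_inj hK (fun m => by positivity) hinj
  have hfold := hKe.hasSum.nat_add_neg
  have hsymm : ∀ k : ℤ, ‖KT (oddPowerSeq μ) (2 * -k)‖ = ‖KT (oddPowerSeq μ) (2 * k)‖ := fun k => by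
    rw [mul_neg, KT_neg (oddPowerSeq_neg μ)]
  simp only [hsymm, ← two_mul] at hfold
  have hnat : Summable fun k : ℕ => ‖KT (oddPowerSeq μ) (2 * k)‖ ^ p :=
    hKe.comp_injective (i := fun k : ℕ => (k : ℤ)) Nat.cast_injective
  have hsplit := hnat.sum_add_tsum_nat_add (J + 1)
  rw [Finset.sum_range_succ'] at hsplit
  have hS0 : 0 ≤ ∑ k ∈ Finset.range J, ‖KT (oddPowerSeq μ) (2 * ((k + 1 : ℕ) : ℤ))‖ ^ p :=
    Finset.sum_nonneg fun k _ => by positivity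
  have hf0 : 0 ≤ ‖KT (oddPowerSeq μ) (2 * 0)‖ ^ p := by positivity
  have hfe := hfold.tsum_eq
  rw [tsum_mul_left] at hfe
  have htail : D ^ p * ∑' k : ℕ, (2 * ((k + (J + 1) : ℕ) : ℝ) + 1) ^ ((μ - 1) * p)
      ≤ ∑' k : ℕ, ‖KT (oddPowerSeq μ) (2 * ((k + (J + 1) : ℕ) : ℤ))‖ ^ p := by
    rw [← tsum_mul_left]
    refine Summable.tsum_le_tsum (fun k => ?_) (((summable_nat_add_iff (J + 1)).2 hzs).mul_left _)
      ((summable_nat_add_iff (J + 1)).2 hnat)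
    have hn : (0 : ℝ) < 2 * ((k + J : ℕ) + 1) := by positivity
    have h2 := le_norm_KT_oddPowerSeq hp h h0 h1 (k + J) K
    have h3 : (2 * ((k + J : ℕ) + 1) : ℝ) ^ (μ - 1) * D
        ≤ ‖KT (oddPowerSeq μ) (2 * ((k + J : ℕ) + 1))‖ := by
      refine le_trans ?_ h2
      gcongr
      refine hDle.trans ?_
      gcongr
      linarith
    have h4 := Real.rpow_le_rpow (by positivity) h3 hp0.le
    rw [Real.mul_rpow (by positivity) hD, ← Real.rpow_mul hn.le] at h4
    have h5 := Real.rpow_le_rpow_of_nonpos hn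
      (show (2 * ((k + J : ℕ) + 1) : ℝ) ≤ 2 * ((k + (J + 1) : ℕ) : ℝ) + 1 by push_cast; linarith) hr
    have h6 : 0 ≤ D ^ p := by positivity
    rw [show (2 * ((k + (J + 1) : ℕ) : ℤ)) = 2 * ((k + J : ℕ) + 1) by push_cast; ring]
    nlinarith
  have hz := hzs.sum_add_tsum_nat_add (J + 1)
  have hz1 : ∑ i ∈ Finset.range (J + 1), (2 * i + 1 : ℝ) ^ ((μ - 1) * p) ≤ J + 1 := by
    refine (Finset.sum_le_card_nsmul _ _ 1 fun i _ => ?_).trans (le_of_eq (by simp))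
    exact Real.rpow_le_one_of_one_le_of_nonpos (by linarith [show (0 : ℝ) ≤ i by positivity]) hr
  have h7 : D ^ p * (Z - (J + 1))
      ≤ D ^ p * ∑' k : ℕ, (2 * ((k + (J + 1) : ℕ) : ℝ) + 1) ^ ((μ - 1) * p) := by
    gcongr
    linarith
  simp only [Nat.cast_zero] at hsplit
  linarith

lemma not_bddAbove_sum_odd_inv (B : ℝ) :
    ¬ ∀ I : ℕ, ∑ i ∈ Finset.range I, (2 * i + 1 : ℝ) ^ (-1 : ℝ) ≤ B := fun h => by
  have h1 := summable_of_sum_range_le (fun i => by positivity) h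
  refine Real.not_summable_one_div_natCast ((summable_nat_add_iff 1).1 ?_)
  refine Summable.of_nonneg_of_le (fun i => by positivity) (fun i => ?_) (h1.mul_left 2)
  rw [Real.rpow_neg_one, ← div_eq_mul_inv, div_le_div_iff₀ (by positivity) (by positivity)]
  push_cast
  linarith

lemma kernel_sum_le_of_test {p C : ℝ} (hp : 1 < p) (hC : 0 ≤ C)
    (hK : ∀ a, MemLpZ p a → MemLpZ p (KT a))
    (hle : ∀ a, MemLpZ p a → _root_.lpNorm p (KT a) ≤ C * _root_.lpNorm p a) (K J : ℕ) :
    2 / Real.pi * (∑ j ∈ Finset.range K, (1 / (2 * j + 1 / p) - 1 / (2 * j + 2 - 1 / p))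
      - K / (2 * (J + 1))) ≤ C := by
  have hp0 : 0 < p := by linarith
  have hp1 : 1 / p < 1 := (div_lt_one hp0).2 hp
  have hp2 : 0 < 1 / p := by positivity
  let D : ℝ → ℝ := fun μ => 2 / Real.pi *
    (∑ j ∈ Finset.range K, (1 / (2 * j + 1 - μ) - 1 / (2 * j + 1 + μ)) - K / (2 * (J + 1)))
  set ν := 1 - 1 / p with hν
  have hDν : D ν = 2 / Real.pi * (∑ j ∈ Finset.range K, (1 / (2 * j + 1 / p) - 1 / (2 * j + 2 - 1 / p))
      - K / (2 * (J + 1))) := by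
    simp only [D, hν]
    congr 3
    ext j
    ring_nf
  rw [← hDν]
  have hcont : ContinuousAt D ν := by
    have h1 : ∀ j ∈ Finset.range K, ContinuousAt (fun μ : ℝ => 1 / (2 * j + 1 - μ) - 1 / (2 * j + 1 + μ)) ν := by
      intro j _
      have hj : (0 : ℝ) ≤ 2 * j := by positivity
      refine ContinuousAt.sub (ContinuousAt.div (by fun_prop) (by fun_prop) ?_)
        (ContinuousAt.div (by fun_prop) (by fun_prop) ?_)
      · rw [hν]; linarith
      · rw [hν]; linarith
    have h2 : ContinuousAt (fun μ : ℝ => ∑ j ∈ Finset.range K,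
        (1 / (2 * j + 1 - μ) - 1 / (2 * j + 1 + μ))) ν := tendsto_finsetSum _ h1
    exact continuousAt_const.mul (h2.sub continuousAt_const)
  by_contra! hlt
  obtain ⟨E, hCE, hED⟩ := exists_between hlt
  have hE : 0 < E := by linarith
  have hpow : C ^ p < E ^ p := Real.rpow_lt_rpow hC hCE hp0
  refine not_bddAbove_sum_odd_inv (max (E ^ p * (J + 1) / (E ^ p - C ^ p)) (J + 1)) fun I => ?_
  have hlim : Filter.Tendsto (fun μ : ℝ => ∑ i ∈ Finset.range I, (2 * i + 1 : ℝ) ^ ((μ - 1) * p))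
      (nhdsWithin ν (Set.Iio ν)) (nhds (∑ i ∈ Finset.range I, (2 * i + 1 : ℝ) ^ (-1 : ℝ))) := by
    have hc : Continuous fun μ : ℝ => ∑ i ∈ Finset.range I, (2 * i + 1 : ℝ) ^ ((μ - 1) * p) :=
      continuous_finsetSum _ fun i _ =>
        Continuous.rpow continuous_const (by fun_prop) fun _ => Or.inl (by positivity)
    have := hc.tendsto ν
    rw [show (ν - 1) * p = -1 by rw [hν]; field_simp; ring] at this
    exact this.mono_left nhdsWithin_le_nhds
  refine le_of_tendsto hlim ?_
  filter_upwards [self_mem_nhdsWithin, nhdsWithin_le_nhds (hcont.eventually (lt_mem_nhds hED)),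
    nhdsWithin_le_nhds (lt_mem_nhds (show 0 < ν by rw [hν]; linarith))] with μ hμ hEμ hμ0
  have hr : (μ - 1) * p < -1 := by
    have : (μ - 1) * p < (ν - 1) * p := by
      have : μ < ν := hμ
      gcongr
    rwa [show (ν - 1) * p = -1 by rw [hν]; field_simp; ring] at this
  have hmem : MemLpZ p (oddPowerSeq μ) := (hasSum_norm_oddPowerSeq hp0 hr).summable
  have hμ1 : μ < 1 := by
    have : μ < ν := hμ
    linarith
  have ht := oddPowerSeq_test hp hr hμ0.le hμ1 K J hC (hK _ hmem) (hle _ hmem) hE.le hEμ.le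
  refine ((summable_odd_rpow hr).sum_le_tsum _ fun i _ => by positivity).trans (le_max_of_le_left ?_)
  rw [le_div_iff₀ (sub_pos.2 hpow)]
  linarith

lemma tendsto_kernel_sum {x : ℝ} (h0 : 0 < x) (h1 : x < 1) :
    Filter.Tendsto (fun K : ℕ => 2 / Real.pi *
      ∑ j ∈ Finset.range K, (1 / (2 * j + x) - 1 / (2 * j + 2 - x))) Filter.atTop
      (nhds (Real.cot (Real.pi * x / 2))) := by
  have hz : ((x / 2 : ℝ) : ℂ) ∈ Complex.integerComplement := by
    rintro ⟨m, hm⟩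
    have hm' : (m : ℝ) = x / 2 := by exact_mod_cast hm
    have h2 : (0 : ℝ) < m := by rw [hm']; linarith
    have h3 : (m : ℝ) < 1 := by rw [hm']; linarith
    have h4 : 0 < m := by exact_mod_cast h2
    have h5 : m < 1 := by exact_mod_cast h3
    omega
  have h := Complex.continuous_re.continuousAt.tendsto.comp (tendsto_logDeriv_euler_cot_sub hz)
  have e : (Real.pi * Complex.cot (Real.pi * ((x / 2 : ℝ) : ℂ)) - 1 / ((x / 2 : ℝ) : ℂ)).re
      = Real.pi * Real.cot (Real.pi * x / 2) - 2 / x := by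
    rw [← Complex.ofReal_mul, ← Complex.ofReal_cot, ← Complex.ofReal_mul, ← Complex.ofReal_one,
      ← Complex.ofReal_div, ← Complex.ofReal_sub, Complex.ofReal_re, mul_div_assoc, one_div_div]
  rw [e] at h
  have hr : Filter.Tendsto (fun K : ℕ => 1 / ((K : ℝ) + x / 2)) Filter.atTop (nhds 0) :=
    Filter.Tendsto.div_atTop tendsto_const_nhds
      (Filter.tendsto_atTop_add_const_right _ _ tendsto_natCast_atTop_atTop)
  have h2 := ((h.add_const (2 / x)).sub hr).const_mul (1 / Real.pi)
  rw [sub_add_cancel, sub_zero, ← mul_assoc, one_div_mul_cancel Real.pi_ne_zero, one_mul] at h2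
  refine h2.congr fun K => ?_
  have hpi := Real.pi_ne_zero
  suffices hs : (∑ j ∈ Finset.range K, cotTerm ((x / 2 : ℝ) : ℂ) j).re + 2 / x - 1 / ((K : ℝ) + x / 2)
      = 2 * ∑ j ∈ Finset.range K, (1 / (2 * j + x) - 1 / (2 * j + 2 - x)) by
    simp only [Function.comp_apply]
    rw [hs]
    ring
  induction K with
  | zero => simp
  | succ K ih =>
    have hK : (0 : ℝ) ≤ K := by positivity
    have e2 : (cotTerm ((x / 2 : ℝ) : ℂ) K).re = 1 / (x / 2 - (K + 1)) + 1 / (x / 2 + (K + 1)) := by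
      have : cotTerm ((x / 2 : ℝ) : ℂ) K = ((1 / (x / 2 - (K + 1)) + 1 / (x / 2 + (K + 1)) : ℝ) : ℂ) := by
        simp [cotTerm]
      rw [this, Complex.ofReal_re]
    rw [Finset.sum_range_succ, Finset.sum_range_succ, mul_add, ← ih, Complex.add_re, e2]
    have e3 : 1 / (x / 2 - (K + 1)) = -(2 * (1 / (2 * K + 2 - x))) := by
      have h3 : 2 * K + 2 - x ≠ 0 := by linarith
      rw [show x / 2 - (K + 1) = -((2 * K + 2 - x) / 2) by ring]
      field_simp
    have e4 : 1 / ((K : ℝ) + x / 2) = 2 * (1 / (2 * K + x)) := by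
      have h3 : 2 * K + x ≠ 0 := by positivity
      rw [show K + x / 2 = (2 * K + x) / 2 by ring]
      field_simp
    rw [e3, e4]
    push_cast
    ring

lemma cot_le_of_test {p C : ℝ} (hp : 1 < p) (hC : 0 ≤ C)
    (hK : ∀ a, MemLpZ p a → MemLpZ p (KT a))
    (hle : ∀ a, MemLpZ p a → _root_.lpNorm p (KT a) ≤ C * _root_.lpNorm p a) :
    Real.cot (Real.pi / (2 * p)) ≤ C := by
  have hp0 : 0 < p := by linarith
  have hlim := tendsto_kernel_sum (x := 1 / p) (by positivity) ((div_lt_one hp0).2 hp)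
  rw [mul_one_div, div_div, mul_comm p] at hlim
  refine le_of_tendsto' hlim fun K => ?_
  have hJ : Filter.Tendsto (fun J : ℕ => (K : ℝ) / (2 * (J + 1))) Filter.atTop (nhds 0) :=
    Filter.Tendsto.div_atTop tendsto_const_nhds (Filter.Tendsto.const_mul_atTop two_pos
      (Filter.tendsto_atTop_add_const_right _ _ tendsto_natCast_atTop_atTop))
  have h := (hJ.const_sub (∑ j ∈ Finset.range K, (1 / (2 * j + 1 / p) - 1 / (2 * j + 2 - 1 / p)))).const_mul
    (2 / Real.pi)
  rw [sub_zero] at h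
  exact le_of_tendsto' h fun J => kernel_sum_le_of_test hp hC hK hle K J

end KakHilbert

/-- For positive even integer p, the operator norm of 𝓚 on ℓ^p equals cot(π/(2p)). -/
theorem kak_norm_even (p : ℕ) (hp : 0 < p) (he : Even p) :
    opNormOn (p : ℝ) KT = Real.cot (Real.pi / (2 * (p : ℝ))) := by
  obtain ⟨n, rfl⟩ := he
  have hn : 0 < n := by omega
  have hn1 : (1 : ℝ) ≤ n := by exact_mod_cast hn
  have e : ((n + n : ℕ) : ℝ) = 2 * n := by push_cast; ring
  have e2 : Real.cot (Real.pi / (2 * (2 * n))) = Real.cot (Real.pi / (4 * n)) := by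
    congr 2; ring
  have hc := KakHilbert.cot_pi_div_nonneg hn
  rw [e, e2]
  refine le_antisymm (csInf_le ⟨0, fun C hC => hC.1⟩ ⟨hc, fun a ha => (KakHilbert.KT_bound hn ha).2⟩)
    (le_csInf ⟨_, hc, fun a ha => (KakHilbert.KT_bound hn ha).2⟩ fun C hC => ?_)
  rw [← e2]
  exact KakHilbert.cot_le_of_test (by linarith) hC.1 (fun a ha => (KakHilbert.KT_bound hn ha).1) hC.2

end
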